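/- arXiv:1609.08477 — 5 statements merged into one kernel-verified Lean document; each statement's English description precedes it below -/
import Mathlib

section
/- For every integer n ≥ 0 there exists a unique C² solution Q_n : ℝ → ℝ of the harmonic map ODE such that lim_{r→-∞} Q_n(r) = 0 and lim_{r→+∞} Q_n(r) = nπ. Moreover Q_0 is identically 0, and for n ≥ 1: Q_n is strictly increasing on ℝ, satisfies Q_n(r) + Q_n(-r) = nπ for all r ∈ ℝ, and there exist a constant α_n > 0 and C > 0 such that |Q_n(r) - nπ + α_n r^{-2}| ≤ C r^{-4} for all r ≥ 1 and |Q_n(r) - α_n r^{-2}| ≤ C |r|^{-4} for all r ≤ -1. -/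
open Real Filter MeasureTheory

/-- `F` is a (global, C²) solution of the harmonic map ODE
`F'' + (2r/(r²+1)) F' - sin(2F)/(r²+1) = 0` on the wormhole. -/
def IsHarmonicMapSol (F : ℝ → ℝ) : Prop :=
  ContDiff ℝ 2 F ∧
    ∀ r : ℝ, deriv (deriv F) r + (2 * r / (r ^ 2 + 1)) * deriv F r
      - Real.sin (2 * F r) / (r ^ 2 + 1) = 0

/-- First order system in the variable `r`. -/
def Sr (F W : ℝ → ℝ) : Prop :=
  ∀ r : ℝ, HasDerivAt F (W r / (r ^ 2 + 1)) r ∧ HasDerivAt W (Real.sin (2 * F r)) r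

/-- First order system in the variable `x`, `r = sinh x`. -/
def Sx (G p : ℝ → ℝ) : Prop :=
  ∀ x : ℝ, HasDerivAt G (p x) x ∧ HasDerivAt p (Real.sin (2 * G x) - Real.tanh x * p x) x

theorem Sr.of_sol {F : ℝ → ℝ} (h : IsHarmonicMapSol F) :
    Sr F (fun r => (r ^ 2 + 1) * deriv F r) := by
  intro r
  obtain ⟨hc, he⟩ := h
  have hpos : (0:ℝ) < r ^ 2 + 1 := by positivity
  have h1 : Differentiable ℝ F := hc.differentiable (by norm_num)
  have h2 : ContDiff ℝ 1 (deriv F) := by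
    have : ContDiff ℝ (1 + 1) F := by simpa [one_add_one_eq_two] using hc
    exact (contDiff_succ_iff_deriv.1 this).2.2
  have h3 : Differentiable ℝ (deriv F) := h2.differentiable (by norm_num)
  constructor
  · have := (h1 r).hasDerivAt
    refine this.congr_deriv ?_
    field_simp
  · have := ((((hasDerivAt_id r).pow 2).add_const 1).mul (h3 r).hasDerivAt)
    refine (this.congr_deriv ?_)
    have e := he r
    field_simp at e
    simp
    linarith

theorem Sr.to_sol {F W : ℝ → ℝ} (h : Sr F W) : IsHarmonicMapSol F := by
  have hd : deriv F = fun r => W r / (r ^ 2 + 1) := funext fun r => (h r).1.deriv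
  have hdW : deriv W = fun r => Real.sin (2 * F r) := funext fun r => (h r).2.deriv
  have hF : Differentiable ℝ F := fun r => (h r).1.differentiableAt
  have hW : Differentiable ℝ W := fun r => (h r).2.differentiableAt
  have hW1 : ContDiff ℝ 1 W := by
    rw [contDiff_one_iff_deriv]
    refine ⟨hW, ?_⟩
    rw [hdW]
    exact Real.continuous_sin.comp (continuous_const.mul hF.continuous)
  constructor
  · have : ContDiff ℝ (1 + 1) F := by
      rw [contDiff_succ_iff_deriv]
      refine ⟨hF, by simp, ?_⟩
      rw [hd]
      exact hW1.div (by fun_prop) (fun x => by positivity)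
    simpa [one_add_one_eq_two] using this
  · intro r
    have h2 := (h r).2.div (((hasDerivAt_id r).pow 2).add_const 1) (by simp; positivity)
    have h3 := h2.deriv
    have h4 : deriv (deriv F) r = deriv (W / fun x => ((id : ℝ → ℝ) ^ 2) x + 1) r := by
      rw [hd]; rfl
    rw [h4, h3, hd]
    have hpos : (0:ℝ) < r ^ 2 + 1 := by positivity
    simp
    field_simp
    ring

theorem Sr.toSx {F W : ℝ → ℝ} (h : Sr F W) :
    Sx (fun x => F (Real.sinh x)) (fun x => W (Real.sinh x) / Real.cosh x) := by
  intro x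
  have hc := Real.cosh_pos x
  have hsq : Real.sinh x ^ 2 + 1 = Real.cosh x ^ 2 := by rw [Real.cosh_sq]
  constructor
  · have := (h (Real.sinh x)).1.comp x (Real.hasDerivAt_sinh x)
    refine this.congr_deriv ?_
    rw [hsq]; field_simp
  · have := ((h (Real.sinh x)).2.comp x (Real.hasDerivAt_sinh x)).div (Real.hasDerivAt_cosh x) hc.ne'
    refine this.congr_deriv ?_
    rw [Real.tanh_eq_sinh_div_cosh]
    simp
    field_simp

theorem Sr.reflect {F W : ℝ → ℝ} (h : Sr F W) (n : ℕ) :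
    Sr (fun r => n * π - F (-r)) (fun r => W (-r)) := by
  intro r
  have hn := hasDerivAt_neg r
  constructor
  · have := ((h (-r)).1.comp r hn).const_sub (n * π)
    refine this.congr_deriv ?_
    simp
  · have := ((h (-r)).2.comp r hn)
    refine this.congr_deriv ?_
    have : 2 * (n * π - F (-r)) = - (2 * F (-r)) + n * (2 * π) := by ring
    rw [this, Real.sin_add_nat_mul_two_pi, Real.sin_neg]
    ring

/-- vector field -/
noncomputable def vf (t : ℝ) (z : ℝ × ℝ) : ℝ × ℝ := (z.2 / (t ^ 2 + 1), Real.sin (2 * z.1))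

theorem sin_sub_le (a b : ℝ) : |Real.sin a - Real.sin b| ≤ |a - b| := by
  have := Real.lipschitzWith_sin.dist_le_mul a b
  simpa [Real.dist_eq] using this

theorem vf_lip (t : ℝ) : LipschitzWith 2 (vf t) := by
  apply LipschitzWith.of_dist_le_mul
  intro z w
  have hpos : (1:ℝ) ≤ t ^ 2 + 1 := by nlinarith [sq_nonneg t]
  rw [Prod.dist_eq, Prod.dist_eq]
  simp only [vf, Real.dist_eq]
  have h1 : |z.1 - w.1| ≤ max |z.1 - w.1| |z.2 - w.2| := le_max_left _ _
  have h2 : |z.2 - w.2| ≤ max |z.1 - w.1| |z.2 - w.2| := le_max_right _ _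
  apply max_le
  · rw [← sub_div, abs_div, abs_of_pos (by linarith : (0:ℝ) < t^2+1)]
    have : |z.2 - w.2| / (t ^ 2 + 1) ≤ |z.2 - w.2| := div_le_self (abs_nonneg _) hpos
    have := abs_nonneg (z.2 - w.2)
    push_cast
    linarith
  · have := sin_sub_le (2 * z.1) (2 * w.1)
    rw [← mul_sub, abs_mul] at this
    push_cast
    norm_num at this ⊢
    linarith

theorem Sr.vf {F W : ℝ → ℝ} (h : Sr F W) (t : ℝ) :
    HasDerivAt (fun t => (F t, W t)) (vf t (F t, W t)) t :=
  (h t).1.prodMk (h t).2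

theorem Sr.unique {F W F' W' : ℝ → ℝ} (h : Sr F W) (h' : Sr F' W') (t₀ : ℝ)
    (h1 : F t₀ = F' t₀) (h2 : W t₀ = W' t₀) : F = F' ∧ W = W' := by
  have : (fun t => (F t, W t)) = (fun t => (F' t, W' t)) :=
    ODE_solution_unique_univ (s := fun _ => Set.univ) (K := 2) (t₀ := t₀)
      (fun t => (vf_lip t).lipschitzOnWith)
      (fun t => ⟨h.vf t, trivial⟩) (fun t => ⟨h'.vf t, trivial⟩) (by simp [h1, h2])
  constructor
  · funext t; exact congrArg Prod.fst (congrFun this t)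
  · funext t; exact congrArg Prod.snd (congrFun this t)

theorem Sr.const {F W : ℝ → ℝ} (h : Sr F W) (t₀ : ℝ)
    (h1 : Real.sin (2 * F t₀) = 0) (h2 : W t₀ = 0) : ∀ t, F t = F t₀ ∧ W t = 0 := by
  have hc : Sr (fun _ => F t₀) (fun _ => 0) := by
    intro r
    constructor
    · simpa using hasDerivAt_const r (F t₀)
    · rw [h1]; exact hasDerivAt_const r (0:ℝ)
  have := h.unique hc t₀ rfl h2
  intro t
  exact ⟨congrFun this.1 t, congrFun this.2 t⟩

theorem Sr.dep {F W F' W' : ℝ → ℝ} (h : Sr F W) (h' : Sr F' W')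
    (h1 : F 0 = F' 0) (t : ℝ) (ht : 0 ≤ t) :
    |F t - F' t| ≤ |W 0 - W' 0| * Real.exp (2 * t) ∧
    |W t - W' t| ≤ |W 0 - W' 0| * Real.exp (2 * t) := by
  have := dist_le_of_trajectories_ODE (v := _root_.vf) (K := 2) (a := 0) (b := t)
    (f := fun t => (F t, W t)) (g := fun t => (F' t, W' t)) (δ := |W 0 - W' 0|) vf_lip
    (fun s _ => (h.vf s).continuousAt.continuousWithinAt)
    (fun s _ => (h.vf s).hasDerivWithinAt)
    (fun s _ => (h'.vf s).continuousAt.continuousWithinAt)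
    (fun s _ => (h'.vf s).hasDerivWithinAt)
    (by rw [Prod.dist_eq]; simp [h1, Real.dist_eq]) t ⟨ht, le_rfl⟩
  rw [Prod.dist_eq] at this
  simp only [Real.dist_eq, sub_zero] at this
  exact ⟨(le_max_left _ _).trans this, (le_max_right _ _).trans this⟩

theorem local_exist (c b T : ℝ) (hT : 1 ≤ T) :
    ∃ z : ℝ → ℝ × ℝ, z 0 = (c, b) ∧ ∀ t ∈ Set.Ioo (-T) T, HasDerivAt z (vf t (z t)) t := by
  set l : ℝ := 1 / (2 * T) with hl
  have hlp : 0 < l := by positivity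
  have hTp : 0 < T := by linarith
  have hlT : l * T = 1 / 2 := by rw [hl]; field_simp
  let v' : ℝ → ℝ × ℝ → ℝ × ℝ := fun t z => (l * z.2 / (t ^ 2 + 1), Real.sin (2 * z.1) / l)
  let a : NNReal := ⟨2 * |b| * T + 4 * T * T, by positivity⟩
  let L : NNReal := ⟨|b| + l * a + 2 * T, by positivity⟩
  let K : NNReal := ⟨l + 2 / l, by positivity⟩
  have ha : (a : ℝ) = 2 * |b| * T + 4 * T * T := rfl
  have hL : (L : ℝ) = |b| + l * a + 2 * T := rfl
  have hK : (K : ℝ) = l + 2 / l := rfl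
  have hinv : 1 / l = 2 * T := by rw [hl]; field_simp
  have ht1 : ∀ t : ℝ, (1:ℝ) ≤ t ^ 2 + 1 := fun t => by nlinarith [sq_nonneg t]
  have hPL : IsPicardLindelof v' (tmin := -T) (tmax := T) ⟨0, by constructor <;> linarith⟩
      ((c, b / l) : ℝ × ℝ) a 0 L K := by
    refine ⟨?_, ?_, ?_, ?_⟩
    · intro t _
      apply LipschitzWith.lipschitzOnWith
      apply LipschitzWith.of_dist_le_mul
      intro z w
      rw [Prod.dist_eq, Prod.dist_eq, hK]
      simp only [v', Real.dist_eq]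
      have h1 : |z.1 - w.1| ≤ max |z.1 - w.1| |z.2 - w.2| := le_max_left _ _
      have h2 : |z.2 - w.2| ≤ max |z.1 - w.1| |z.2 - w.2| := le_max_right _ _
      set m := max |z.1 - w.1| |z.2 - w.2|
      have hm : 0 ≤ m := (abs_nonneg _).trans h1
      have hli : 0 < 1 / l := by positivity
      have h2l : 2 / l = 2 * (1 / l) := by ring
      apply max_le
      · rw [← sub_div, ← mul_sub, abs_div, abs_of_pos (by linarith [ht1 t] : (0:ℝ) < t^2+1), abs_mul,
          abs_of_pos hlp]
        have : l * |z.2 - w.2| / (t ^ 2 + 1) ≤ l * |z.2 - w.2| := div_le_self (by positivity) (ht1 t)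
        rw [h2l]
        nlinarith
      · rw [← sub_div, abs_div, abs_of_pos hlp]
        have := sin_sub_le (2 * z.1) (2 * w.1)
        rw [← mul_sub, abs_mul] at this
        norm_num at this
        have h3 : |Real.sin (2 * z.1) - Real.sin (2 * w.1)| / l ≤ (2 * m) / l := by
          gcongr; linarith
        have : 2 * m / l = 2 / l * m := by ring
        nlinarith
    · intro x _
      apply Continuous.continuousOn
      simp only [v']
      refine Continuous.prodMk ?_ continuous_const
      exact continuous_const.div (by fun_prop) (fun t => by positivity)
    · intro t _ x hx
      rw [Metric.mem_closedBall, Prod.dist_eq] at hx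
      have hx2 : |x.2 - b / l| ≤ a := by
        have := (le_max_right _ _).trans hx
        simpa [Real.dist_eq] using this
      rw [Prod.norm_def, hL]
      simp only [v', Real.norm_eq_abs]
      have hanon : (0:ℝ) ≤ a := a.2
      apply max_le
      · rw [abs_div, abs_of_pos (by linarith [ht1 t] : (0:ℝ) < t^2+1)]
        refine (div_le_self (abs_nonneg _) (ht1 t)).trans ?_
        have e : l * x.2 = b + l * (x.2 - b / l) := by field_simp; ring
        rw [e]
        refine (abs_add_le _ _).trans ?_
        rw [abs_mul, abs_of_pos hlp]
        have : l * |x.2 - b / l| ≤ l * a := by gcongr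
        linarith
      · rw [abs_div, abs_of_pos hlp]
        have : |Real.sin (2 * x.1)| / l ≤ 1 / l := by
          gcongr; exact Real.abs_sin_le_one _
        have : 0 ≤ l * a := by positivity
        have := abs_nonneg b
        linarith
    · simp only [sub_zero, zero_sub, neg_neg, max_self, NNReal.coe_zero]
      rw [hL]
      have : (|b| + l * a + 2 * T) * T = |b| * T + (l * T) * a + 2 * T * T := by ring
      rw [this, hlT, ha]
      nlinarith
  obtain ⟨α, h0, hα⟩ := hPL.exists_eq_forall_mem_Icc_hasDerivWithinAt₀
  refine ⟨fun t => ((α t).1, l * (α t).2), ?_, ?_⟩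
  · simp only at h0
    simp only [h0]
    congr 1
    field_simp
  · intro t ht
    have h1 := (hα t ⟨ht.1.le, ht.2.le⟩).hasDerivAt (Icc_mem_nhds ht.1 ht.2)
    have hf : HasDerivAt (fun t => (α t).1) (v' t (α t)).1 t := h1.fst
    have hs' : HasDerivAt (fun t => (α t).2) (v' t (α t)).2 t := h1.snd
    have hs := hs'.const_mul l
    refine (hf.prodMk hs).congr_deriv ?_
    simp only [v', vf]
    congr 1
    field_simp

theorem global_exist (c b : ℝ) : ∃ F W : ℝ → ℝ, Sr F W ∧ F 0 = c ∧ W 0 = b := by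
  choose z hz0 hz using fun N : ℕ => local_exist c b (N + 1) (by simp)
  have hagree : ∀ N M : ℕ, N ≤ M → ∀ t ∈ Set.Ioo (-((N:ℝ) + 1)) (N + 1), z N t = z M t := by
    intro N M hNM t ht
    have hNM' : (N:ℝ) ≤ M := by exact_mod_cast hNM
    have h0N : (0:ℝ) ≤ N := Nat.cast_nonneg N
    refine ODE_solution_unique_of_mem_Ioo (s := fun _ => Set.univ) (K := 2) (t₀ := 0)
      (v := vf) (fun t _ => (vf_lip t).lipschitzOnWith) (by constructor <;> linarith)
      (fun t ht => ⟨hz N t ht, trivial⟩)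
      (fun t ht => ⟨hz M t ⟨by linarith [ht.1], by linarith [ht.2]⟩, trivial⟩) (by rw [hz0, hz0]) ht
  let y : ℝ → ℝ × ℝ := fun t => z ⌈|t|⌉₊ t
  have hy : ∀ N : ℕ, ∀ t ∈ Set.Ioo (-((N:ℝ) + 1)) (N + 1), y t = z N t := by
    intro N t ht
    have h1 := Nat.le_ceil |t|
    have h2 := abs_le.1 h1
    rcases le_total N ⌈|t|⌉₊ with h | h
    · exact (hagree _ _ h t ht).symm
    · exact hagree _ _ h t ⟨by linarith [h2.1], by linarith [h2.2]⟩
  have hd : ∀ t, HasDerivAt y (vf t (y t)) t := by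
    intro t
    have h1 := Nat.le_ceil |t|
    have h2 := abs_le.1 h1
    have hmem : t ∈ Set.Ioo (-((⌈|t|⌉₊:ℝ) + 1)) (⌈|t|⌉₊ + 1) :=
      ⟨by linarith [h2.1], by linarith [h2.2]⟩
    have := hz ⌈|t|⌉₊ t hmem
    refine this.congr_of_eventuallyEq ?_
    filter_upwards [Ioo_mem_nhds hmem.1 hmem.2] with s hs using hy _ s hs
  have hy0 : y 0 = (c, b) := by
    simp only [y]; exact hz0 _
  refine ⟨fun t => (y t).1, fun t => (y t).2, fun t => ⟨(hd t).fst, (hd t).snd⟩, ?_, ?_⟩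
  · simp [hy0]
  · simp [hy0]

theorem le_of_deriv_nonpos {f f' : ℝ → ℝ} {a b : ℝ} (hab : a ≤ b)
    (hf : ∀ t ∈ Set.Icc a b, HasDerivAt f (f' t) t) (h : ∀ t ∈ Set.Icc a b, f' t ≤ 0) :
    f b ≤ f a := by
  have := antitoneOn_of_hasDerivWithinAt_nonpos (convex_Icc a b) (f := f) (f' := f')
    (fun t ht => (hf t ht).continuousAt.continuousWithinAt)
    (fun t ht => (hf t (interior_subset ht)).hasDerivWithinAt)
    (fun t ht => h t (interior_subset ht))
  exact this ⟨le_rfl, hab⟩ ⟨hab, le_rfl⟩ hab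

theorem le_of_deriv_nonneg {f f' : ℝ → ℝ} {a b : ℝ} (hab : a ≤ b)
    (hf : ∀ t ∈ Set.Icc a b, HasDerivAt f (f' t) t) (h : ∀ t ∈ Set.Icc a b, 0 ≤ f' t) :
    f a ≤ f b := by
  have := le_of_deriv_nonpos (f := fun t => - f t) (f' := fun t => - f' t) hab
    (fun t ht => (hf t ht).neg) (fun t ht => by have := h t ht; linarith)
  linarith

theorem tanh_lt_tanh' {x y : ℝ} (h : x < y) : Real.tanh x < Real.tanh y := by
  rw [Real.tanh_eq_sinh_div_cosh, Real.tanh_eq_sinh_div_cosh,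
    div_lt_div_iff₀ (Real.cosh_pos x) (Real.cosh_pos y)]
  have h1 : 0 < Real.sinh (y - x) := Real.sinh_pos_iff.2 (by linarith)
  rw [Real.sinh_sub] at h1
  nlinarith

theorem tanh_nonneg' {x : ℝ} (h : 0 ≤ x) : 0 ≤ Real.tanh x := by
  rw [Real.tanh_eq_sinh_div_cosh]
  exact div_nonneg (Real.sinh_nonneg_iff.2 h) (Real.cosh_pos x).le

/-- energy -/
noncomputable def En (G p : ℝ → ℝ) (x : ℝ) : ℝ := p x ^ 2 / 2 - Real.sin (G x) ^ 2

theorem Sx.hasDerivAt_En {G p : ℝ → ℝ} (h : Sx G p) (x : ℝ) :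
    HasDerivAt (En G p) (-(Real.tanh x * p x ^ 2)) x := by
  have h1 := (((h x).2.pow 2).div_const 2).sub ((h x).1.sin.pow 2)
  refine h1.congr_deriv ?_
  rw [Real.sin_two_mul]
  simp
  ring

theorem Sx.En_anti {G p : ℝ → ℝ} (h : Sx G p) {a b : ℝ} (ha : 0 ≤ a) (hab : a ≤ b) :
    En G p b ≤ En G p a :=
  le_of_deriv_nonpos hab (fun t _ => h.hasDerivAt_En t) (fun t ht => by
    have := tanh_nonneg' (ha.trans ht.1)
    have := sq_nonneg (p t)
    nlinarith [mul_nonneg (tanh_nonneg' (ha.trans ht.1)) (sq_nonneg (p t))])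

theorem Sx.reflect {G p : ℝ → ℝ} (h : Sx G p) (n : ℕ) :
    Sx (fun r => n * π - G (-r)) (fun r => p (-r)) := by
  intro r
  have hn := hasDerivAt_neg r
  constructor
  · have := ((h (-r)).1.comp r hn).const_sub (n * π)
    refine this.congr_deriv ?_
    simp
  · have := ((h (-r)).2.comp r hn)
    refine this.congr_deriv ?_
    have : 2 * (n * π - G (-r)) = - (2 * G (-r)) + n * (2 * π) := by ring
    rw [this, Real.sin_add_nat_mul_two_pi, Real.sin_neg, Real.tanh_neg]
    ring

theorem En_reflect (G p : ℝ → ℝ) (n : ℕ) (x : ℝ) :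
    En (fun r => n * π - G (-r)) (fun r => p (-r)) x = En G p (-x) := by
  simp only [En]
  have : n * π - G (-x) = - (G (-x) - n * π) := by ring
  rw [this, Real.sin_neg, Real.sin_sub_nat_mul_pi, neg_sq, mul_pow, ← pow_mul]
  simp

theorem Sx.En_nonneg_of_tendsto {G p : ℝ → ℝ} (h : Sx G p) {n : ℕ}
    (hG : Tendsto G atTop (nhds (n * π))) {x : ℝ} (hx : 0 ≤ x) : 0 ≤ En G p x := by
  have h1 : Tendsto (fun y => - Real.sin (G y) ^ 2) atTop (nhds (- Real.sin (n * π) ^ 2)) :=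
    (((Real.continuous_sin.tendsto _).comp hG).pow 2).neg
  rw [Real.sin_nat_mul_pi] at h1
  refine le_of_tendsto (by simpa using h1) ?_
  filter_upwards [eventually_ge_atTop x] with y hy
  have := h.En_anti hx hy
  refine le_trans ?_ this
  simp only [En]
  have := sq_nonneg (p y)
  linarith

theorem tendsto_reflect {G : ℝ → ℝ} {n : ℕ} (hG : Tendsto G atBot (nhds 0)) :
    Tendsto (fun r => n * π - G (-r)) atTop (nhds (n * π)) := by
  have := (hG.comp tendsto_neg_atTop_atBot).const_sub (n * π)
  simpa using this

theorem tendsto_reflect' {G : ℝ → ℝ} {n : ℕ} (hG : Tendsto G atTop (nhds (n * π))) :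
    Tendsto (fun r => n * π - G (-r)) atBot (nhds 0) := by
  have := (hG.comp tendsto_neg_atBot_atTop).const_sub (n * π)
  simpa using this

theorem Sx.En_nonneg {G p : ℝ → ℝ} (h : Sx G p) {n : ℕ}
    (hG0 : Tendsto G atBot (nhds 0)) (hG : Tendsto G atTop (nhds (n * π))) (x : ℝ) :
    0 ≤ En G p x := by
  rcases le_total 0 x with hx | hx
  · exact h.En_nonneg_of_tendsto hG hx
  · have := (h.reflect n).En_nonneg_of_tendsto (n := n) (tendsto_reflect hG0)
      (x := -x) (by linarith)
    rw [En_reflect] at this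
    simpa using this

theorem Sx.lim {G p : ℝ → ℝ} (h : Sx G p) {L : ℝ}
    (hG : Tendsto G atTop (nhds L)) (hE : ∀ x, 0 ≤ x → 0 ≤ En G p x) :
    Tendsto p atTop (nhds 0) ∧ Real.sin L = 0 ∧ Tendsto (En G p) atTop (nhds 0) := by
  obtain ⟨e, he⟩ : ∃ e, Tendsto (En G p) atTop (nhds e) := by
    have hanti : Antitone (fun x => En G p (max x 0)) := fun a b hab =>
      h.En_anti (le_max_right _ _) (max_le_max_right _ hab)
    have hb : BddBelow (Set.range (fun x => En G p (max x 0))) :=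
      ⟨0, by rintro _ ⟨x, rfl⟩; exact hE _ (le_max_right _ _)⟩
    refine ⟨_, (tendsto_atTop_ciInf hanti hb).congr' ?_⟩
    filter_upwards [eventually_ge_atTop 0] with x hx
    rw [max_eq_left hx]
  have he0 : 0 ≤ e := ge_of_tendsto he (by
    filter_upwards [eventually_ge_atTop 0] with x hx using hE x hx)
  have hsin : Tendsto (fun y => Real.sin (G y) ^ 2) atTop (nhds (Real.sin L ^ 2)) :=
    ((Real.continuous_sin.tendsto _).comp hG).pow 2
  have hp2 : Tendsto (fun x => p x ^ 2) atTop (nhds (2 * (e + Real.sin L ^ 2))) := by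
    refine ((he.add hsin).const_mul 2).congr (fun x => ?_)
    simp only [En]; ring
  have hmv : ∀ x : ℝ, ∃ c ∈ Set.Ioo x (x + 1), p c = G (x + 1) - G x := by
    intro x
    obtain ⟨c, hc, hc'⟩ := exists_hasDerivAt_eq_slope G p (by linarith : x < x + 1)
      (fun t _ => (h t).1.continuousAt.continuousWithinAt) (fun t _ => (h t).1)
    refine ⟨c, hc, ?_⟩
    rw [hc']; simp
  choose c hc hpc using hmv
  have hct : Tendsto c atTop atTop :=
    tendsto_atTop_mono (fun x => (hc x).1.le) tendsto_id
  have h1 := hp2.comp hct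
  have h2 : Tendsto (fun x => (G (x + 1) - G x) ^ 2) atTop (nhds ((L - L) ^ 2)) :=
    ((hG.comp (tendsto_atTop_add_const_right _ 1 tendsto_id)).sub hG).pow 2
  have h3 : Tendsto (fun x => (G (x + 1) - G x) ^ 2) atTop
      (nhds (2 * (e + Real.sin L ^ 2))) := by
    refine h1.congr (fun x => ?_)
    simp [hpc]
  have h4 := tendsto_nhds_unique h2 h3
  have hs0 : Real.sin L ^ 2 = 0 := by nlinarith [sq_nonneg (Real.sin L)]
  have he00 : e = 0 := by nlinarith [sq_nonneg (Real.sin L)]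
  refine ⟨?_, by simpa using hs0, by rwa [he00] at he⟩
  rw [hs0, he00] at hp2
  have h5 := (Real.continuous_sqrt.tendsto _).comp hp2
  simp only [Function.comp_def, Real.sqrt_sq_eq_abs] at h5
  rw [tendsto_zero_iff_abs_tendsto_zero]
  simpa [Function.comp_def] using h5

theorem Sx_unique {n : ℕ} {G₁ p₁ G₂ p₂ : ℝ → ℝ} (h₁ : Sx G₁ p₁) (h₂ : Sx G₂ p₂)
    (hp₁ : ∀ x, 0 < p₁ x) (hp₂ : ∀ x, 0 < p₂ x)
    (l₁ : Tendsto G₁ atBot (nhds 0)) (r₁ : Tendsto G₁ atTop (nhds (n * π)))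
    (l₂ : Tendsto G₂ atBot (nhds 0)) (r₂ : Tendsto G₂ atTop (nhds (n * π)))
    (pl₁ : Tendsto p₁ atBot (nhds 0)) (pr₁ : Tendsto p₁ atTop (nhds 0))
    (pl₂ : Tendsto p₂ atBot (nhds 0)) (pr₂ : Tendsto p₂ atTop (nhds 0)) :
    G₁ = G₂ := by
  have m₁ : StrictMono G₁ := strictMono_of_hasDerivAt_pos (fun x => (h₁ x).1) hp₁
  have m₂ : StrictMono G₂ := strictMono_of_hasDerivAt_pos (fun x => (h₂ x).1) hp₂
  have c₁ : Continuous G₁ := continuous_iff_continuousAt.2 fun x => (h₁ x).1.continuousAt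
  have c₂ : Continuous G₂ := continuous_iff_continuousAt.2 fun x => (h₂ x).1.continuousAt
  have cp₁ : Continuous p₁ := continuous_iff_continuousAt.2 fun x => (h₁ x).2.continuousAt
  have cp₂ : Continuous p₂ := continuous_iff_continuousAt.2 fun x => (h₂ x).2.continuousAt
  have bd : ∀ {G : ℝ → ℝ}, StrictMono G → Tendsto G atBot (nhds 0) →
      Tendsto G atTop (nhds (n * π)) → ∀ x, 0 < G x ∧ G x < n * π := by
    intro G m l r x
    constructor
    · exact (m.monotone.le_of_tendsto l (x - 1)).trans_lt (m (by linarith))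
    · exact (m (by linarith : x < x + 1)).trans_le (m.monotone.ge_of_tendsto r (x + 1))
  have surj : ∀ {G H : ℝ → ℝ}, StrictMono G → StrictMono H → Continuous H →
      Tendsto G atBot (nhds 0) → Tendsto G atTop (nhds (n * π)) →
      Tendsto H atBot (nhds 0) → Tendsto H atTop (nhds (n * π)) → ∀ x, ∃ y, H y = G x := by
    intro G H m m' c l r l' r' x
    have := bd m l r x
    exact mem_range_of_exists_le_of_exists_ge c
      ((l'.eventually (gt_mem_nhds this.1)).exists.imp fun _ h => h.le)
      ((r'.eventually (lt_mem_nhds this.2)).exists.imp fun _ h => h.le)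
  choose y hy using surj m₁ m₂ c₂ l₁ r₁ l₂ r₂
  have ym : StrictMono y := by
    intro a b hab
    rw [← m₂.lt_iff_lt, hy, hy]
    exact m₁ hab
  have ys : Function.Surjective y := by
    intro t
    obtain ⟨x, hx⟩ := surj m₂ m₁ c₁ l₂ r₂ l₁ r₁ t
    exact ⟨x, m₂.injective (by rw [hy, hx])⟩
  have yc : Continuous y := ym.monotone.continuous_of_surjective ys
  have yt : Tendsto y atTop atTop :=
    tendsto_atTop_atTop_of_monotone ym.monotone (fun b => (ys b).imp fun _ h => h.ge)
  have yb : Tendsto y atBot atBot :=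
    tendsto_atBot_atBot_of_monotone ym.monotone (fun b => (ys b).imp fun _ h => h.le)
  have yd : ∀ x, HasDerivAt y (p₁ x / p₂ (y x)) x := by
    intro x
    refine (HasDerivAt.of_comp_left (f := G₂) (h := G₁) yc.continuousAt (h₂ (y x)).1 (h₁ x).1
      (hp₂ _).ne' (Eventually.of_forall hy)).congr_deriv ?_
    ring
  set D : ℝ → ℝ := fun x => p₁ x - p₂ (y x) with hD
  set s : ℝ → ℝ := fun x => Real.sin (2 * G₁ x) with hs
  set τ : ℝ → ℝ := fun x => Real.tanh x - Real.tanh (y x) with hτ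
  have Dd : ∀ x, HasDerivAt D (-(τ x * p₁ x) - s x / p₂ (y x) * D x) x := by
    intro x
    have := (h₁ x).2.sub ((h₂ (y x)).2.comp x (yd x))
    refine this.congr_deriv ?_
    rw [hy]
    simp only [hD, hs, hτ]
    have := (hp₂ (y x)).ne'
    field_simp
    ring
  have D2d : ∀ x, HasDerivAt (fun x => D x ^ 2)
      (-2 * (τ x * D x) * p₁ x - 2 * (s x / p₂ (y x)) * D x ^ 2) x := by
    intro x
    refine ((Dd x).pow 2).congr_deriv ?_
    simp
    ring
  have ac : Continuous (fun x => s x / p₂ (y x)) :=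
    (Real.continuous_sin.comp (continuous_const.mul c₁)).div (cp₂.comp yc)
      (fun x => (hp₂ _).ne')
  set A : ℝ → ℝ := fun x => ∫ t in (0:ℝ)..x, s t / p₂ (y t) with hA
  have Ad : ∀ x, HasDerivAt A (s x / p₂ (y x)) x := fun x =>
    intervalIntegral.integral_hasDerivAt_right (ac.intervalIntegrable _ _)
      (ac.stronglyMeasurableAtFilter _ _) ac.continuousAt
  set Y : ℝ → ℝ := fun x => (x - y x) * D x * Real.exp (A x) with hY
  have Yd : ∀ x, HasDerivAt Y
      (-(Real.exp (A x) * (D x ^ 2 / p₂ (y x) + (x - y x) * τ x * p₁ x))) x := by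
    intro x
    have := ((((hasDerivAt_id x).sub (yd x)).mul (Dd x)).mul (Ad x).exp)
    refine this.congr_deriv ?_
    have := (hp₂ (y x)).ne'
    have hDx : p₁ x = D x + p₂ (y x) := by simp only [hD]; ring
    simp only [id, Pi.sub_apply, Pi.mul_apply]
    rw [hDx]
    field_simp
    ring
  have τpos : ∀ x, 0 ≤ (x - y x) * τ x := by
    intro x
    rcases lt_trichotomy x (y x) with h | h | h
    · have := tanh_lt_tanh' h
      simp only [hτ]; nlinarith
    · simp only [hτ]; rw [← h]; simp
    · have := tanh_lt_tanh' h
      simp only [hτ]; nlinarith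
  have τD : ∀ x, 0 ≤ (τ x * D x) * ((x - y x) * D x) := by
    intro x
    have := mul_nonneg (τpos x) (sq_nonneg (D x))
    nlinarith
  have Yanti : Antitone Y := by
    intro a b hab
    refine le_of_deriv_nonpos hab (fun t _ => Yd t) (fun t _ => ?_)
    have h1 := τpos t
    have h2 := hp₁ t
    have h3 := hp₂ (y t)
    have h4 := Real.exp_pos (A t)
    have : 0 ≤ Real.exp (A t) * (D t ^ 2 / p₂ (y t) + (t - y t) * τ t * p₁ t) := by positivity
    linarith
  have Dt : Tendsto (fun x => D x ^ 2) atTop (nhds 0) := by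
    have := (pr₁.sub (pr₂.comp yt)).pow 2
    simpa using this
  have Db : Tendsto (fun x => D x ^ 2) atBot (nhds 0) := by
    have := (pl₁.sub (pl₂.comp yb)).pow 2
    simpa using this
  have hbd := bd m₁ l₁ r₁
  have Y0 : ∀ x, Y x = 0 := by
    intro x₀
    by_contra hne
    rcases lt_or_gt_of_ne hne with hlt | hgt
    · -- negative: contradiction at `+∞`
      have hev : ∀ᶠ x in atTop, n * π - π / 2 < G₁ x :=
        r₁.eventually (lt_mem_nhds (by linarith [Real.pi_pos]))
      obtain ⟨x₁, hx₁⟩ := eventually_atTop.1 (hev.and (eventually_ge_atTop x₀))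
      have hq : ∀ x, x₁ ≤ x → (x - y x) * D x < 0 := by
        intro x hx
        have h1 : Y x < 0 := (Yanti (hx₁ x hx).2).trans_lt hlt
        by_contra hcon
        push Not at hcon
        have := mul_nonneg hcon (Real.exp_pos (A x)).le
        simp only [hY] at h1
        linarith
      have hsneg : ∀ x, x₁ ≤ x → s x ≤ 0 := by
        intro x hx
        have h1 := (hx₁ x hx).1
        have h2 := (hbd x).2
        have e : 2 * G₁ x = (2 * G₁ x - n * (2 * π)) + n * (2 * π) := by ring
        simp only [hs]
        rw [e, Real.sin_add_nat_mul_two_pi]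
        exact Real.sin_nonpos_of_nonpos_of_neg_pi_le (by linarith) (by linarith)
      have hmono : ∀ x, x₁ ≤ x → D x₁ ^ 2 ≤ D x ^ 2 := by
        intro x hx
        refine le_of_deriv_nonneg hx (fun t _ => D2d t) (fun t ht => ?_)
        have h1 := hq t ht.1
        have h2 := τD t
        have h3 : τ t * D t ≤ 0 := by
          by_contra hcon
          push Not at hcon
          nlinarith
        have h4 : s t / p₂ (y t) ≤ 0 := div_nonpos_of_nonpos_of_nonneg (hsneg t ht.1) (hp₂ _).le
        have h5 := mul_nonneg (neg_nonneg.2 h3) (hp₁ t).le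
        have h6 := mul_nonneg (neg_nonneg.2 h4) (sq_nonneg (D t))
        linarith
      have h7 : D x₁ ^ 2 ≤ 0 := ge_of_tendsto Dt (by
        filter_upwards [eventually_ge_atTop x₁] with x hx using hmono x hx)
      have h8 : D x₁ = 0 := by
        have := sq_nonneg (D x₁)
        exact pow_eq_zero_iff (two_ne_zero) |>.1 (le_antisymm h7 this)
      have := hq x₁ le_rfl
      rw [h8] at this
      simp at this
    · have hev : ∀ᶠ x in atBot, G₁ x < π / 2 :=
        l₁.eventually (gt_mem_nhds (by linarith [Real.pi_pos]))
      obtain ⟨x₁, hx₁⟩ := eventually_atBot.1 (hev.and (eventually_le_atBot x₀))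
      have hq : ∀ x, x ≤ x₁ → 0 < (x - y x) * D x := by
        intro x hx
        have h1 : 0 < Y x := lt_of_lt_of_le hgt (Yanti (hx₁ x hx).2)
        by_contra hcon
        push Not at hcon
        have := mul_nonneg (neg_nonneg.2 hcon) (Real.exp_pos (A x)).le
        simp only [hY] at h1
        linarith
      have hspos : ∀ x, x ≤ x₁ → 0 ≤ s x := by
        intro x hx
        have h1 := (hx₁ x hx).1
        have h2 := (hbd x).1
        simp only [hs]
        exact Real.sin_nonneg_of_nonneg_of_le_pi (by linarith) (by linarith)
      have hmono : ∀ x, x ≤ x₁ → D x₁ ^ 2 ≤ D x ^ 2 := by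
        intro x hx
        refine le_of_deriv_nonpos hx (fun t _ => D2d t) (fun t ht => ?_)
        have h1 := hq t ht.2
        have h2 := τD t
        have h3 : 0 ≤ τ t * D t := by
          by_contra hcon
          push Not at hcon
          nlinarith
        have h4 : 0 ≤ s t / p₂ (y t) := div_nonneg (hspos t ht.2) (hp₂ _).le
        have h5 := mul_nonneg h3 (hp₁ t).le
        have h6 := mul_nonneg h4 (sq_nonneg (D t))
        linarith
      have h7 : D x₁ ^ 2 ≤ 0 := ge_of_tendsto Db (by
        filter_upwards [eventually_le_atBot x₁] with x hx using hmono x hx)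
      have h8 : D x₁ = 0 := by
        have := sq_nonneg (D x₁)
        exact pow_eq_zero_iff (two_ne_zero) |>.1 (le_antisymm h7 this)
      have := hq x₁ le_rfl
      rw [h8] at this
      simp at this
  have hyid : ∀ x, y x = x := by
    intro x
    have h1 : HasDerivAt Y 0 x := by
      have : Y = fun _ => 0 := funext Y0
      rw [this]; exact hasDerivAt_const x (0:ℝ)
    have h2 := (Yd x).unique h1
    have h3 := Real.exp_pos (A x)
    have h4 : D x ^ 2 / p₂ (y x) + (x - y x) * τ x * p₁ x = 0 := by
      have : Real.exp (A x) * (D x ^ 2 / p₂ (y x) + (x - y x) * τ x * p₁ x) = 0 := by linarith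
      exact (mul_eq_zero.1 this).resolve_left h3.ne'
    have h5 : 0 ≤ D x ^ 2 / p₂ (y x) := div_nonneg (sq_nonneg _) (hp₂ _).le
    have h6 := mul_nonneg (τpos x) (hp₁ x).le
    have h7 : (x - y x) * τ x * p₁ x = 0 := by linarith
    have h8 : (x - y x) * τ x = 0 := (mul_eq_zero.1 h7).resolve_right (hp₁ x).ne'
    rcases mul_eq_zero.1 h8 with h | h
    · linarith
    · simp only [hτ] at h
      rcases lt_trichotomy x (y x) with h' | h' | h'
      · have := tanh_lt_tanh' h'; linarith
      · exact h'.symm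
      · have := tanh_lt_tanh' h'; linarith
  funext x
  rw [← hy, hyid]

theorem tendsto_sinh_top : Tendsto Real.sinh atTop atTop := Real.sinhOrderIso.tendsto_atTop
theorem tendsto_sinh_bot : Tendsto Real.sinh atBot atBot := Real.sinhOrderIso.tendsto_atBot

/-- The `x`-profile. -/
noncomputable def gx (F : ℝ → ℝ) (x : ℝ) : ℝ := F (Real.sinh x)
/-- The `x`-momentum. -/
noncomputable def px (W : ℝ → ℝ) (x : ℝ) : ℝ := W (Real.sinh x) / Real.cosh x

theorem Sr.sx {F W : ℝ → ℝ} (h : Sr F W) : Sx (gx F) (px W) := h.toSx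

theorem Sr.continuous {F W : ℝ → ℝ} (h : Sr F W) : Continuous F ∧ Continuous W :=
  ⟨continuous_iff_continuousAt.2 fun x => (h x).1.continuousAt,
   continuous_iff_continuousAt.2 fun x => (h x).2.continuousAt⟩

theorem Sr.const_of_En {F W : ℝ → ℝ} (h : Sr F W) {x : ℝ} (hE : 0 ≤ En (gx F) (px W) x)
    (hp : px W x = 0) : Real.sin (gx F x) = 0 ∧ ∀ t, F t = gx F x ∧ W t = 0 := by
  have hs : Real.sin (gx F x) = 0 := by
    simp only [En, hp] at hE
    have := sq_nonneg (Real.sin (gx F x))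
    have : Real.sin (gx F x) ^ 2 = 0 := by linarith
    simpa using this
  refine ⟨hs, ?_⟩
  refine h.const (Real.sinh x) ?_ ?_
  · rw [Real.sin_two_mul]
    have : Real.sin (F (Real.sinh x)) = 0 := hs
    rw [this]; simp
  · have := Real.cosh_pos x
    simp only [px] at hp
    rcases div_eq_zero_iff.1 hp with h | h
    · exact h
    · linarith

theorem gx_lim {F : ℝ → ℝ} {L : ℝ} (h : Tendsto F atTop (nhds L)) :
    Tendsto (gx F) atTop (nhds L) := h.comp tendsto_sinh_top

theorem gx_lim' {F : ℝ → ℝ} {L : ℝ} (h : Tendsto F atBot (nhds L)) :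
    Tendsto (gx F) atBot (nhds L) := h.comp tendsto_sinh_bot

theorem Sr.sign_info {F W : ℝ → ℝ} (h : Sr F W) {n : ℕ} (h0 : Tendsto F atBot (nhds 0))
    (hn : Tendsto F atTop (nhds (n * π))) :
    (n = 0 → F = fun _ => 0) ∧ (1 ≤ n → ∀ r, 0 < W r) := by
  have hE := h.sx.En_nonneg (gx_lim' h0) (gx_lim hn)
  have hz : ∀ r, W r = 0 → n = 0 ∧ F = fun _ => 0 := by
    intro r hr
    have hp : px W (Real.arsinh r) = 0 := by simp [px, Real.sinh_arsinh, hr]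
    obtain ⟨-, hc⟩ := h.const_of_En (hE (Real.arsinh r)) hp
    have e : F = fun _ => gx F (Real.arsinh r) := funext fun t => (hc t).1
    set c := gx F (Real.arsinh r)
    rw [e] at h0 hn
    have e1 := tendsto_nhds_unique h0 tendsto_const_nhds
    have e2 := tendsto_nhds_unique hn tendsto_const_nhds
    have hpi := Real.pi_pos
    rw [← e1] at e2
    refine ⟨?_, by rw [e, ← e1]⟩
    have := (mul_eq_zero.1 e2).resolve_right hpi.ne'
    exact_mod_cast this
  have hsign : (∃ r, W r = 0) ∨ (∀ r, 0 < W r) ∨ (∀ r, W r < 0) := by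
    by_contra hcon
    push Not at hcon
    obtain ⟨h1, ⟨a, ha⟩, ⟨b, hb⟩⟩ := hcon
    obtain ⟨c, hc⟩ := mem_range_of_exists_le_of_exists_ge h.continuous.2 ⟨a, ha⟩ ⟨b, hb⟩
    exact h1 c hc
  rcases hsign with ⟨r, hr⟩ | hpos | hneg
  · obtain ⟨e, hF⟩ := hz r hr
    exact ⟨fun _ => hF, fun h => by omega⟩
  · refine ⟨fun hn0 => ?_, fun _ => hpos⟩
    exfalso
    have m : StrictMono F := strictMono_of_hasDerivAt_pos (fun x => (h x).1)
      (fun x => div_pos (hpos x) (by positivity))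
    have h1 := m.monotone.le_of_tendsto h0 0
    have h2 := m.monotone.ge_of_tendsto hn 1
    have h3 := m (show (0:ℝ) < 1 by norm_num)
    rw [hn0] at h2
    simp at h2
    linarith
  · exfalso
    have m : StrictAnti F := strictAnti_of_hasDerivAt_neg (fun x => (h x).1)
      (fun x => div_neg_of_neg_of_pos (hneg x) (by positivity))
    have h1 := m.antitone.ge_of_tendsto h0 0
    have h2 := m.antitone.le_of_tendsto hn 1
    have h3 := m (show (0:ℝ) < 1 by norm_num)
    have : (0:ℝ) ≤ n * π := by positivity
    linarith

theorem Sr.full {F W : ℝ → ℝ} (h : Sr F W) {n : ℕ} (h0 : Tendsto F atBot (nhds 0))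
    (hn : Tendsto F atTop (nhds (n * π))) :
    Tendsto (px W) atTop (nhds 0) ∧ Tendsto (px W) atBot (nhds 0) := by
  have hE := h.sx.En_nonneg (gx_lim' h0) (gx_lim hn)
  refine ⟨(h.sx.lim (gx_lim hn) (fun x _ => hE x)).1, ?_⟩
  have := ((h.sx.reflect n).lim (tendsto_reflect (gx_lim' h0)) (fun x _ => by
    rw [En_reflect]; exact hE _)).1
  have := this.comp tendsto_neg_atBot_atTop
  simpa [Function.comp_def] using this

theorem Sr.uniq {n : ℕ} (hn1 : 1 ≤ n) {F W F' W' : ℝ → ℝ} (h : Sr F W) (h' : Sr F' W')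
    (h0 : Tendsto F atBot (nhds 0)) (hn : Tendsto F atTop (nhds (n * π)))
    (h0' : Tendsto F' atBot (nhds 0)) (hn' : Tendsto F' atTop (nhds (n * π))) : F = F' := by
  have hp := (h.sign_info h0 hn).2 hn1
  have hp' := (h'.sign_info h0' hn').2 hn1
  have := Sx_unique h.sx h'.sx (fun x => div_pos (hp _) (Real.cosh_pos x))
    (fun x => div_pos (hp' _) (Real.cosh_pos x)) (gx_lim' h0) (gx_lim hn)
    (gx_lim' h0') (gx_lim hn') (h.full h0 hn).2 (h.full h0 hn).1 (h'.full h0' hn').2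
    (h'.full h0' hn').1
  funext r
  have := congrFun this (Real.arsinh r)
  simpa [gx] using this

/-- primitive of `|sin|` -/
noncomputable def Ph (u : ℝ) : ℝ := ∫ t in (0:ℝ)..u, |Real.sin t|

theorem Ph_deriv (u : ℝ) : HasDerivAt Ph |Real.sin u| u := by
  have c : Continuous fun t : ℝ => |Real.sin t| := by fun_prop
  exact intervalIntegral.integral_hasDerivAt_right (c.intervalIntegrable _ _)
      (c.stronglyMeasurableAtFilter _ _) c.continuousAt

theorem Ph_mono : Monotone Ph := fun _ _ hab =>
  le_of_deriv_nonneg hab (fun t _ => Ph_deriv t) (fun _ _ => abs_nonneg _)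

theorem Ph_lt (k : ℤ) : Ph (k * π + π / 2) < Ph (k * π + π) := by
  have hpi := Real.pi_pos
  have m : StrictMonoOn Ph (Set.Icc (k * π + π / 2) (k * π + π)) := by
    refine strictMonoOn_of_hasDerivWithinAt_pos (convex_Icc _ _)
      (fun t _ => (Ph_deriv t).continuousAt.continuousWithinAt)
      (fun t _ => (Ph_deriv t).hasDerivWithinAt) ?_
    intro t ht
    rw [interior_Icc] at ht
    have e : t = (t - k * π) + k * π := by ring
    rw [e, Real.sin_add_int_mul_pi, abs_mul]
    have h1 : 0 < Real.sin (t - k * π) :=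
      Real.sin_pos_of_pos_of_lt_pi (by linarith [ht.1]) (by linarith [ht.2])
    have h2 : |((-1:ℝ)) ^ k| = 1 := by simp
    rw [h2, one_mul]
    exact abs_pos.2 h1.ne'
  exact m ⟨le_rfl, by linarith⟩ ⟨by linarith, le_rfl⟩ (by linarith)

theorem Sx.drop {G p : ℝ → ℝ} (h : Sx G p) {a X : ℝ} (ha : 1 ≤ a) (haX : a ≤ X)
    (hE : ∀ x ∈ Set.Icc a X, 0 ≤ En G p x) :
    En G p X + Real.tanh 1 * Ph (G X) ≤ En G p a + Real.tanh 1 * Ph (G a) := by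
  refine le_of_deriv_nonpos (f := fun x => En G p x + Real.tanh 1 * Ph (G x)) haX
    (fun t _ => (h.hasDerivAt_En t).add (((Ph_deriv (G t)).comp t (h t).1).const_mul _)) ?_
  intro t ht
  have h1 := hE t ht
  simp only [En] at h1
  have h2 : |Real.sin (G t)| ≤ |p t| := by
    apply sq_le_sq.1
    nlinarith [sq_nonneg (Real.sin (G t))]
  have h3 : |Real.sin (G t)| * p t ≤ p t ^ 2 := by
    have : |Real.sin (G t)| * p t ≤ |p t| * |p t| := by
        have a1 := mul_le_mul_of_nonneg_left (le_abs_self (p t)) (abs_nonneg (Real.sin (G t)))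
        have a2 := mul_le_mul_of_nonneg_right h2 (abs_nonneg (p t))
        linarith
    rw [← sq, sq_abs] at this
    exact this
  have h4 : Real.tanh 1 ≤ Real.tanh t := by
    rcases eq_or_lt_of_le (ha.trans ht.1) with h | h
    · rw [h]
    · exact (tanh_lt_tanh' h).le
  have h5 : 0 ≤ Real.tanh 1 := tanh_nonneg' (by norm_num)
  have h6 := mul_le_mul_of_nonneg_left h3 h5
  have h7 := mul_le_mul_of_nonneg_right h4 (sq_nonneg (p t))
  linarith

theorem exist_half {n : ℕ} (hn : 1 ≤ n) :
    ∃ F W : ℝ → ℝ, Sr F W ∧ F 0 = n * π / 2 ∧ Tendsto F atTop (nhds (n * π)) := by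
  have hpi := Real.pi_pos
  have hnpi : 0 < n * π := by positivity
  choose F W hS hF0 hW0 using fun b : ℝ => global_exist (n * π / 2) b
  have hdF : ∀ b b' t : ℝ, 0 ≤ t → |F b t - F b' t| ≤ |b - b'| * Real.exp (2 * t) := by
    intro b b' t ht
    have := ((hS b).dep (hS b') (by rw [hF0, hF0]) t ht).1
    rwa [hW0, hW0] at this
  have hdW : ∀ b b' t : ℝ, 0 ≤ t → |W b t - W b' t| ≤ |b - b'| * Real.exp (2 * t) := by
    intro b b' t ht
    have := ((hS b).dep (hS b') (by rw [hF0, hF0]) t ht).2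
    rwa [hW0, hW0] at this
  have hcont : ∀ (Z : ℝ → ℝ → ℝ), (∀ b b' t : ℝ, 0 ≤ t → |Z b t - Z b' t| ≤ |b - b'| * Real.exp (2 * t)) →
      ∀ t, 0 ≤ t → Continuous (fun b => Z b t) := by
    intro Z hZ t ht
    refine (LipschitzWith.of_dist_le_mul (K := ⟨Real.exp (2 * t), (Real.exp_pos _).le⟩) ?_).continuous
    intro b b'
    rw [Real.dist_eq, Real.dist_eq, mul_comm]
    exact hZ b b' t ht
  have cF := hcont F hdF
  have cW := hcont W hdW
  have cG : ∀ x, 0 ≤ x → Continuous (fun b => gx (F b) x) := fun x hx =>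
    cF _ (Real.sinh_nonneg_iff.2 hx)
  have cE : ∀ x, 0 ≤ x → Continuous (fun b => En (gx (F b)) (px (W b)) x) := by
    intro x hx
    have h1 := cG x hx
    have h2 := cW _ (Real.sinh_nonneg_iff.2 hx)
    simp only [En, px]
    fun_prop
  have g0 : ∀ b, gx (F b) 0 = n * π / 2 := fun b => by simp [gx, hF0]
  have p0 : ∀ b, px (W b) 0 = b := fun b => by simp [px, hW0]
  let A : Set ℝ := {b | 0 ≤ b ∧ ∃ x, 0 ≤ x ∧ n * π < gx (F b) x}
  have gc : ∀ b, Continuous (gx (F b)) := fun b => (hS b).continuous.1.comp Real.continuous_sinh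
  have hhit : ∀ b ∈ A, ∃ X, 0 ≤ X ∧ gx (F b) X = n * π ∧
      ∀ x ∈ Set.Icc 0 X, 0 ≤ En (gx (F b)) (px (W b)) x := by
    rintro b ⟨hb, x, hx, hgx⟩
    obtain ⟨X, hX, hXe⟩ := intermediate_value_Icc hx (gc b).continuousOn
      (show n * π ∈ Set.Icc (gx (F b) 0) (gx (F b) x) from ⟨by rw [g0]; linarith, hgx.le⟩)
    refine ⟨X, hX.1, hXe, fun t ht => ?_⟩
    refine le_trans ?_ ((hS b).sx.En_anti ht.1 ht.2)
    simp only [En, hXe, Real.sin_nat_mul_pi]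
    have := sq_nonneg (px (W b) X)
    norm_num
    positivity
  have hA0 : (0:ℝ) ∉ A := by
    intro h
    obtain ⟨X, hX, hXe, hE⟩ := hhit 0 h
    obtain ⟨-, hc⟩ := (hS 0).const_of_En (hE 0 ⟨le_rfl, hX⟩) (p0 0)
    have := (hc (Real.sinh X)).1
    rw [g0] at this
    simp only [gx] at hXe
    linarith
  have hAne : A.Nonempty := by
    refine ⟨1 + 2 * (n * π), by positivity, Real.arsinh 1, Real.arsinh_nonneg_iff.2 (by norm_num), ?_⟩
    set b := 1 + 2 * (n * π) with hb
    have hW : ∀ r ∈ Set.Icc (0:ℝ) 1, b - 1 ≤ W b r := by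
      intro r hr
      have := le_of_deriv_nonneg (f := fun r => W b r + r) hr.1
        (fun t _ => ((hS b) t).2.add (hasDerivAt_id t)) (fun t _ => by
          linarith [Real.neg_one_le_sin (2 * F b t)])
      simp only [hW0] at this
      linarith [hr.2]
    have hF : F b 0 - (b - 1) / 2 * 0 ≤ F b 1 - (b - 1) / 2 * 1 := by
      refine le_of_deriv_nonneg (f := fun r => F b r - (b - 1) / 2 * r) zero_le_one
        (fun t _ => ((hS b) t).1.sub ((hasDerivAt_id t).const_mul _)) (fun t ht => ?_)
      have h1 := hW t ht
      have h2 : t ^ 2 + 1 ≤ 2 := by nlinarith [ht.1, ht.2]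
      have h3 : (b - 1) / 2 ≤ W b t / (t ^ 2 + 1) := by
        apply div_le_div₀ <;> linarith [sq_nonneg t]
      linarith
    rw [hF0] at hF
    simp only [gx, Real.sinh_arsinh]
    linarith
  have hbdd : BddBelow A := ⟨0, fun b hb => hb.1⟩
  set β := sInf A with hβ
  have hβ0 : 0 ≤ β := le_csInf hAne fun b hb => hb.1
  have hβA : β ∉ A := by
    intro h
    have hpos : 0 < β := lt_of_le_of_ne hβ0 (fun e => hA0 (e ▸ h))
    obtain ⟨-, x, hx, hgx⟩ := h
    have h1 : ∀ᶠ b in nhds β, n * π < gx (F b) x :=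
      (cG x hx).continuousAt.eventually (lt_mem_nhds hgx)
    have h2 : ∀ᶠ b in nhds β, 0 < b := lt_mem_nhds hpos
    have h3 : ∀ᶠ b in nhdsWithin β (Set.Iio β), b < β := self_mem_nhdsWithin
    obtain ⟨b, ⟨hb1, hb2⟩, hb⟩ :=
      (((h1.and h2).filter_mono nhdsWithin_le_nhds).and h3).exists
    exact absurd (csInf_le hbdd ⟨hb2.le, x, hx, hb1⟩) (not_le.2 hb)
  have hfreq : ∃ᶠ b in nhds β, b ∈ A := by
    have := csInf_mem_closure hAne hbdd
    exact mem_closure_iff_frequently.1 this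
  have hle : ∀ x, 0 ≤ x → gx (F β) x ≤ n * π := by
    intro x hx
    by_contra hcon
    push Not at hcon
    exact hβA ⟨hβ0, x, hx, hcon⟩
  have hlt : ∀ x, 0 ≤ x → gx (F β) x < n * π := by
    intro x hx
    refine lt_of_le_of_ne (hle x hx) (fun e => ?_)
    have hx0 : 0 < x := lt_of_le_of_ne hx (fun e' => by
      rw [← e', g0] at e; linarith)
    have hmax : IsLocalMax (gx (F β)) x := by
      filter_upwards [lt_mem_nhds hx0] with t ht
      rw [e]; exact hle t ht.le
    have hp := hmax.hasDerivAt_eq_zero ((hS β).sx x).1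
    obtain ⟨-, hc⟩ := (hS β).const_of_En (x := x) (by
      simp only [En, e, Real.sin_nat_mul_pi]; norm_num; positivity) hp
    have := (hc 0).1
    rw [hF0, e] at this
    linarith
  -- nearby members of `A` hit late
  have hlate : ∀ x₁, 0 ≤ x₁ → ∀ᶠ b in nhds β, ∀ x ∈ Set.Icc 0 x₁, gx (F b) x < n * π := by
    intro x₁ hx₁
    obtain ⟨m, hm, hmax⟩ := isCompact_Icc.exists_isMaxOn (Set.nonempty_Icc.2 hx₁)
      (gc β).continuousOn
    have hm' := hlt m hm.1
    set ε := n * π - gx (F β) m with hε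
    have hεp : 0 < ε := by linarith
    have h1 : Continuous fun b : ℝ => |b - β| * Real.exp (2 * Real.sinh x₁) := by fun_prop
    have h2 : ∀ᶠ b in nhds β, |b - β| * Real.exp (2 * Real.sinh x₁) < ε :=
      h1.continuousAt.eventually (gt_mem_nhds (by simpa using hεp))
    filter_upwards [h2] with b hb x hx
    have h3 := hdF b β (Real.sinh x) (Real.sinh_nonneg_iff.2 hx.1)
    have h4 : |b - β| * Real.exp (2 * Real.sinh x) ≤ |b - β| * Real.exp (2 * Real.sinh x₁) := by
      gcongr
      exact Real.sinh_le_sinh.2 hx.2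
    have h5 := le_abs_self (F b (Real.sinh x) - F β (Real.sinh x))
    have h6 : gx (F β) x ≤ gx (F β) m := hmax hx
    simp only [gx] at *
    linarith
  have hEβ : ∀ x, 0 ≤ x → 0 ≤ En (gx (F β)) (px (W β)) x := by
    intro x hx
    by_contra hcon
    push Not at hcon
    have h1 := (cE x hx).continuousAt.eventually (gt_mem_nhds hcon)
    obtain ⟨b, hbA, hb1, hb2⟩ := (hfreq.and_eventually (h1.and (hlate x hx))).exists
    obtain ⟨X, hX, hXe, hE⟩ := hhit b hbA
    have hxX : x ≤ X := by
      by_contra hc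
      push Not at hc
      have := hb2 X ⟨hX, hc.le⟩
      linarith
    have := hE x ⟨hx, hxX⟩
    linarith
  obtain ⟨L, hL⟩ : ∃ L, Tendsto (gx (F β)) atTop (nhds L) := by
    by_cases hz : ∃ x, 0 ≤ x ∧ px (W β) x = 0
    · obtain ⟨x, hx, hpx⟩ := hz
      obtain ⟨-, hc⟩ := (hS β).const_of_En (hEβ x hx) hpx
      refine ⟨gx (F β) x, tendsto_const_nhds.congr fun t => ?_⟩
      exact ((hc (Real.sinh t)).1).symm
    · push Not at hz
      have pc : Continuous (px (W β)) :=
        ((hS β).continuous.2.comp Real.continuous_sinh).div Real.continuous_cosh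
          (fun x => (Real.cosh_pos x).ne')
      have hpos : ∀ x, 0 ≤ x → 0 ≤ px (W β) x := by
        intro x hx
        by_contra hcon
        push Not at hcon
        obtain ⟨t, ht, hte⟩ := intermediate_value_Icc' hx pc.continuousOn
          (show (0:ℝ) ∈ Set.Icc (px (W β) x) (px (W β) 0) from ⟨hcon.le, by rw [p0]; exact hβ0⟩)
        exact hz t ht.1 hte
      have hmono : Monotone fun x => gx (F β) (max x 0) := by
        intro a b hab
        exact le_of_deriv_nonneg (max_le_max_right 0 hab) (fun t _ => ((hS β).sx t).1)
          (fun t ht => hpos t ((le_max_right _ _).trans ht.1))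
      have hb : BddAbove (Set.range fun x => gx (F β) (max x 0)) :=
        ⟨n * π, by rintro _ ⟨x, rfl⟩; exact hle _ (le_max_right _ _)⟩
      refine ⟨_, (tendsto_atTop_ciSup hmono hb).congr' ?_⟩
      filter_upwards [eventually_ge_atTop 0] with x hx
      rw [max_eq_left hx]
  obtain ⟨-, hsL, hEt⟩ := (hS β).sx.lim hL hEβ
  have hLn : L ≤ n * π := le_of_tendsto hL (by
    filter_upwards [eventually_ge_atTop 0] with x hx using hle x hx)
  have hLe : L = n * π := by
    by_contra hne
    have hLlt := lt_of_le_of_ne hLn hne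
    obtain ⟨k, hk⟩ := Real.sin_eq_zero_iff.1 hsL
    have hkn : (k:ℝ) + 1 ≤ n := by
      rw [← hk] at hLlt
      have h1 : (k:ℝ) < n := lt_of_mul_lt_mul_right hLlt hpi.le
      have h2 : k < n := by exact_mod_cast h1
      exact_mod_cast h2
    have hPh := Ph_lt k
    have ht1 : 0 < Real.tanh 1 := by
      have := tanh_lt_tanh' (show (0:ℝ) < 1 by norm_num)
      simpa using this
    set δ := Real.tanh 1 * (Ph (k * π + π) - Ph (k * π + π / 2)) with hδ
    have hδp : 0 < δ := mul_pos ht1 (by linarith)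
    have e1 := hEt.eventually (gt_mem_nhds hδp)
    have e2 := hL.eventually (gt_mem_nhds (show L < k * π + π / 2 by rw [hk]; linarith))
    obtain ⟨x₁, hx1, hx2, hx3⟩ := (e1.and (e2.and (eventually_ge_atTop 1))).exists
    have hx0 : 0 ≤ x₁ := by linarith
    have f1 := (cE x₁ hx0).continuousAt.eventually (gt_mem_nhds hx1)
    have f2 := (cG x₁ hx0).continuousAt.eventually (gt_mem_nhds hx2)
    obtain ⟨b, hbA, hb1, hb2, hb3⟩ :=
      (hfreq.and_eventually (f1.and (f2.and (hlate x₁ hx0)))).exists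
    obtain ⟨X, hX, hXe, hE⟩ := hhit b hbA
    have hxX : x₁ ≤ X := by
      by_contra hc
      push Not at hc
      have := hb3 X ⟨hX, hc.le⟩
      linarith
    have hdrop := (hS b).sx.drop hx3 hxX (fun x hx => hE x ⟨hx0.trans hx.1, hx.2⟩)
    have hEX := hE X ⟨hX, le_rfl⟩
    rw [hXe] at hdrop
    have g1 : Ph (k * π + π) ≤ Ph (n * π) := Ph_mono (by nlinarith)
    have g2 : Ph (gx (F b) x₁) ≤ Ph (k * π + π / 2) := Ph_mono hb2.le
    have g3 := mul_le_mul_of_nonneg_left (sub_le_sub g1 g2) ht1.le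
    linarith
  refine ⟨F β, W β, hS β, hF0 β, ?_⟩
  rw [hLe] at hL
  have := hL.comp (Real.sinhOrderIso.symm.tendsto_atTop)
  refine this.congr fun r => ?_
  have : Real.sinh (Real.sinhOrderIso.symm r) = r := Real.sinhOrderIso.apply_symm_apply r
  simp [gx, this]

theorem exist_full {n : ℕ} (hn : 1 ≤ n) :
    ∃ F W : ℝ → ℝ, Sr F W ∧ Tendsto F atBot (nhds 0) ∧ Tendsto F atTop (nhds (n * π)) := by
  obtain ⟨F, W, h, h0, hl⟩ := exist_half hn
  refine ⟨F, W, h, ?_, hl⟩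
  have := (h.unique (h.reflect n) 0 (by simp [h0]; ring) (by simp)).1
  rw [this]
  exact tendsto_reflect' hl

theorem hasDerivAt_div_pow (c : ℝ) (k : ℕ) {r : ℝ} (hr : r ≠ 0) :
    HasDerivAt (fun r : ℝ => c / r ^ k) (-(k * c) / r ^ (k + 1)) r := by
  have h := ((hasDerivAt_pow k r).inv (pow_ne_zero k hr)).const_mul c
  have h2 : HasDerivAt (fun r : ℝ => c / r ^ k) (c * (-(k * r ^ (k - 1)) / (r ^ k) ^ 2)) r := by
    refine h.congr_of_eventuallyEq ?_
    filter_upwards with t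
    simp [div_eq_mul_inv]
  refine h2.congr_deriv ?_
  rcases k with _ | k
  · simp
  · simp only [Nat.add_sub_cancel]
    field_simp
    ring

theorem le_lim_of_deriv_nonneg {f f' : ℝ → ℝ} {a L : ℝ} (hL : Tendsto f atTop (nhds L))
    (hf : ∀ t, a ≤ t → HasDerivAt f (f' t) t) (h : ∀ t, a ≤ t → 0 ≤ f' t) {r : ℝ} (hr : a ≤ r) :
    f r ≤ L := by
  refine ge_of_tendsto hL ?_
  filter_upwards [eventually_ge_atTop r] with t ht
  exact le_of_deriv_nonneg ht (fun s hs => hf s (hr.trans hs.1)) (fun s hs => h s (hr.trans hs.1))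

theorem lim_le_of_deriv_nonpos {f f' : ℝ → ℝ} {a L : ℝ} (hL : Tendsto f atTop (nhds L))
    (hf : ∀ t, a ≤ t → HasDerivAt f (f' t) t) (h : ∀ t, a ≤ t → f' t ≤ 0) {r : ℝ} (hr : a ≤ r) :
    L ≤ f r := by
  refine le_of_tendsto hL ?_
  filter_upwards [eventually_ge_atTop r] with t ht
  exact le_of_deriv_nonpos ht (fun s hs => hf s (hr.trans hs.1)) (fun s hs => h s (hr.trans hs.1))

theorem tendsto_div_pow_top' (c : ℝ) {k : ℕ} (hk : k ≠ 0) :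
    Tendsto (fun r : ℝ => c / r ^ k) atTop (nhds 0) :=
  tendsto_const_nhds.div_atTop (tendsto_pow_atTop hk)

/-- asymptotics, abstract form -/
theorem asymp {v W : ℝ → ℝ} (hv : ∀ r, HasDerivAt v (-(W r) / (r ^ 2 + 1)) r)
    (hW : ∀ r, HasDerivAt W (-Real.sin (2 * v r)) r)
    (hv0 : ∀ r, 0 < v r) (hW0 : ∀ r, 0 < W r) (hvt : Tendsto v atTop (nhds 0))
    (hE : ∀ r, 2 * Real.sin (v r) ^ 2 * (r ^ 2 + 1) ≤ W r ^ 2) :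
    ∃ α : ℝ, 0 < α ∧ ∃ C : ℝ, 0 < C ∧ ∀ r : ℝ, 1 ≤ r → |v r - α / r ^ 2| ≤ C / r ^ 4 := by
  obtain ⟨r0, hsmall0⟩ : ∃ r0 : ℝ, ∀ r, r0 ≤ r → v r < 1 / 2 :=
    eventually_atTop.1 (hvt.eventually (gt_mem_nhds (by norm_num)))
  set a : ℝ := max r0 2 with ha
  have ha2 : 2 ≤ a := le_max_right _ _
  have hsmall : ∀ r, a ≤ r → v r < 1 / 2 := fun r hr => hsmall0 r ((le_max_left _ _).trans hr)
  have hcub : ∀ r, a ≤ r → 2 * v r - Real.sin (2 * v r) ≤ 2 * v r ^ 3 := by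
    intro r hr
    have h1 := Real.sin_gt_sub_cube (x := 2 * v r) (by linarith [hv0 r])
    nlinarith [pow_pos (hv0 r) 3]
  have hlin : ∀ r, a ≤ r → 15 / 16 * v r ≤ Real.sin (v r) := by
    intro r hr
    have p := hv0 r
    have q := hsmall r hr
    have h1 := Real.sin_gt_sub_cube (x := v r) p
    have : 0 ≤ v r ^ 3 := by positivity
    have : v r ^ 3 ≤ v r * (1 / 4) := by
      rw [pow_succ, mul_comm]
      gcongr
      nlinarith
    linarith
  -- first decay
  have step1 : ∀ r, a ≤ r → v r * r ≤ v a * a := by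
    intro r hr
    refine le_of_deriv_nonpos (f := fun r => v r * r) hr
      (fun t _ => (hv t).mul (hasDerivAt_id t)) ?_
    intro t ht
    have t2 : 2 ≤ t := ha2.trans ht.1
    have e1 := hlin t ht.1
    have p := hv0 t
    have e2 := hE t
    have e3 : (15 / 16 * v t) ^ 2 ≤ Real.sin (v t) ^ 2 := by gcongr
    have e4 : (v t * (t ^ 2 + 1)) ^ 2 ≤ (W t * t) ^ 2 := by
      have f1 : 2 * (15 / 16 * v t) ^ 2 * (t ^ 2 + 1) ≤ W t ^ 2 := le_trans (by gcongr) e2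
      have f2 := mul_le_mul_of_nonneg_right f1 (sq_nonneg t)
      have f3 : (v t * (t ^ 2 + 1)) ^ 2 ≤ 2 * (15 / 16 * v t) ^ 2 * (t ^ 2 + 1) * t ^ 2 := by
        have : 0 ≤ v t ^ 2 * (t ^ 2 + 1) * (97 / 128 * t ^ 2 - 1) := by
          apply mul_nonneg (by positivity); nlinarith
        nlinarith
      rw [mul_pow]; linarith
    have e5 : v t * (t ^ 2 + 1) ≤ W t * t :=
      le_of_sq_le_sq e4 (mul_nonneg (hW0 t).le (by linarith))
    have e6 : v t ≤ W t * t / (t ^ 2 + 1) := by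
      rw [le_div_iff₀ (by positivity)]; exact e5
    have e7 : -W t / (t ^ 2 + 1) * t = -(W t * t / (t ^ 2 + 1)) := by ring
    change -W t / (t ^ 2 + 1) * t + v t * 1 ≤ 0
    rw [e7]; linarith
  set A := v a * a with hA
  have hA0 : 0 < A := mul_pos (hv0 a) (by linarith)
  have d1 : ∀ r, a ≤ r → v r ≤ A / r := fun r hr => by
    rw [le_div_iff₀ (by linarith)]; exact step1 r hr
  -- the quantity `Om`
  set Om : ℝ → ℝ := fun r => W r * r + (r ^ 2 + 1) * v r with hOm
  have dOm : ∀ r, HasDerivAt Om (r * (2 * v r - Real.sin (2 * v r))) r := by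
    intro r
    have h1 := ((hW r).mul (hasDerivAt_id r)).add
      ((((hasDerivAt_pow 2 r).add_const 1)).mul (hv r))
    refine h1.congr_deriv ?_
    have : r ^ 2 + 1 ≠ 0 := by positivity
    simp only [id]
    field_simp
    push_cast
    ring
  have Om_pos : ∀ r, a ≤ r → 0 < Om r := fun r hr => by
    have : 0 < r := by linarith
    have := hv0 r
    have := hW0 r
    simp only [hOm]; positivity
  have dOm0 : ∀ r, a ≤ r → 0 ≤ r * (2 * v r - Real.sin (2 * v r)) := fun r hr => by
    have := Real.sin_le (x := 2 * v r) (by linarith [hv0 r])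
    exact mul_nonneg (by linarith) (by linarith)
  have dOm1 : ∀ r, a ≤ r → r * (2 * v r - Real.sin (2 * v r)) ≤ r * (2 * v r ^ 3) := fun r hr =>
    mul_le_mul_of_nonneg_left (hcub r hr) (by linarith)
  have Om_mono : ∀ r s, a ≤ r → r ≤ s → Om r ≤ Om s := fun r s hr hs =>
    le_of_deriv_nonneg hs (fun t _ => dOm t) (fun t ht => dOm0 t (hr.trans ht.1))
  obtain ⟨B, hB⟩ : ∃ B, ∀ r, a ≤ r → Om r ≤ B := by
    refine ⟨Om a + 2 * A ^ 3 / a ^ 1, fun r hr => ?_⟩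
    have := le_of_deriv_nonpos (f := fun r => Om r + 2 * A ^ 3 / r ^ 1) hr
      (fun t ht => (dOm t).add (hasDerivAt_div_pow (2 * A ^ 3) 1 (by linarith [ht.1]))) (by
        intro t ht
        have t0 : 0 < t := by linarith [ht.1]
        have e1 := dOm1 t ht.1
        have e2 : v t ^ 3 ≤ (A / t) ^ 3 := by
          have := d1 t ht.1
          have := (hv0 t).le
          gcongr
        have e3 : t * (2 * v t ^ 3) ≤ t * (2 * (A / t) ^ 3) := by gcongr
        have e4 : t * (2 * (A / t) ^ 3) = 2 * A ^ 3 / t ^ 2 := by field_simp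
        have e5 : -(((1:ℕ):ℝ) * (2 * A ^ 3)) / t ^ (1 + 1) = - (2 * A ^ 3 / t ^ 2) := by
          push_cast; ring
        rw [e5]; linarith)
    have hp : 0 ≤ 2 * A ^ 3 / r ^ 1 := by
      have : 0 < r := by linarith
      positivity
    linarith
  have hB0 : 0 < B := (Om_pos a le_rfl).trans_le (hB a le_rfl)
  obtain ⟨l, hl⟩ : ∃ l, Tendsto Om atTop (nhds l) := by
    have hmono : Monotone fun x => Om (max x a) := fun x y hxy =>
      Om_mono _ _ (le_max_right _ _) (max_le_max_right a hxy)
    have hb : BddAbove (Set.range fun x => Om (max x a)) :=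
      ⟨B, by rintro _ ⟨x, rfl⟩; exact hB _ (le_max_right _ _)⟩
    refine ⟨_, (tendsto_atTop_ciSup hmono hb).congr' ?_⟩
    filter_upwards [eventually_ge_atTop a] with x hx
    rw [max_eq_left hx]
  have Om_le : ∀ r, a ≤ r → Om r ≤ l := fun r hr =>
    le_lim_of_deriv_nonneg hl (fun t _ => dOm t) dOm0 hr
  have hl0 : 0 < l := (Om_pos a le_rfl).trans_le (Om_le a le_rfl)
  have dq : ∀ r, a ≤ r → HasDerivAt (fun r => v r / r) (-(Om r) / (r ^ 2 * (r ^ 2 + 1))) r := by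
    intro r hr
    have r0' : r ≠ 0 := by linarith
    refine ((hv r).div (hasDerivAt_id r) r0').congr_deriv ?_
    have : r ^ 2 + 1 ≠ 0 := by positivity
    simp only [id, hOm]
    field_simp
    ring
  have tq : Tendsto (fun r => v r / r) atTop (nhds 0) := hvt.div_atTop tendsto_id
  -- second decay
  set D := B / 3 with hD
  have hD0 : 0 < D := by positivity
  have d2 : ∀ r, a ≤ r → v r ≤ D / r ^ 2 := by
    intro r hr
    have r0 : 0 < r := by linarith
    have := le_lim_of_deriv_nonneg (f := fun r => v r / r - D / r ^ 3) (L := 0 - 0) (a := a)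
      (tq.sub (tendsto_div_pow_top' D (by norm_num)))
      (fun t ht => (dq t ht).sub (hasDerivAt_div_pow D 3 (by linarith))) (by
        intro t ht
        have t0 : 0 < t := by linarith
        have e1 := hB t ht
        have e2 : -(((3:ℕ):ℝ) * D) / t ^ (3 + 1) = - (B / t ^ 4) := by
          rw [hD]; push_cast; ring
        have e3 : Om t / (t ^ 2 * (t ^ 2 + 1)) ≤ B / t ^ 4 := by
          apply div_le_div₀ hB0.le e1 (by positivity)
          nlinarith [sq_nonneg t]
        rw [e2, neg_div]; linarith) hr
    have h2 : v r / r ≤ D / r ^ 3 := by linarith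
    rw [div_le_div_iff₀ r0 (by positivity)] at h2
    rw [le_div_iff₀ (by positivity)]
    have : r * (v r * r ^ 2) ≤ r * D := by nlinarith
    exact le_of_mul_le_mul_left this r0
  have Om_ge : ∀ r, a ≤ r → l ≤ Om r + (D ^ 3 / 2) / r ^ 4 := by
    intro r hr
    have := lim_le_of_deriv_nonpos (f := fun r => Om r + (D ^ 3 / 2) / r ^ 4) (L := l + 0) (a := a)
      (hl.add (tendsto_div_pow_top' (D ^ 3 / 2) (by norm_num)))
      (fun t ht => (dOm t).add (hasDerivAt_div_pow (D ^ 3 / 2) 4 (by linarith))) (by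
        intro t ht
        have t0 : 0 < t := by linarith
        have e1 := dOm1 t ht
        have e2 : v t ^ 3 ≤ (D / t ^ 2) ^ 3 := by
          have := d2 t ht
          have := (hv0 t).le
          gcongr
        have e3 : t * (2 * v t ^ 3) ≤ t * (2 * (D / t ^ 2) ^ 3) := by gcongr
        have e4 : t * (2 * (D / t ^ 2) ^ 3) = 2 * D ^ 3 / t ^ 5 := by field_simp
        have e5 : -(((4:ℕ):ℝ) * (D ^ 3 / 2)) / t ^ (4 + 1) = - (2 * D ^ 3 / t ^ 5) := by
          push_cast; ring
        rw [e5]; linarith) hr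
    linarith
  set α := l / 3 with hα
  have hα0 : 0 < α := by positivity
  set C1 := (l + D ^ 3) / 5 with hC1
  have hC1p : 0 < C1 := by positivity
  have fin : ∀ r, a ≤ r → |v r - α / r ^ 2| ≤ C1 / r ^ 4 := by
    intro r hr
    have r0 : 0 < r := by linarith
    have up := le_lim_of_deriv_nonneg (f := fun r => v r / r - α / r ^ 3) (L := 0 - 0) (a := a)
      (tq.sub (tendsto_div_pow_top' α (by norm_num)))
      (fun t ht => (dq t ht).sub (hasDerivAt_div_pow α 3 (by linarith))) (by
        intro t ht
        have t0 : 0 < t := by linarith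
        have e1 := Om_le t ht
        have e2 : -(((3:ℕ):ℝ) * α) / t ^ (3 + 1) = - (l / t ^ 4) := by
          rw [hα]; push_cast; ring
        have e3 : Om t / (t ^ 2 * (t ^ 2 + 1)) ≤ l / t ^ 4 := by
          apply div_le_div₀ hl0.le e1 (by positivity)
          nlinarith [sq_nonneg t]
        rw [e2, neg_div]; linarith) hr
    have lo := lim_le_of_deriv_nonpos (f := fun r => v r / r - α / r ^ 3 + C1 / r ^ 5)
      (L := 0 - 0 + 0) (a := a)
      ((tq.sub (tendsto_div_pow_top' α (by norm_num))).add
        (tendsto_div_pow_top' C1 (by norm_num)))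
      (fun t ht => ((dq t ht).sub (hasDerivAt_div_pow α 3 (by linarith))).add
        (hasDerivAt_div_pow C1 5 (by linarith))) (by
        intro t ht
        have t0 : 0 < t := by linarith
        have e1 := Om_ge t ht
        have e2 : -(((3:ℕ):ℝ) * α) / t ^ (3 + 1) = - (l / t ^ 4) := by
          rw [hα]; push_cast; ring
        have e3 : -(((5:ℕ):ℝ) * C1) / t ^ (5 + 1) = - ((l + D ^ 3) / t ^ 6) := by
          rw [hC1]; push_cast; ring
        have e4 : l - D ^ 3 / t ^ 2 ≤ Om t := by
          have : (D ^ 3 / 2) / t ^ 4 ≤ D ^ 3 / t ^ 2 := by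
            apply div_le_div₀ (by positivity) (by linarith [pow_pos hD0 3]) (by positivity)
            exact pow_le_pow_right₀ (by linarith) (by norm_num)
          linarith
        have e5 : l / t ^ 4 - (l + D ^ 3) / t ^ 6 ≤ Om t / (t ^ 2 * (t ^ 2 + 1)) := by
          rw [le_div_iff₀ (by positivity)]
          refine le_trans ?_ e4
          have : (l / t ^ 4 - (l + D ^ 3) / t ^ 6) * (t ^ 2 * (t ^ 2 + 1))
            = l - D ^ 3 / t ^ 2 - (l + D ^ 3) / t ^ 4 := by
              field_simp
              ring
          rw [this]
          have : 0 ≤ (l + D ^ 3) / t ^ 4 := by positivity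
          linarith
        rw [e2, e3, neg_div]; linarith) hr
    have m1 : (v r / r - α / r ^ 3) * r = v r - α / r ^ 2 := by field_simp
    have m2 : (C1 / r ^ 5) * r = C1 / r ^ 4 := by field_simp
    have m3 : 0 ≤ C1 / r ^ 4 := by positivity
    rw [abs_le]
    constructor
    · have := mul_nonneg (show 0 ≤ (v r / r - α / r ^ 3) + (C1 / r ^ 5) by linarith) r0.le
      rw [add_mul, m1, m2] at this
      linarith
    · have := mul_nonneg (show 0 ≤ -(v r / r - α / r ^ 3) by linarith) r0.le
      rw [neg_mul, m1] at this
      linarith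
  have cont : ContinuousOn (fun r => v r - α / r ^ 2) (Set.Icc 1 a) := by
    intro r hr
    have : r ≠ 0 := by linarith [hr.1]
    exact ((hv r).continuousAt.sub (hasDerivAt_div_pow α 2 this).continuousAt).continuousWithinAt
  obtain ⟨M, hM⟩ := isCompact_Icc.exists_bound_of_continuousOn cont
  refine ⟨α, hα0, C1 + |M| * a ^ 4, by positivity, fun r hr => ?_⟩
  have r0 : 0 < r := by linarith
  rcases le_total a r with h | h
  · refine (fin r h).trans ?_
    gcongr
    have : 0 ≤ |M| * a ^ 4 := by positivity
    linarith
  · have h1 := (hM r ⟨hr, h⟩).trans (le_abs_self M)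
    rw [Real.norm_eq_abs] at h1
    refine h1.trans ?_
    rw [le_div_iff₀ (by positivity)]
    have : |M| * r ^ 4 ≤ |M| * a ^ 4 := by gcongr
    linarith

theorem Sr.asymp {F W : ℝ → ℝ} (h : Sr F W) {n : ℕ} (h0 : Tendsto F atBot (nhds 0))
    (hn : Tendsto F atTop (nhds (n * π))) (hm : StrictMono F) (hp : ∀ r, 0 < W r) :
    ∃ α : ℝ, 0 < α ∧ ∃ C : ℝ, 0 < C ∧
      ∀ r : ℝ, 1 ≤ r → |F r - (n : ℝ) * π + α / r ^ 2| ≤ C / r ^ 4 := by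
  have hE := h.sx.En_nonneg (gx_lim' h0) (gx_lim hn)
  have hsin : ∀ u : ℝ, Real.sin (n * π - u) ^ 2 = Real.sin u ^ 2 := by
    intro u
    have : n * π - u = - (u - n * π) := by ring
    rw [this, Real.sin_neg, Real.sin_sub_nat_mul_pi, neg_sq, mul_pow, ← pow_mul]
    simp
  obtain ⟨α, hα, C, hC, H⟩ := _root_.asymp (v := fun r => n * π - F r) (W := W)
    (fun r => by
      have := (h r).1.const_sub (n * π)
      rwa [← neg_div] at this)
    (fun r => by
      refine (h r).2.congr_deriv ?_
      have : 2 * (n * π - F r) = -(2 * F r - n * (2 * π)) := by ring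
      rw [this, Real.sin_neg, Real.sin_sub_nat_mul_two_pi, neg_neg])
    (fun r => by
      have h1 : F r < F (r + 1) := hm (by linarith)
      have h2 := hm.monotone.ge_of_tendsto hn (r + 1)
      linarith)
    hp (by simpa using hn.const_sub (n * π))
    (fun r => by
      have h1 := hE (Real.arsinh r)
      simp only [En, gx, px, Real.sinh_arsinh] at h1
      have h2 : Real.cosh (Real.arsinh r) ^ 2 = r ^ 2 + 1 := by
        rw [Real.cosh_sq, Real.sinh_arsinh]
      rw [div_pow, h2] at h1
      rw [hsin]
      have h3 : 2 * Real.sin (F r) ^ 2 ≤ W r ^ 2 / (r ^ 2 + 1) := by linarith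
      rwa [le_div_iff₀ (by positivity)] at h3)
  refine ⟨α, hα, C, hC, fun r hr => ?_⟩
  rw [← abs_neg]
  convert H r hr using 2
  ring

theorem stmt0 (n : ℕ) :
    (∃! Q : ℝ → ℝ, IsHarmonicMapSol Q ∧
        Tendsto Q atBot (nhds 0) ∧ Tendsto Q atTop (nhds ((n : ℝ) * Real.pi))) ∧
    (∀ Q : ℝ → ℝ, IsHarmonicMapSol Q →
        Tendsto Q atBot (nhds 0) → Tendsto Q atTop (nhds ((n : ℝ) * Real.pi)) →
        (n = 0 → Q = fun _ => 0) ∧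
        (1 ≤ n → StrictMono Q ∧ (∀ r : ℝ, Q r + Q (-r) = (n : ℝ) * Real.pi) ∧
          ∃ α : ℝ, 0 < α ∧ ∃ C : ℝ, 0 < C ∧
            (∀ r : ℝ, 1 ≤ r → |Q r - (n : ℝ) * Real.pi + α / r ^ 2| ≤ C / r ^ 4) ∧
            (∀ r : ℝ, r ≤ -1 → |Q r - α / r ^ 2| ≤ C / |r| ^ 4))) := by
  refine ⟨?_, ?_⟩
  · rcases Nat.eq_zero_or_pos n with hn | hn
    · subst hn
      refine ⟨fun _ => 0, ⟨?_, tendsto_const_nhds, by simp⟩, ?_⟩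
      · refine Sr.to_sol (W := fun _ => 0) fun r => ⟨?_, ?_⟩
        · simpa using hasDerivAt_const r (0:ℝ)
        · simpa using hasDerivAt_const r (0:ℝ)
      · rintro Q ⟨hQ, h0, h1⟩
        exact ((Sr.of_sol hQ).sign_info h0 h1).1 rfl
    · obtain ⟨F, W, h, h0, h1⟩ := exist_full hn
      refine ⟨F, ⟨h.to_sol, h0, h1⟩, ?_⟩
      rintro Q ⟨hQ, hQ0, hQ1⟩
      exact Sr.uniq hn (Sr.of_sol hQ) h hQ0 hQ1 h0 h1
  · intro Q hQ h0 h1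
    have h := Sr.of_sol hQ
    refine ⟨(h.sign_info h0 h1).1, fun hn => ?_⟩
    have hp := (h.sign_info h0 h1).2 hn
    have hm : StrictMono Q := strictMono_of_hasDerivAt_pos (fun r => (h r).1)
      (fun r => div_pos (hp r) (by positivity))
    have hs : ∀ r : ℝ, Q r + Q (-r) = (n : ℝ) * Real.pi := by
      intro r
      have := congrFun (Sr.uniq hn h (h.reflect n) h0 h1 (tendsto_reflect' h1) (tendsto_reflect h0)) r
      linarith
    obtain ⟨α, hα, C, hC, H⟩ := h.asymp h0 h1 hm hp
    refine ⟨hm, hs, α, hα, C, hC, H, fun r hr => ?_⟩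
    have h2 := H (-r) (by linarith)
    have e1 : |r| ^ 4 = (-r) ^ 4 := by rw [abs_of_nonpos (by linarith)]
    rw [e1, ← abs_neg]
    have e2 := hs r
    convert h2 using 2
    rw [neg_sq]
    linarith
end

section
/- (i) For any r₀, a, b ∈ ℝ there exists a C² solution F : ℝ → ℝ of the harmonic map ODE, defined on all of ℝ, with F(r₀) = a and F'(r₀) = b. (ii) If F : ℝ → ℝ is a C² solution of the harmonic map ODE, then the limits lim_{r→+∞} F(r) and lim_{r→-∞} F(r) both exist, and each belongs to the set {kπ/2 : k ∈ ℤ} (that is, to ℤπ ∪ (ℤ + 1/2)π). -/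
open Real Filter MeasureTheory

lemma hm_exists_cos_ne (d a b : ℝ) (hab : a < b) :
    ∃ c, a < c ∧ c < b ∧ Real.cos (2 * c) ≠ d := by
  by_contra! hcon
  obtain ⟨t, ht0, ht1, ht2⟩ : ∃ t : ℝ, 0 < t ∧ t ≤ (b - a) / 4 ∧ t ≤ 1 / 2 :=
    ⟨min ((b - a) / 4) (1 / 2), lt_min (by linarith) (by norm_num), min_le_left _ _,
      min_le_right _ _⟩
  have h0 := hcon ((a + b) / 2) (by linarith) (by linarith)
  have h1 := hcon ((a + b) / 2 + t) (by linarith) (by linarith)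
  have h2 := hcon ((a + b) / 2 - t) (by linarith) (by linarith)
  rw [mul_add, Real.cos_add] at h1
  rw [mul_sub, Real.cos_sub] at h2
  have hs : 0 < Real.sin (2 * t) :=
    Real.sin_pos_of_pos_of_lt_pi (by linarith) (by linarith [Real.pi_gt_three])
  have e1 := Real.sin_sq_add_cos_sq (2 * t)
  have e2 := Real.sin_sq_add_cos_sq (2 * ((a + b) / 2))
  have hz : Real.sin (2 * ((a + b) / 2)) * Real.sin (2 * t) = 0 := by linarith
  have hz' : Real.sin (2 * ((a + b) / 2)) = 0 := by
    rcases mul_eq_zero.1 hz with h | h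
    · exact h
    · exact absurd h hs.ne'
  rw [hz'] at e2
  have hm : Real.cos (2 * ((a + b) / 2)) * (Real.cos (2 * t) - 1) = 0 := by linarith
  rcases mul_eq_zero.1 hm with h | h
  · rw [h] at e2; norm_num at e2
  · have : Real.cos (2 * t) = 1 := by linarith
    rw [this] at e1
    nlinarith

lemma hm_ivt {f : ℝ → ℝ} (hf : Continuous f) {X c x y : ℝ} (hx : X ≤ x) (hy : X ≤ y)
    (h1 : f x ≤ c) (h2 : c ≤ f y) : ∃ z, X ≤ z ∧ f z = c := by
  have := intermediate_value_uIcc (a := x) (b := y) hf.continuousOn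
  obtain ⟨z, hz, hzc⟩ := this (show c ∈ Set.uIcc (f x) (f y) from Set.mem_uIcc.2 (Or.inl ⟨h1, h2⟩))
  refine ⟨z, ?_, hzc⟩
  rcases Set.mem_uIcc.1 hz with h | h <;> linarith [h.1]

lemma hm_conv {f : ℝ → ℝ} (hf : Continuous f) (d : ℝ)
    (h : Tendsto (fun x => Real.cos (2 * f x)) atTop (nhds d)) :
    ∃ L, Tendsto f atTop (nhds L) := by
  have key : ∀ c, Real.cos (2 * c) ≠ d → ∃ X, ∀ x ≥ X, Real.cos (2 * f x) ≠ Real.cos (2 * c) := by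
    intro c hc
    exact eventually_atTop.1 (h.eventually_ne hc.symm)
  have hbd : ∃ A B : ℝ, ∀ᶠ x in atTop, A ≤ f x ∧ f x ≤ B := by
    obtain ⟨c, -, -, hc⟩ := hm_exists_cos_ne d 0 1 one_pos
    obtain ⟨X, hX⟩ := key c hc
    have hX' : ∀ x ≥ X, ∀ k : ℤ, f x ≠ c + k * Real.pi := by
      intro x hx k hk
      apply hX x hx
      rw [hk, show 2 * (c + k * Real.pi) = 2 * c + k * (2 * Real.pi) by ring,
        Real.cos_add_int_mul_two_pi]
    set k := ⌊(f X - c) / Real.pi⌋ with hk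
    have k1 : (k : ℝ) ≤ (f X - c) / Real.pi := Int.floor_le _
    have k2 : (f X - c) / Real.pi < k + 1 := Int.lt_floor_add_one _
    rw [le_div_iff₀ Real.pi_pos] at k1
    rw [div_lt_iff₀ Real.pi_pos] at k2
    refine ⟨c + k * Real.pi, c + ((k + 1 : ℤ) : ℝ) * Real.pi, eventually_atTop.2 ⟨X, ?_⟩⟩
    intro x hx
    constructor
    · by_contra! hlt
      obtain ⟨z, hz, hz'⟩ := hm_ivt hf hx le_rfl hlt.le (by linarith)
      exact hX' z hz _ hz'
    · by_contra! hlt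
      obtain ⟨z, hz, hz'⟩ := hm_ivt (c := c + ((k + 1 : ℤ) : ℝ) * Real.pi) hf le_rfl hx
        (by push_cast; linarith) hlt.le
      exact hX' z hz _ hz'
  obtain ⟨A, B, hAB⟩ := hbd
  refine tendsto_of_no_upcrossings dense_univ ?_ ?_ ?_
  · rintro a - b - hab ⟨h1, h2⟩
    obtain ⟨c, hac, hcb, hc⟩ := hm_exists_cos_ne d a b hab
    obtain ⟨X, hX⟩ := key c hc
    obtain ⟨x, hx, hx'⟩ := frequently_atTop.1 h1 X
    obtain ⟨y, hy, hy'⟩ := frequently_atTop.1 h2 X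
    obtain ⟨z, hz, hz'⟩ := hm_ivt (c := c) hf hx hy (by linarith) (by linarith)
    exact hX z hz (by rw [hz'])
  · exact ⟨B, by simpa using hAB.mono fun x hx => hx.2⟩
  · exact ⟨A, by simpa using hAB.mono fun x hx => hx.1⟩

lemma hm_asymp {f p τ : ℝ → ℝ} (hf : ∀ x, HasDerivAt f (p x) x)
    (hp : ∀ x, HasDerivAt p (Real.sin (2 * f x) - τ x * p x) x)
    (hτ : ∀ x, |τ x| ≤ 1) (hτ' : ∀ x, 1 ≤ x → 1 / 2 ≤ τ x) :
    ∃ L : ℝ, Tendsto f atTop (nhds L) ∧ ∃ k : ℤ, L = (k : ℝ) * Real.pi / 2 := by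
  have hfc : Continuous f := continuous_iff_continuousAt.2 fun x => (hf x).continuousAt
  set H : ℝ → ℝ := fun x => p x ^ 2 / 2 - Real.sin (f x) ^ 2 with hH
  have hHd : ∀ x, HasDerivAt H (- τ x * p x ^ 2) x := by
    intro x
    have := (((hp x).pow 2).div_const 2).sub (((hf x).sin).pow 2)
    refine this.congr_deriv ?_
    rw [Real.sin_two_mul]
    push_cast
    ring
  have hHanti : AntitoneOn H (Set.Ici 1) := by
    apply antitoneOn_of_deriv_nonpos (convex_Ici 1)
    · exact fun x _ => (hHd x).continuousAt.continuousWithinAt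
    · exact fun x _ => (hHd x).differentiableAt.differentiableWithinAt
    · intro x hx
      rw [interior_Ici] at hx
      rw [(hHd x).deriv]
      have := hτ' x (le_of_lt hx)
      nlinarith [sq_nonneg (p x)]
  have hHlow : ∀ x, -1 ≤ H x := fun x => by
    simp only [hH]; nlinarith [Real.sin_sq_le_one (f x), sq_nonneg (p x)]
  obtain ⟨h, hh⟩ : ∃ h, Tendsto H atTop (nhds h) := by
    have ha : Antitone (fun x => H (max 1 x)) := fun x y hxy =>
      hHanti (Set.mem_Ici.2 (le_max_left _ _)) (Set.mem_Ici.2 (le_max_left _ _)) (max_le_max le_rfl hxy)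
    refine ⟨_, (tendsto_atTop_ciInf ha ⟨-1, ?_⟩).congr' ?_⟩
    · rintro _ ⟨x, rfl⟩; exact hHlow _
    · filter_upwards [eventually_ge_atTop 1] with x hx
      rw [max_eq_right hx]
  obtain ⟨M, hM0, hM⟩ : ∃ M : ℝ, 0 < M ∧ ∀ x, 1 ≤ x → |p x| ≤ M := by
    refine ⟨2 * (H 1 + 1) + 1, by linarith [hHlow 1], fun x hx => ?_⟩
    have h1 : H x ≤ H 1 := hHanti (Set.mem_Ici.2 le_rfl) hx hx
    simp only [hH] at h1 ⊢
    have h2 := Real.sin_sq_le_one (f x)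
    have h3 := sq_abs (p x)
    nlinarith [sq_nonneg (|p x| - 1), abs_nonneg (p x)]
  set N := M * (1 + M) with hN
  have hN0 : 0 < N := by positivity
  have hpp : ∀ x, 1 ≤ x → |p x * (Real.sin (2 * f x) - τ x * p x)| ≤ N := by
    intro x hx
    rw [abs_mul]
    have h1 : |Real.sin (2 * f x) - τ x * p x| ≤ 1 + M := by
      refine (abs_sub _ _).trans (add_le_add (Real.abs_sin_le_one _) ?_)
      rw [abs_mul]
      nlinarith [hM x hx, hτ x, abs_nonneg (p x), abs_nonneg (τ x)]
    exact mul_le_mul (hM x hx) h1 (abs_nonneg _) hM0.le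
  have hmono : MonotoneOn (fun s => p s ^ 2 + 2 * N * s) (Set.Ici 1) := by
    have hd : ∀ x, HasDerivAt (fun s => p s ^ 2 + 2 * N * s)
        (2 * (p x * (Real.sin (2 * f x) - τ x * p x)) + 2 * N) x := by
      intro x
      refine (((hp x).pow 2).add ((hasDerivAt_id x).const_mul (2 * N))).congr_deriv ?_
      push_cast
      ring
    apply monotoneOn_of_deriv_nonneg (convex_Ici 1)
    · exact fun x _ => (hd x).continuousAt.continuousWithinAt
    · exact fun x _ => (hd x).differentiableAt.differentiableWithinAt
    · intro x hx
      rw [interior_Ici] at hx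
      rw [(hd x).deriv]
      linarith [(abs_le.1 (hpp x (le_of_lt hx))).1]
  have hbar : ∀ x δ : ℝ, 1 ≤ x → 0 < δ → p x ^ 2 * δ ≤ 2 * (H x - H (x + δ)) + N * δ ^ 2 := by
    intro x δ hx hδ
    have hd : ∀ s, HasDerivAt (fun s => H s + (p x ^ 2 * s - N * (s - x) ^ 2) / 2)
        (- τ s * p s ^ 2 + (p x ^ 2 - N * (2 * (s - x))) / 2) s := by
      intro s
      refine ((hHd s).add ((((hasDerivAt_id s).const_mul (p x ^ 2)).sub
        ((((hasDerivAt_id s).sub_const x).pow 2).const_mul N)).div_const 2)).congr_deriv ?_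
      push_cast
      simp
    have hanti : AntitoneOn (fun s => H s + (p x ^ 2 * s - N * (s - x) ^ 2) / 2) (Set.Ici x) := by
      apply antitoneOn_of_deriv_nonpos (convex_Ici x)
      · exact fun s _ => (hd s).continuousAt.continuousWithinAt
      · exact fun s _ => (hd s).differentiableAt.differentiableWithinAt
      · intro s hs
        rw [interior_Ici] at hs
        have hs' : x < s := hs
        rw [(hd s).deriv]
        have h1 := hmono (Set.mem_Ici.2 hx) (Set.mem_Ici.2 (hx.trans hs'.le)) hs'.le
        simp only at h1
        have h2 := hτ' s (hx.trans hs'.le)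
        nlinarith [sq_nonneg (p s)]
    have := hanti (Set.mem_Ici.2 le_rfl) (Set.mem_Ici.2 (show x ≤ x + δ by linarith))
      (by linarith)
    simp only at this
    nlinarith
  have hp2 : Tendsto (fun x => p x ^ 2) atTop (nhds 0) := by
    rw [Metric.tendsto_atTop']
    intro ε hε
    obtain ⟨δ, hδ, hδ'⟩ : ∃ δ, 0 < δ ∧ N * δ = ε / 2 := ⟨ε / 2 / N, by positivity, by field_simp⟩
    have ht : Tendsto (fun x => 2 * (H x - H (x + δ))) atTop (nhds 0) := by
      have := (hh.sub (hh.comp (tendsto_atTop_add_const_right atTop δ tendsto_id))).const_mul 2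
      simpa using this
    have he := ht.eventually (gt_mem_nhds (show (0:ℝ) < ε / 2 * δ by positivity))
    obtain ⟨X, hX⟩ := eventually_atTop.1 (he.and (eventually_ge_atTop 1))
    refine ⟨X, fun x hx => ?_⟩
    obtain ⟨h1, h2⟩ := hX x hx.le
    have h3 := hbar x δ h2 hδ
    rw [Real.dist_eq, sub_zero, abs_of_nonneg (sq_nonneg _)]
    have h4 : N * δ ^ 2 = ε / 2 * δ := by rw [← hδ']; ring
    have h5 : p x ^ 2 * δ < ε * δ := by linarith
    exact lt_of_mul_lt_mul_right h5 hδ.le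
  have hp0 : Tendsto p atTop (nhds 0) := by
    rw [tendsto_zero_iff_abs_tendsto_zero]
    have := hp2.sqrt
    rw [Real.sqrt_zero] at this
    exact this.congr fun x => Real.sqrt_sq_eq_abs _
  obtain ⟨L, hL⟩ : ∃ L, Tendsto f atTop (nhds L) := by
    refine hm_conv hfc (1 - 2 * (0 / 2 - h)) ?_
    refine (tendsto_const_nhds.sub (((hp2.div_const 2).sub hh).const_mul 2)).congr fun x => ?_
    simp only [hH]
    rw [Real.cos_two_mul, Real.cos_sq']
    ring
  refine ⟨L, hL, ?_⟩
  have hq : Tendsto (fun x => Real.sin (2 * f x) - τ x * p x) atTop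
      (nhds (Real.sin (2 * L) - 0)) := by
    refine Tendsto.sub ((Real.continuous_sin.tendsto _).comp (hL.const_mul 2)) ?_
    refine squeeze_zero_norm (fun x => ?_) (tendsto_zero_iff_abs_tendsto_zero _ |>.1 hp0)
    rw [Real.norm_eq_abs, abs_mul]
    simpa using mul_le_mul_of_nonneg_right (hτ x) (abs_nonneg (p x))
  have hmv : ∀ x, ∃ c, x < c ∧ Real.sin (2 * f c) - τ c * p c = p (x + 1) - p x := by
    intro x
    obtain ⟨c, hc, hc'⟩ := exists_hasDerivAt_eq_slope p
      (fun c => Real.sin (2 * f c) - τ c * p c) (show x < x + 1 by linarith)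
      (fun x _ => (hp x).continuousAt.continuousWithinAt) (fun x _ => hp x)
    exact ⟨c, hc.1, by simpa using hc'⟩
  choose c hc hc' using hmv
  have hct : Tendsto c atTop atTop := tendsto_atTop_mono (fun x => (hc x).le) tendsto_id
  have l1 := hq.comp hct
  have l2 : Tendsto (fun x => p (x + 1) - p x) atTop (nhds (0 - 0)) :=
    (hp0.comp (tendsto_atTop_add_const_right atTop (1:ℝ) tendsto_id)).sub hp0
  have hs := tendsto_nhds_unique (l1.congr hc') l2
  rw [sub_zero, sub_zero] at hs
  obtain ⟨k, hk⟩ := Real.sin_eq_zero_iff.1 hs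
  exact ⟨k, by linarith⟩

lemma hm_global {E : Type*} [NormedAddCommGroup E] [NormedSpace ℝ E] [CompleteSpace E]
    (v : ℝ → E → E) (K L : NNReal) (hlip : ∀ t, LipschitzWith K (v t))
    (hcont : ∀ x, Continuous fun t => v t x) (hb : ∀ t x, ‖v t x‖ ≤ L) (t₀ : ℝ) (x₀ : E) :
    ∃ α : ℝ → E, α t₀ = x₀ ∧ ∀ t, HasDerivAt α (v t (α t)) t := by
  have hloc : ∀ T : ℝ, ∃ α : ℝ → E, 0 < T → α t₀ = x₀ ∧
      ∀ t ∈ Set.Ioo (t₀ - T) (t₀ + T), HasDerivAt α (v t (α t)) t := by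
    intro T
    by_cases hT : 0 < T
    swap
    · exact ⟨fun _ => 0, fun h => absurd h hT⟩
    have hpl : IsPicardLindelof v (tmin := t₀ - T) (tmax := t₀ + T)
        ⟨t₀, by constructor <;> linarith⟩ x₀ (L * T.toNNReal) 0 L K :=
      { lipschitzOnWith := fun t _ => (hlip t).lipschitzOnWith
        continuousOn := fun x _ => (hcont x).continuousOn
        norm_le := fun t _ x _ => hb t x
        mul_max_le := by simp [hT.le] }
    obtain ⟨α, h1, h2⟩ := hpl.exists_eq_forall_mem_Icc_hasDerivWithinAt₀
    exact ⟨α, fun _ => ⟨h1, fun t ht =>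
      (h2 t (Set.Ioo_subset_Icc_self ht)).hasDerivAt (Icc_mem_nhds ht.1 ht.2)⟩⟩
  choose α hα using hloc
  have huniq : ∀ S T : ℝ, 0 < S → S ≤ T → Set.EqOn (α S) (α T) (Set.Ioo (t₀ - S) (t₀ + S)) := by
    intro S T hS hST
    refine ODE_solution_unique_of_mem_Ioo (v := v) (K := K) (s := fun _ => Set.univ) (t₀ := t₀)
      (fun t _ => (hlip t).lipschitzOnWith) (by constructor <;> linarith) ?_ ?_ ?_
    · exact fun t ht => ⟨(hα S hS).2 t ht, trivial⟩
    · exact fun t ht => ⟨(hα T (hS.trans_le hST)).2 t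
        ⟨by linarith [ht.1], by linarith [ht.2]⟩, trivial⟩
    · rw [(hα S hS).1, (hα T (hS.trans_le hST)).1]
  have hmem : ∀ t S, |t - t₀| < S → t ∈ Set.Ioo (t₀ - S) (t₀ + S) := by
    intro t S h
    have := abs_lt.1 h
    constructor <;> linarith [this.1, this.2]
  refine ⟨fun t => α (|t - t₀| + 1) t, ?_, fun t => ?_⟩
  · exact (hα _ (by positivity)).1
  · have hpos : 0 < |t - t₀| + 2 := by positivity
    have h1 := (hα _ hpos).2 t (hmem t _ (by linarith))
    have heq : ∀ s, |s - t₀| < |t - t₀| + 1 → α (|s - t₀| + 1) s = α (|t - t₀| + 2) s := by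
      intro s hs
      exact huniq _ _ (by positivity) (by linarith) (hmem s _ (by linarith))
    have h2 := heq t (by linarith)
    simp only
    rw [h2]
    refine h1.congr_of_eventuallyEq ?_
    have : Continuous fun s : ℝ => |s - t₀| := by fun_prop
    filter_upwards [this.continuousAt.eventually (gt_mem_nhds (show |t - t₀| < |t - t₀| + 1 by linarith))]
      with s hs
    exact heq s hs

lemma hm_existence (r₀ a b : ℝ) :
    ∃ F : ℝ → ℝ, IsHarmonicMapSol F ∧ F r₀ = a ∧ deriv F r₀ = b := by
  set g := b * (r₀ ^ 2 + 1) with hg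
  set C : ℝ := |g| + |r₀| + 1 with hC
  have hC1 : 1 ≤ C := by simp only [hC]; linarith [abs_nonneg g, abs_nonneg r₀]
  set v : ℝ → ℝ × ℝ → ℝ × ℝ := fun t x =>
    (max (-C) (min C (x.2 / (t ^ 2 + 1))), Real.sin (2 * x.1)) with hv
  obtain ⟨α, hα0, hα⟩ := hm_global v 2 ⟨C, by linarith⟩ (by
      intro t
      apply LipschitzWith.of_dist_le_mul
      intro x y
      have hx1 : dist x.1 y.1 ≤ dist x y := le_max_left _ _
      have hx2 : dist x.2 y.2 ≤ dist x y := le_max_right _ _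
      rw [Real.dist_eq] at hx1 hx2
      rw [Prod.dist_eq]
      apply max_le
      · simp only [hv, Real.dist_eq]
        refine (abs_max_sub_max_le_max _ _ _ _).trans ?_
        rw [sub_self, abs_zero, max_eq_right (abs_nonneg _)]
        refine (abs_min_sub_min_le_max _ _ _ _).trans ?_
        rw [sub_self, abs_zero, max_eq_right (abs_nonneg _), ← sub_div, abs_div,
          abs_of_pos (show (0:ℝ) < t ^ 2 + 1 by positivity)]
        refine (div_le_self (abs_nonneg _) (by nlinarith [sq_nonneg t])).trans ?_
        simp only [NNReal.coe_ofNat]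
        linarith [dist_nonneg (x := x) (y := y)]
      · have := Real.lipschitzWith_sin.dist_le_mul (2 * x.1) (2 * y.1)
        refine this.trans ?_
        rw [Real.dist_eq, ← mul_sub, abs_mul]
        simp
        linarith)
    (by
      intro x
      simp only [hv]
      have : ∀ t : ℝ, t ^ 2 + 1 ≠ 0 := fun t => by positivity
      fun_prop (disch := exact this _))
    (by
      intro t x
      rw [Prod.norm_def]
      apply max_le
      · simp only [hv, Real.norm_eq_abs]
        rw [abs_le]
        exact ⟨le_max_left _ _, max_le (by linarith) (min_le_left _ _)⟩
      · simp only [hv, Real.norm_eq_abs]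
        exact (Real.abs_sin_le_one _).trans hC1) r₀ (a, g)
  set F := fun t => (α t).1 with hF
  set G := fun t => (α t).2 with hG
  have hG' : ∀ t, HasDerivAt G (Real.sin (2 * F t)) t := fun t => (hα t).snd
  have hF0' : ∀ t, HasDerivAt F (max (-C) (min C (G t / (t ^ 2 + 1)))) t := fun t => (hα t).fst
  have hpos : ∀ t : ℝ, 0 < t ^ 2 + 1 := fun t => by positivity
  have hGb : ∀ t, |G t / (t ^ 2 + 1)| ≤ C := by
    intro t
    have h1 : |G t - g| ≤ |t - r₀| := by
      have := convex_univ.norm_image_sub_le_of_norm_hasDerivWithin_le (f := G) (C := 1)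
        (fun x _ => (hG' x).hasDerivWithinAt) (fun x _ => Real.abs_sin_le_one _)
        (Set.mem_univ r₀) (Set.mem_univ t)
      have h0 : G r₀ = g := by simp [hG, hα0]
      simpa [h0, Real.norm_eq_abs] using this
    have h2 : |G t| ≤ |g| + |t - r₀| := by
      have := abs_add_le (G t - g) g
      rw [sub_add_cancel] at this
      linarith
    have h3 := abs_sub t r₀
    rw [abs_div, abs_of_pos (hpos t), div_le_iff₀ (hpos t)]
    have h4 := sq_abs t
    have h5 : |t| ≤ t ^ 2 + 1 := by nlinarith [sq_nonneg (|t| - 1), abs_nonneg t]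
    simp only [hC]
    nlinarith [sq_nonneg t, abs_nonneg g, abs_nonneg r₀]
  have hF' : ∀ t, HasDerivAt F (G t / (t ^ 2 + 1)) t := by
    intro t
    have := abs_le.1 (hGb t)
    have h := hF0' t
    rwa [min_eq_right this.2, max_eq_right this.1] at h
  have hdF : deriv F = fun t => G t / (t ^ 2 + 1) := funext fun t => (hF' t).deriv
  have hdG : deriv G = fun t => Real.sin (2 * F t) := funext fun t => (hG' t).deriv
  have hFd : Differentiable ℝ F := fun t => (hF' t).differentiableAt
  have hGd : Differentiable ℝ G := fun t => (hG' t).differentiableAt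
  have hG1 : ContDiff ℝ 1 G := by
    rw [contDiff_one_iff_deriv, hdG]
    have := hFd.continuous
    exact ⟨hGd, by fun_prop⟩
  have hF2 : ContDiff ℝ 2 F := by
    rw [show (2 : WithTop ℕ∞) = 1 + 1 by norm_num, contDiff_succ_iff_deriv]
    refine ⟨hFd, by simp, ?_⟩
    rw [hdF]
    exact hG1.div (by fun_prop) fun t => (hpos t).ne'
  refine ⟨F, ⟨hF2, fun r => ?_⟩, by simp [hF, hα0], ?_⟩
  · have hd2 : HasDerivAt (fun t => G t / (t ^ 2 + 1))
        ((Real.sin (2 * F r) * (r ^ 2 + 1) - G r * (2 * r)) / (r ^ 2 + 1) ^ 2) r := by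
      refine ((hG' r).div (((hasDerivAt_id r).pow 2).add_const 1) (hpos r).ne').congr_deriv ?_
      simp
    rw [hdF, hd2.deriv]
    have := (hpos r).ne'
    field_simp
    ring
  · have h0 : G r₀ = g := by simp [hG, hα0]
    rw [hdF]
    simp only
    rw [h0, hg, mul_div_assoc, div_self (hpos r₀).ne', mul_one]

lemma hm_limits (F : ℝ → ℝ) (hF : IsHarmonicMapSol F) :
      (∃ L : ℝ, Tendsto F atTop (nhds L) ∧ ∃ k : ℤ, L = (k : ℝ) * Real.pi / 2) ∧
      (∃ L : ℝ, Tendsto F atBot (nhds L) ∧ ∃ k : ℤ, L = (k : ℝ) * Real.pi / 2) := by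
  obtain ⟨hC, hode⟩ := hF
  rw [show (2 : WithTop ℕ∞) = 1 + 1 by norm_num, contDiff_succ_iff_deriv] at hC
  obtain ⟨hFd, -, hC1⟩ := hC
  have hFd2 : Differentiable ℝ (deriv F) := hC1.differentiable (by norm_num)
  set f : ℝ → ℝ := fun x => F (Real.sinh x) with hf
  set p : ℝ → ℝ := fun x => deriv F (Real.sinh x) * Real.cosh x with hp
  set τ : ℝ → ℝ := fun x => Real.sinh x / Real.cosh x with hτ
  have hf' : ∀ x, HasDerivAt f (p x) x := fun x =>
    (hFd (Real.sinh x)).hasDerivAt.comp x (Real.hasDerivAt_sinh x)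
  have hp' : ∀ x, HasDerivAt p (Real.sin (2 * f x) - τ x * p x) x := by
    intro x
    have h1 : HasDerivAt (fun x => deriv F (Real.sinh x))
        (deriv (deriv F) (Real.sinh x) * Real.cosh x) x :=
      (hFd2 (Real.sinh x)).hasDerivAt.comp x (Real.hasDerivAt_sinh x)
    refine (h1.mul (Real.hasDerivAt_cosh x)).congr_deriv ?_
    have h2 := hode (Real.sinh x)
    have h3 := Real.cosh_sq x
    have h4 := (Real.cosh_pos x).ne'
    rw [← h3] at h2
    simp only [hf, hp, hτ]
    field_simp at h2 ⊢
    linarith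
  have hτ1 : ∀ x, |τ x| ≤ 1 := by
    intro x
    simp only [hτ]
    rw [abs_div, abs_of_pos (Real.cosh_pos x), div_le_one (Real.cosh_pos x)]
    rw [abs_le]
    have e1 := Real.cosh_add_sinh x
    have e2 := Real.cosh_sub_sinh x
    constructor <;> linarith [Real.exp_pos x, Real.exp_pos (-x)]
  have hτ2 : ∀ x, 1 ≤ x → 1 / 2 ≤ τ x := by
    intro x hx
    simp only [hτ]
    rw [le_div_iff₀ (Real.cosh_pos x)]
    have e1 := Real.cosh_add_sinh x
    have e2 := Real.cosh_sub_sinh x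
    have e3 := Real.add_one_le_exp x
    have e4 : Real.exp x * Real.exp (-x) = 1 := by rw [← Real.exp_add]; simp
    nlinarith [Real.exp_pos x, Real.exp_pos (-x)]
  have hars : Tendsto Real.arsinh atTop atTop :=
    Real.sinhOrderIso.symm.tendsto_atTop
  have hars' : Tendsto (fun r => - Real.arsinh r) atBot atTop :=
    tendsto_neg_atBot_atTop.comp Real.sinhOrderIso.symm.tendsto_atBot
  constructor
  · obtain ⟨L, hL, hk⟩ := hm_asymp hf' hp' hτ1 hτ2
    refine ⟨L, (hL.comp hars).congr fun r => ?_, hk⟩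
    simp [hf]
  · obtain ⟨L, hL, hk⟩ := hm_asymp (f := fun x => f (-x)) (p := fun x => - p (-x)) (τ := τ)
      (fun x => by
        refine ((hf' (-x)).comp x (hasDerivAt_neg x)).congr_deriv ?_
        ring)
      (fun x => by
        refine ((hp' (-x)).comp x (hasDerivAt_neg x)).neg.congr_deriv ?_
        simp only [hτ, Real.sinh_neg, Real.cosh_neg]
        ring) hτ1 hτ2
    refine ⟨L, (hL.comp hars').congr fun r => ?_, hk⟩
    simp [hf]

theorem stmt1 :
    (∀ r₀ a b : ℝ, ∃ F : ℝ → ℝ, IsHarmonicMapSol F ∧ F r₀ = a ∧ deriv F r₀ = b) ∧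
    (∀ F : ℝ → ℝ, IsHarmonicMapSol F →
      (∃ L : ℝ, Tendsto F atTop (nhds L) ∧ ∃ k : ℤ, L = (k : ℝ) * Real.pi / 2) ∧
      (∃ L : ℝ, Tendsto F atBot (nhds L) ∧ ∃ k : ℤ, L = (k : ℝ) * Real.pi / 2)) := by
  exact ⟨hm_existence, hm_limits⟩
end

section
/- Suppose F : ℝ → ℝ is a C² solution of the harmonic map ODE and there exists k ∈ ℤ with lim_{r→+∞} F(r) = kπ. Then there exist α ∈ ℝ and C > 0 such that |F(r) - kπ - α r^{-2}| ≤ C r^{-4} for all r ≥ 1. The analogous expansion holds as r → -∞ if lim_{r→-∞} F(r) = kπ. -/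
open Real Filter MeasureTheory

/-- If `|f'| ≤ C / r^(n+1)` on `[R,∞)`, then `f` is within `C / r^n` of a constant. -/
lemma aux_limit (f f' : ℝ → ℝ) (R C : ℝ) (n : ℕ) (hn : 1 ≤ n) (hR : 0 < R) (hC : 0 ≤ C)
    (hf : ∀ r, R ≤ r → HasDerivAt f (f' r) r)
    (hb : ∀ r, R ≤ r → |f' r| ≤ C / r ^ (n + 1)) :
    ∃ L : ℝ, ∀ r, R ≤ r → |f r - L| ≤ C / r ^ n := by
  have hp : ∀ r, R ≤ r → HasDerivAt (fun r : ℝ => C / r ^ n) (-(n * C / r ^ (n + 1))) r := by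
    intro r hr
    have hr0 : r ≠ 0 := by linarith
    have h := (hasDerivAt_const r C).div (hasDerivAt_pow n r) (pow_ne_zero n hr0)
    refine h.congr_deriv ?_
    obtain ⟨m, rfl⟩ : ∃ m, n = m + 1 := ⟨n - 1, by omega⟩
    simp only [Nat.add_sub_cancel]
    field_simp
    ring
  have hnn : (1 : ℝ) ≤ n := by exact_mod_cast hn
  have hb2 : ∀ r, R ≤ r → |f' r| ≤ n * C / r ^ (n + 1) := by
    intro r hr
    have hr0 : 0 < r := by linarith
    refine (hb r hr).trans ?_
    gcongr
    nlinarith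
  have hmono : MonotoneOn (fun r => f r - C / r ^ n) (Set.Ici R) := by
    apply monotoneOn_of_hasDerivWithinAt_nonneg (convex_Ici R)
      (f' := fun r => f' r - -(n * C / r ^ (n + 1)))
    · intro r hr
      exact ((hf r hr).sub (hp r hr)).continuousAt.continuousWithinAt
    · intro r hr
      rw [interior_Ici] at hr
      exact ((hf r (le_of_lt hr)).sub (hp r (le_of_lt hr))).hasDerivWithinAt
    · intro r hr
      rw [interior_Ici] at hr
      have := abs_le.1 (hb2 r (le_of_lt hr))
      linarith [this.1]
  have hanti : AntitoneOn (fun r => f r + C / r ^ n) (Set.Ici R) := by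
    apply antitoneOn_of_hasDerivWithinAt_nonpos (convex_Ici R)
      (f' := fun r => f' r + -(n * C / r ^ (n + 1)))
    · intro r hr
      exact ((hf r hr).add (hp r hr)).continuousAt.continuousWithinAt
    · intro r hr
      rw [interior_Ici] at hr
      exact ((hf r (le_of_lt hr)).add (hp r (le_of_lt hr))).hasDerivWithinAt
    · intro r hr
      rw [interior_Ici] at hr
      have := abs_le.1 (hb2 r (le_of_lt hr))
      linarith [this.2]
  have hle : ∀ r s, R ≤ r → R ≤ s → f r - C / r ^ n ≤ f s + C / s ^ n := by
    intro r s hr hs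
    have h1 : f r - C / r ^ n ≤ f (max r s) - C / (max r s) ^ n :=
      hmono hr (le_max_of_le_left hr) (le_max_left r s)
    have h2 : f (max r s) + C / (max r s) ^ n ≤ f s + C / s ^ n :=
      hanti hs (le_max_of_le_left hr) (le_max_right r s)
    have h3 : 0 ≤ C / (max r s) ^ n := by
      have : 0 < max r s := lt_max_of_lt_left (by linarith)
      positivity
    linarith
  refine ⟨sSup ((fun r => f r - C / r ^ n) '' Set.Ici R), ?_⟩
  intro r hr
  have h1 : f r - C / r ^ n ≤ sSup ((fun r => f r - C / r ^ n) '' Set.Ici R) := by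
    apply le_csSup
    · refine ⟨f R + C / R ^ n, ?_⟩
      rintro _ ⟨s, hs, rfl⟩
      exact hle s R hs le_rfl
    · exact ⟨r, hr, rfl⟩
  have h2 : sSup ((fun r => f r - C / r ^ n) '' Set.Ici R) ≤ f r + C / r ^ n := by
    apply csSup_le (Set.Nonempty.image _ ⟨R, le_rfl⟩)
    rintro _ ⟨s, hs, rfl⟩
    exact hle s r hs hr
  rw [abs_le]
  constructor <;> linarith

/-- Same, with limit zero. -/
lemma aux_zero (f f' : ℝ → ℝ) (R C : ℝ) (n : ℕ) (hn : 1 ≤ n) (hR : 0 < R) (hC : 0 ≤ C)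
    (hf : ∀ r, R ≤ r → HasDerivAt f (f' r) r)
    (hb : ∀ r, R ≤ r → |f' r| ≤ C / r ^ (n + 1))
    (h0 : Tendsto f atTop (nhds 0)) :
    ∀ r, R ≤ r → |f r| ≤ C / r ^ n := by
  obtain ⟨L, hL⟩ := aux_limit f f' R C n hn hR hC hf hb
  have h1 : Tendsto (fun r : ℝ => C / r ^ n) atTop (nhds 0) :=
    tendsto_const_nhds.div_atTop (tendsto_pow_atTop (by omega))
  have h2 : Tendsto (fun r => f r - L) atTop (nhds 0) := by
    apply squeeze_zero_norm' _ h1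
    filter_upwards [eventually_ge_atTop R] with r hr
    exact hL r hr
  have h3 : Tendsto (fun r => f r - L) atTop (nhds (0 - L)) := h0.sub_const L
  have h4 := tendsto_nhds_unique h2 h3
  have h5 : L = 0 := by linarith
  subst h5
  simpa using hL

/-- Maximum principle: decay like `1/r`. -/
lemma aux_max (G G1 G2 : ℝ → ℝ) (hG : ∀ r, HasDerivAt G (G1 r) r)
    (hG1 : ∀ r, HasDerivAt G1 (G2 r) r)
    (hode : ∀ r, (r ^ 2 + 1) * G2 r + 2 * r * G1 r = Real.sin (2 * G r))
    (hlim : Tendsto G atTop (nhds 0)) (R A : ℝ) (hR : 2 ≤ R)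
    (hsmall : ∀ r, R ≤ r → |G r| ≤ 1 / 2) (hA : 0 ≤ A) (hAR : G R ≤ A / R) :
    ∀ r, R ≤ r → G r ≤ A / r := by
  by_contra! hcon
  obtain ⟨x, hx, hxA⟩ := hcon
  set u : ℝ → ℝ := fun r => G r - A / r with hu
  have hux : 0 < u x := by simp only [hu]; linarith
  have hu0 : Tendsto u atTop (nhds 0) := by
    have h1 : Tendsto (fun r : ℝ => A / r) atTop (nhds 0) :=
      tendsto_const_nhds.div_atTop tendsto_id
    simpa using hlim.sub h1
  have hu1 : ∀ r, 0 < r → HasDerivAt u (G1 r + A / r ^ 2) r := by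
    intro r hr
    have h := (hG r).sub ((hasDerivAt_const r A).div (hasDerivAt_id r) hr.ne')
    refine h.congr_deriv ?_
    simp only [id]
    field_simp
    ring
  have hu2 : ∀ r, 0 < r → HasDerivAt (fun r => G1 r + A / r ^ 2) (G2 r - 2 * A / r ^ 3) r := by
    intro r hr
    have h := (hG1 r).add ((hasDerivAt_const r A).div (hasDerivAt_pow 2 r) (pow_ne_zero 2 hr.ne'))
    refine h.congr_deriv ?_
    simp
    field_simp
    ring
  obtain ⟨M, hM1, hM2⟩ : ∃ M, x < M ∧ u M < u x :=
    ((eventually_gt_atTop x).and (hu0.eventually (gt_mem_nhds hux))).exists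
  obtain ⟨c, hc, hmax⟩ := isCompact_Icc.exists_isMaxOn (s := Set.Icc R M) ⟨x, hx, hM1.le⟩
    (f := u) (fun r hr => (hu1 r (by linarith [hr.1])).continuousAt.continuousWithinAt)
  have hcx : u x ≤ u c := hmax ⟨hx, hM1.le⟩
  have hcR : R < c := by
    rcases hc.1.lt_or_eq with h | h
    · exact h
    · subst h
      simp only [hu] at hcx hux
      linarith
  have hcM : c < M := by
    rcases hc.2.lt_or_eq with h | h
    · exact h
    · subst h; linarith
  have hc0 : 0 < c := by linarith
  have hloc : IsLocalMax u c := hmax.isLocalMax (Icc_mem_nhds hcR hcM)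
  have hd0 : G1 c + A / c ^ 2 = 0 := hloc.hasDerivAt_eq_zero (hu1 c hc0)
  have hev : deriv u =ᶠ[nhds c] fun r => G1 r + A / r ^ 2 := by
    filter_upwards [lt_mem_nhds hc0] with r hr
    exact (hu1 r hr).deriv
  have hdd : deriv (deriv u) c = G2 c - 2 * A / c ^ 3 := by
    rw [hev.deriv_eq]
    exact (hu2 c hc0).deriv
  have hGc : A / c < G c := by
    have : 0 < u c := by linarith
    simp only [hu] at this
    linarith
  have hAc : 0 ≤ A / c := by positivity
  have hGc0 : 0 < G c := by linarith
  have hGc1 : G c ≤ 1 / 2 := (abs_le.1 (hsmall c hcR.le)).2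
  have hsin : G c ≤ Real.sin (2 * G c) := by
    have := Real.sin_gt_sub_cube (x := 2 * G c) (by linarith)
    nlinarith [mul_pos hGc0 hGc0, mul_nonneg hGc0.le (mul_nonneg (sub_nonneg.2 hGc1) hGc0.le)]
  have hpos : 0 < G2 c - 2 * A / c ^ 3 := by
    have h1 : (c ^ 2 + 1) * (G2 c - 2 * A / c ^ 3) = Real.sin (2 * G c) - 2 * A / c ^ 3 := by
      rw [← hode c]
      have : G1 c = - (A / c ^ 2) := by linarith
      rw [this]
      field_simp
      ring
    have h2 : 2 * A / c ^ 3 ≤ A / c := by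
      rw [div_le_div_iff₀ (by positivity) hc0]
      have : 2 * c ≤ c ^ 3 := by nlinarith [mul_pos hc0 hc0]
      nlinarith
    have h3 : 0 < (c ^ 2 + 1) * (G2 c - 2 * A / c ^ 3) := by rw [h1]; linarith
    exact pos_of_mul_pos_right h3 (by positivity)
  have hmin : IsLocalMin u c := by
    apply isLocalMin_of_deriv_deriv_pos
    · rw [hdd]; exact hpos
    · rw [(hu1 c hc0).deriv]; exact hd0
    · exact (hu1 c hc0).continuousAt
  have hconst : u =ᶠ[nhds c] fun _ => u c := by
    filter_upwards [hloc, hmin] with r h1 h2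
    exact le_antisymm h1 h2
  have hz : deriv (deriv u) c = 0 := by
    rw [hconst.deriv.deriv_eq]
    simp
  linarith

lemma aux_sin (x : ℝ) (hx : |x| ≤ 1 / 2) : |Real.sin (2 * x) - 2 * x| ≤ 2 * |x| ^ 3 := by
  have key : ∀ y : ℝ, 0 < y → y ≤ 1 / 2 → |Real.sin (2 * y) - 2 * y| ≤ 2 * y ^ 3 := by
    intro y h0 h1
    have h2 := Real.sin_gt_sub_cube (x := 2 * y) (by linarith)
    have h3 := Real.sin_lt (x := 2 * y) (by linarith)
    rw [abs_le]
    have : 0 < y ^ 3 := by positivity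
    constructor <;> nlinarith
  rcases lt_trichotomy x 0 with h | h | h
  · rw [abs_of_neg h] at hx ⊢
    have := key (-x) (by linarith) hx
    rw [mul_neg, Real.sin_neg, abs_sub_comm] at this
    refine le_trans (le_of_eq ?_) this
    congr 1
    ring
  · subst h; simp
  · rw [abs_of_pos h] at hx ⊢
    exact key x h hx

/-- The expansion for solutions tending to zero. -/
lemma aux_main (G G1 G2 : ℝ → ℝ) (hG : ∀ r, HasDerivAt G (G1 r) r)
    (hG1 : ∀ r, HasDerivAt G1 (G2 r) r)
    (hode : ∀ r, (r ^ 2 + 1) * G2 r + 2 * r * G1 r = Real.sin (2 * G r))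
    (hlim : Tendsto G atTop (nhds 0)) :
    ∃ α : ℝ, ∃ C : ℝ, 0 < C ∧ ∀ r : ℝ, 1 ≤ r → |G r - α / r ^ 2| ≤ C / r ^ 4 := by
  obtain ⟨R, hR, hsmall⟩ : ∃ R, 2 ≤ R ∧ ∀ r, R ≤ r → |G r| ≤ 1 / 2 := by
    have h : ∀ᶠ r in atTop, |G r| < 1 / 2 := by
      have := hlim.abs
      rw [abs_zero] at this
      exact this.eventually (gt_mem_nhds (by norm_num))
    obtain ⟨R, hR⟩ := eventually_atTop.1 h
    exact ⟨max R 2, le_max_right _ _, fun r hr => (hR r (le_trans (le_max_left _ _) hr)).le⟩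
  have hR0 : 0 < R := by linarith
  -- first decay
  obtain ⟨A, hA, hdec⟩ : ∃ A, 0 ≤ A ∧ ∀ r, R ≤ r → |G r| ≤ A / r := by
    refine ⟨|G R| * R, by positivity, ?_⟩
    have e : |G R| * R / R = |G R| := by field_simp
    have h1 := aux_max G G1 G2 hG hG1 hode hlim R (|G R| * R) hR hsmall (by positivity)
      (by rw [e]; exact le_abs_self _)
    have h2 := aux_max (fun r => -G r) (fun r => -G1 r) (fun r => -G2 r)
      (fun r => (hG r).neg) (fun r => (hG1 r).neg)
      (fun r => by rw [mul_neg 2 (G r), Real.sin_neg, ← hode r]; ring)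
      (by simpa using hlim.neg) R (|G R| * R) hR (fun r hr => by simpa using hsmall r hr)
      (by positivity) (by rw [e]; exact neg_le_abs _)
    intro r hr
    rw [abs_le]
    constructor
    · linarith [h2 r hr]
    · exact h1 r hr
  -- the Wronskian with the explicit solution `r`
  set W : ℝ → ℝ := fun r => (r ^ 2 + 1) * (r * G1 r - G r) with hW
  have hWd : ∀ r, HasDerivAt W (r * (Real.sin (2 * G r) - 2 * G r)) r := by
    intro r
    have h := ((hasDerivAt_pow 2 r).add_const 1).mul
      (((hasDerivAt_id r).mul (hG1 r)).sub (hG r))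
    refine h.congr_deriv ?_
    rw [← hode r]
    simp
    ring
  have hWb : ∀ (B : ℝ) (m : ℕ), 0 ≤ B → (∀ r, R ≤ r → |G r| ≤ B / r ^ m) → ∀ r, R ≤ r →
      |r * (Real.sin (2 * G r) - 2 * G r)| ≤ r * (2 * (B / r ^ m) ^ 3) := by
    intro B m hB h r hr
    have hr0 : 0 < r := by linarith
    rw [abs_mul, abs_of_pos hr0]
    have := aux_sin (G r) (hsmall r hr)
    have h3 := h r hr
    gcongr
    refine this.trans ?_
    gcongr
  have hQ : ∀ r, R ≤ r → HasDerivAt (fun r => G r / r) (W r / (r ^ 2 * (r ^ 2 + 1))) r := by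
    intro r hr
    have hr0 : r ≠ 0 := by linarith
    refine ((hG r).div (hasDerivAt_id r) hr0).congr_deriv ?_
    simp only [hW, id]
    field_simp
  have hQ0 : Tendsto (fun r => G r / r) atTop (nhds 0) := hlim.div_atTop tendsto_id
  -- second decay
  obtain ⟨B, hB, hdec2⟩ : ∃ B, 0 ≤ B ∧ ∀ r, R ≤ r → |G r| ≤ B / r ^ 2 := by
    obtain ⟨L, hL⟩ := aux_limit W _ R (2 * A ^ 3) 1 le_rfl hR0 (by positivity)
      (fun r _ => hWd r) (by
        intro r hr
        have hr0 : 0 < r := by linarith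
        refine (hWb A 1 hA (by simpa using hdec) r hr).trans (le_of_eq ?_)
        field_simp
        try ring)
    have hWB : ∀ r, R ≤ r → |W r| ≤ |L| + 2 * A ^ 3 := by
      intro r hr
      have h1 := hL r hr
      have h2 : 2 * A ^ 3 / r ^ 1 ≤ 2 * A ^ 3 := by
        apply div_le_self (by positivity)
        rw [pow_one]; linarith
      have h3 : |W r| ≤ |W r - L| + |L| := by
        simpa using abs_add_le (W r - L) L
      linarith
    have hz := aux_zero (fun r => G r / r) _ R (|L| + 2 * A ^ 3) 3 (by norm_num) hR0
      (by positivity) hQ (by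
        intro r hr
        have hr0 : 0 < r := by linarith
        rw [abs_div, abs_of_pos (show 0 < r ^ 2 * (r ^ 2 + 1) by positivity)]
        have := hWB r hr
        gcongr
        rw [show r ^ (3 + 1) = r ^ 2 * r ^ 2 by ring]
        gcongr
        linarith) hQ0
    refine ⟨|L| + 2 * A ^ 3, by positivity, ?_⟩
    intro r hr
    have hr0 : 0 < r := by linarith
    have := hz r hr
    rw [abs_div, abs_of_pos hr0, div_le_iff₀ hr0] at this
    refine this.trans (le_of_eq ?_)
    field_simp
  obtain ⟨L, hL⟩ := aux_limit W _ R (2 * B ^ 3) 2 (by norm_num) hR0 (by positivity)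
    (fun r _ => hWd r) (by
      intro r hr
      have hr0 : 0 < r := by linarith
      refine (hWb B 2 hB hdec2 r hr).trans ?_
      have : r * (2 * (B / r ^ 2) ^ 3) = 2 * B ^ 3 / r ^ 5 := by field_simp
      rw [this]
      gcongr
      · linarith
      · norm_num)
  have hz := aux_zero (fun r => G r / r + L / 3 / r ^ 3)
    (fun r => W r / (r ^ 2 * (r ^ 2 + 1)) - L / r ^ 4) R (2 * B ^ 3 + |L|) 5 (by norm_num) hR0
    (by positivity) (by
      intro r hr
      have hr0 : r ≠ 0 := by linarith
      refine ((hQ r hr).add ((hasDerivAt_const r (L / 3)).div (hasDerivAt_pow 3 r)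
        (pow_ne_zero 3 hr0))).congr_deriv ?_
      simp
      field_simp
      ring) (by
      intro r hr
      have hr0 : 0 < r := by linarith
      have e : W r / (r ^ 2 * (r ^ 2 + 1)) - L / r ^ 4
          = (W r - L) / (r ^ 2 * (r ^ 2 + 1)) - L / (r ^ 4 * (r ^ 2 + 1)) := by
        field_simp
        ring
      rw [e]
      refine (abs_sub _ _).trans ?_
      rw [abs_div, abs_div, abs_of_pos (show 0 < r ^ 2 * (r ^ 2 + 1) by positivity),
        abs_of_pos (show 0 < r ^ 4 * (r ^ 2 + 1) by positivity), add_div]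
      apply add_le_add
      · have h1 := hL r hr
        calc |W r - L| / (r ^ 2 * (r ^ 2 + 1))
            ≤ (2 * B ^ 3 / r ^ 2) / (r ^ 2 * r ^ 2) := by
              gcongr
              linarith
          _ = 2 * B ^ 3 / r ^ (5 + 1) := by field_simp
      · gcongr
        rw [show r ^ (5 + 1) = r ^ 4 * r ^ 2 by ring]
        gcongr
        linarith) (by
      have : Tendsto (fun r : ℝ => L / 3 / r ^ 3) atTop (nhds 0) :=
        tendsto_const_nhds.div_atTop (tendsto_pow_atTop (by norm_num))
      simpa using hQ0.add this)
  -- compact part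
  obtain ⟨D, hD⟩ := (isCompact_Icc (a := (1 : ℝ)) (b := R)).exists_bound_of_continuousOn
    (f := fun r => (G r - (-(L / 3)) / r ^ 2) * r ^ 4) (by
      intro r hr
      have hr0 : r ≠ 0 := by linarith [hr.1]
      apply ContinuousAt.continuousWithinAt
      have := (hG r).continuousAt
      fun_prop (disch := positivity))
  refine ⟨-(L / 3), max D (2 * B ^ 3 + |L|) + 1, ?_, ?_⟩
  · have : 0 ≤ 2 * B ^ 3 + |L| := by positivity
    have := le_max_right D (2 * B ^ 3 + |L|)
    linarith
  · intro r hr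
    have hr0 : 0 < r := by linarith
    rw [le_div_iff₀ (by positivity)]
    rcases le_total r R with h | h
    · have := hD r ⟨hr, h⟩
      rw [Real.norm_eq_abs, abs_mul, abs_of_pos (show 0 < r ^ 4 by positivity)] at this
      have := le_max_left D (2 * B ^ 3 + |L|)
      linarith
    · have h1 := hz r h
      have e : G r / r + L / 3 / r ^ 3 = (G r - (-(L / 3)) / r ^ 2) / r := by
        field_simp
        ring
      rw [e, abs_div, abs_of_pos hr0, div_le_iff₀ hr0] at h1
      have e2 : (2 * B ^ 3 + |L|) / r ^ 5 * r = (2 * B ^ 3 + |L|) / r ^ 4 := by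
        field_simp
      rw [e2, le_div_iff₀ (by positivity)] at h1
      have := le_max_right D (2 * B ^ 3 + |L|)
      linarith

theorem stmt2 (F : ℝ → ℝ) (hF : IsHarmonicMapSol F) :
    (∀ k : ℤ, Tendsto F atTop (nhds ((k : ℝ) * Real.pi)) →
      ∃ α : ℝ, ∃ C : ℝ, 0 < C ∧ ∀ r : ℝ, 1 ≤ r →
        |F r - (k : ℝ) * Real.pi - α / r ^ 2| ≤ C / r ^ 4) ∧
    (∀ k : ℤ, Tendsto F atBot (nhds ((k : ℝ) * Real.pi)) →
      ∃ α : ℝ, ∃ C : ℝ, 0 < C ∧ ∀ r : ℝ, r ≤ -1 →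
        |F r - (k : ℝ) * Real.pi - α / r ^ 2| ≤ C / |r| ^ 4) := by
  obtain ⟨hC2, hode⟩ := hF
  have hd1 : ∀ r, HasDerivAt F (deriv F r) r := fun r =>
    (hC2.differentiable (by norm_num) r).hasDerivAt
  have hd2 : ∀ r, HasDerivAt (deriv F) (deriv (deriv F) r) r := fun r => by
    have h : ContDiff ℝ 1 (deriv F) := by
      have h2 : ContDiff ℝ (1 + 1) F := by
        rw [one_add_one_eq_two]; exact hC2
      exact (contDiff_succ_iff_deriv.1 h2).2.2
    exact (h.differentiable (by norm_num) r).hasDerivAt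
  have hode' : ∀ (k : ℤ) (r : ℝ), (r ^ 2 + 1) * deriv (deriv F) r + 2 * r * deriv F r
      = Real.sin (2 * (F r - k * Real.pi)) := by
    intro k r
    have h := hode r
    have e : 2 * (F r - k * Real.pi) = 2 * F r - k * (2 * Real.pi) := by ring
    rw [e, Real.sin_sub_int_mul_two_pi]
    have : r ^ 2 + 1 ≠ 0 := by positivity
    field_simp at h
    linarith
  constructor
  · intro k hk
    exact aux_main (fun r => F r - k * Real.pi) (deriv F) (deriv (deriv F))
      (fun r => (hd1 r).sub_const _) hd2 (hode' k) (by simpa using hk.sub_const (k * Real.pi))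
  · intro k hk
    obtain ⟨α, C, hC, h⟩ := aux_main (fun r => F (-r) - k * Real.pi) (fun r => -deriv F (-r))
      (fun r => deriv (deriv F) (-r))
      (fun r => by
        have := ((hd1 (-r)).comp r (hasDerivAt_neg r)).sub_const (k * Real.pi)
        exact this.congr_deriv (by ring))
      (fun r => by
        have := ((hd2 (-r)).comp r (hasDerivAt_neg r)).neg
        exact this.congr_deriv (by ring))
      (fun r => by
        rw [← hode' k (-r)]; ring)
      (by simpa using (hk.comp tendsto_neg_atTop_atBot).sub_const (k * Real.pi))
    refine ⟨α, C, hC, fun r hr => ?_⟩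
    have := h (-r) (by linarith)
    rw [abs_of_neg (by linarith : r < 0)]
    simpa using this
end

section
/- Let k ≥ 0 be an integer and let α ∈ ℝ. Then there exists a C² solution F_α : ℝ → ℝ of the harmonic map ODE such that for some C > 0 one has |F_α(r) - kπ - α r^{-2}| ≤ C r^{-4} for all r ≥ 1; moreover F_α is unique: any two solutions of the harmonic map ODE admitting such an expansion (each with its own constant C) coincide on all of ℝ. -/
open Real Filter MeasureTheory

/-- The pair `(F, p)` with `p = (r²+1) F'` solves the first order system at `t`. -/
def SysAt (F p : ℝ → ℝ) (t : ℝ) : Prop :=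
  HasDerivAt F (p t / (t ^ 2 + 1)) t ∧ HasDerivAt p (Real.sin (2 * F t)) t

theorem sin_two_lip (a b : ℝ) : |Real.sin (2 * a) - Real.sin (2 * b)| ≤ 2 * |a - b| := by
  have h := Real.lipschitzWith_sin.dist_le_mul (2 * a) (2 * b)
  simp only [Real.dist_eq, NNReal.coe_one, one_mul] at h
  calc _ ≤ _ := h
    _ = |2 * (a - b)| := by ring_nf
    _ = _ := by rw [abs_mul]; norm_num

theorem sys_unique {F p G q : ℝ → ℝ} {a b t₀ : ℝ} (ht : t₀ ∈ Set.Ioo a b)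
    (h1 : ∀ t ∈ Set.Ioo a b, SysAt F p t) (h2 : ∀ t ∈ Set.Ioo a b, SysAt G q t)
    (hF : F t₀ = G t₀) (hp : p t₀ = q t₀) :
    ∀ t ∈ Set.Ioo a b, F t = G t ∧ p t = q t := by
  have key := ODE_solution_unique_of_mem_Ioo (E := ℝ × ℝ) (K := 2)
    (v := fun t y => (y.2 / (t ^ 2 + 1), Real.sin (2 * y.1))) (s := fun _ => Set.univ)
    (f := fun t => (F t, p t)) (g := fun t => (G t, q t)) (a := a) (b := b) (t₀ := t₀)
    (by
      intro t _
      apply LipschitzWith.lipschitzOnWith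
      apply LipschitzWith.of_dist_le_mul
      intro x y
      rw [Prod.dist_eq, Prod.dist_eq]
      simp only [Real.dist_eq]
      have hm1 := le_max_left |x.1 - y.1| |x.2 - y.2|
      have hm2 := le_max_right |x.1 - y.1| |x.2 - y.2|
      have h0 := abs_nonneg (x.2 - y.2)
      apply max_le
      · rw [← sub_div, abs_div, abs_of_pos (by positivity : (0:ℝ) < t ^ 2 + 1)]
        calc |x.2 - y.2| / (t ^ 2 + 1) ≤ |x.2 - y.2| :=
              div_le_self h0 (by nlinarith [sq_nonneg t])
          _ ≤ _ := by push_cast; linarith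
      · calc _ ≤ _ := sin_two_lip x.1 y.1
          _ ≤ _ := by push_cast; linarith)
    ht
    (fun t h => ⟨(h1 t h).1.prodMk (h1 t h).2, trivial⟩)
    (fun t h => ⟨(h2 t h).1.prodMk (h2 t h).2, trivial⟩)
    (by simp [hF, hp])
  intro t h
  have := key h
  simpa using this

theorem sys_local (r₀ F₀ p₀ T : ℝ) (hT : 0 < T) :
    ∃ F p : ℝ → ℝ, F r₀ = F₀ ∧ p r₀ = p₀ ∧
      ∀ t ∈ Set.Ioo (r₀ - T) (r₀ + T), SysAt F p t := by
  set l : ℝ := 1 / (2 * T) with hl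
  have hl0 : 0 < l := by positivity
  set P₀ : ℝ := p₀ / l with hP
  set a : ℝ := |P₀| + 2 * T ^ 2 with ha
  have ha0 : 0 < a := by positivity
  have haT : 2 * T ≤ a / T := by
    rw [le_div_iff₀ hT]; nlinarith [abs_nonneg P₀]
  have hpl : IsPicardLindelof (E := ℝ × ℝ)
      (fun t y => (l * y.2 / (t ^ 2 + 1), Real.sin (2 * y.1) / l))
      (tmin := r₀ - T) (tmax := r₀ + T) ⟨r₀, by constructor <;> linarith⟩ (F₀, P₀)
      ⟨a, ha0.le⟩ 0 ⟨a / T, by positivity⟩ ⟨l + 2 / l, by positivity⟩ := by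
    constructor
    · intro t _
      apply LipschitzWith.lipschitzOnWith
      apply LipschitzWith.of_dist_le_mul
      intro x y
      rw [Prod.dist_eq, Prod.dist_eq]
      simp only [Real.dist_eq]
      have hm1 := le_max_left |x.1 - y.1| |x.2 - y.2|
      have hm2 := le_max_right |x.1 - y.1| |x.2 - y.2|
      set m := max |x.1 - y.1| |x.2 - y.2|
      have h0 := abs_nonneg (x.2 - y.2)
      have h0' : 0 ≤ m := h0.trans hm2
      have h2l : 0 ≤ 2 / l := by positivity
      apply max_le
      · rw [← sub_div, ← mul_sub, abs_div, abs_mul, abs_of_pos hl0,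
          abs_of_pos (by positivity : (0:ℝ) < t ^ 2 + 1)]
        calc l * |x.2 - y.2| / (t ^ 2 + 1) ≤ l * |x.2 - y.2| :=
              div_le_self (by positivity) (by nlinarith [sq_nonneg t])
          _ ≤ l * m := by gcongr
          _ ≤ (l + 2 / l) * m := by nlinarith [mul_nonneg h2l h0']
      · rw [← sub_div, abs_div, abs_of_pos hl0]
        calc _ ≤ 2 * |x.1 - y.1| / l := by gcongr; exact sin_two_lip x.1 y.1
          _ ≤ 2 * m / l := by gcongr
          _ = 2 / l * m := by ring
          _ ≤ (l + 2 / l) * m := by nlinarith [mul_nonneg hl0.le h0']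
    · intro x _
      apply Continuous.continuousOn
      have : ∀ t : ℝ, t ^ 2 + 1 ≠ 0 := fun t => by positivity
      fun_prop (disch := assumption)
    · intro t _ x hx
      rw [Metric.mem_closedBall, Prod.dist_eq] at hx
      have hx2 : |x.2 - P₀| ≤ a := (le_max_right _ _).trans hx
      rw [Prod.norm_def]
      simp only [Real.norm_eq_abs]
      apply max_le
      · rw [abs_div, abs_mul, abs_of_pos hl0, abs_of_pos (by positivity : (0:ℝ) < t ^ 2 + 1)]
        have h3 : |x.2| ≤ 2 * a := by
          have := abs_sub_abs_le_abs_sub x.2 P₀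
          nlinarith [sq_nonneg T]
        calc l * |x.2| / (t ^ 2 + 1) ≤ l * |x.2| :=
              div_le_self (by positivity) (by nlinarith [sq_nonneg t])
          _ ≤ l * (2 * a) := by gcongr
          _ = a / T := by rw [hl]; field_simp
      · rw [abs_div, abs_of_pos hl0]
        calc _ ≤ 1 / l := by gcongr; exact Real.abs_sin_le_one _
          _ = 2 * T := by rw [hl]; field_simp
          _ ≤ _ := haT
    · have : max (r₀ + T - r₀) (r₀ - (r₀ - T)) = T := by
        rw [add_sub_cancel_left, sub_sub_cancel, max_self]
      change a / T * max (r₀ + T - r₀) (r₀ - (r₀ - T)) ≤ a - 0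
      rw [this, div_mul_cancel₀ _ hT.ne', sub_zero]
  obtain ⟨y, hy0, hy⟩ := hpl.exists_eq_forall_mem_Icc_hasDerivWithinAt₀
  refine ⟨fun t => (y t).1, fun t => l * (y t).2, ?_, ?_, ?_⟩
  · change y r₀ = _ at hy0; dsimp only; rw [hy0]
  · change y r₀ = _ at hy0; dsimp only; rw [hy0, hP]; field_simp
  · intro t ht
    have h := (hy t ⟨ht.1.le, ht.2.le⟩).hasDerivAt (Icc_mem_nhds ht.1 ht.2)
    have h1 : HasDerivAt (fun t => (y t).1) _ t := hasFDerivAt_fst.comp_hasDerivAt t h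
    have h2 : HasDerivAt (fun t => (y t).2) _ t := hasFDerivAt_snd.comp_hasDerivAt t h
    refine ⟨by simpa using h1, ?_⟩
    have h3 := h2.const_mul l
    refine h3.congr_deriv ?_
    change l * (Real.sin (2 * (y t).1) / l) = Real.sin (2 * (y t).1)
    field_simp

theorem sys_global (r₀ F₀ p₀ : ℝ) :
    ∃ F p : ℝ → ℝ, F r₀ = F₀ ∧ p r₀ = p₀ ∧ ∀ t, SysAt F p t := by
  choose f g hf hg hs using fun n : ℕ => sys_local r₀ F₀ p₀ (n + 1) (by positivity)
  have agree : ∀ m n : ℕ, m ≤ n → ∀ t ∈ Set.Ioo (r₀ - (m + 1)) (r₀ + (m + 1)),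
      f m t = f n t ∧ g m t = g n t := by
    intro m n hmn
    have hc : (m : ℝ) ≤ n := by exact_mod_cast hmn
    have hm0 : (0 : ℝ) ≤ m := by positivity
    apply sys_unique (t₀ := r₀) (by constructor <;> linarith) (hs m)
    · intro t ht
      exact hs n t ⟨by linarith [ht.1], by linarith [ht.2]⟩
    · rw [hf, hf]
    · rw [hg, hg]
  have agree' : ∀ m n : ℕ, ∀ t, |t - r₀| < m + 1 → |t - r₀| < n + 1 →
      f m t = f n t ∧ g m t = g n t := by
    intro m n t h1 h2
    rw [abs_lt] at h1 h2
    rcases le_total m n with h | h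
    · exact agree m n h t ⟨by linarith, by linarith⟩
    · have := agree n m h t ⟨by linarith, by linarith⟩
      exact ⟨this.1.symm, this.2.symm⟩
  have hN : ∀ t : ℝ, |t - r₀| < (⌈|t - r₀|⌉₊ : ℝ) + 1 := fun t => by
    linarith [Nat.le_ceil |t - r₀|]
  refine ⟨fun t => f ⌈|t - r₀|⌉₊ t, fun t => g ⌈|t - r₀|⌉₊ t, hf _, hg _, ?_⟩
  intro t
  set n := ⌈|t - r₀|⌉₊ with hn
  have ht := hN t
  have hopen : ∀ᶠ s in nhds t, |s - r₀| < (n : ℝ) + 1 := by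
    apply IsOpen.mem_nhds (isOpen_lt (by fun_prop) continuous_const)
    exact ht
  have hsys : SysAt (f n) (g n) t := by
    rw [abs_lt] at ht
    exact hs n t ⟨by linarith, by linarith⟩
  constructor
  · refine hsys.1.congr_of_eventuallyEq ?_
    filter_upwards [hopen] with s hs'
    exact (agree' _ _ s (hN s) hs').1
  · refine hsys.2.congr_of_eventuallyEq ?_
    filter_upwards [hopen] with s hs'
    exact (agree' _ _ s (hN s) hs').2

theorem isSol_of_sys {F p : ℝ → ℝ} (h : ∀ t, SysAt F p t) : IsHarmonicMapSol F := by
  have hne : ∀ t : ℝ, t ^ 2 + 1 ≠ 0 := fun t => by positivity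
  have hF : Differentiable ℝ F := fun t => (h t).1.differentiableAt
  have hp : Differentiable ℝ p := fun t => (h t).2.differentiableAt
  have hdF : deriv F = fun t => p t / (t ^ 2 + 1) := funext fun t => (h t).1.deriv
  have hdp : deriv p = fun t => Real.sin (2 * F t) := funext fun t => (h t).2.deriv
  have hpc : ContDiff ℝ 1 p := by
    rw [contDiff_one_iff_deriv]
    refine ⟨hp, ?_⟩
    rw [hdp]
    have := hF.continuous
    fun_prop
  constructor
  · rw [show (2 : WithTop ℕ∞) = 1 + 1 by norm_num, contDiff_succ_iff_deriv]
    refine ⟨hF, by simp, ?_⟩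
    rw [hdF]
    exact hpc.div (by fun_prop) hne
  · intro r
    have h2 : HasDerivAt (deriv F) ((Real.sin (2 * F r) * (r ^ 2 + 1) - p r * (2 * r))
        / (r ^ 2 + 1) ^ 2) r := by
      rw [hdF]
      have h3 : HasDerivAt (fun t : ℝ => t ^ 2 + 1) (2 * r) r := by
        simpa using (hasDerivAt_pow 2 r).add_const 1
      exact (h r).2.div h3 (hne r)
    rw [h2.deriv, hdF]
    have := hne r
    field_simp
    ring

theorem sys_of_isSol {F : ℝ → ℝ} (h : IsHarmonicMapSol F) :
    ∀ t, SysAt F (fun r => (r ^ 2 + 1) * deriv F r) t := by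
  intro t
  have hne : t ^ 2 + 1 ≠ 0 := by positivity
  obtain ⟨hc, he⟩ := h
  rw [show (2 : WithTop ℕ∞) = 1 + 1 by norm_num, contDiff_succ_iff_deriv] at hc
  have hd : Differentiable ℝ (deriv F) := hc.2.2.differentiable (by norm_num)
  constructor
  · refine (hc.1 t).hasDerivAt.congr_deriv ?_
    change deriv F t = (t ^ 2 + 1) * deriv F t / (t ^ 2 + 1)
    field_simp
  · have h3 : HasDerivAt (fun t : ℝ => t ^ 2 + 1) (2 * t) t := by
      simpa using (hasDerivAt_pow 2 t).add_const 1
    refine (h3.mul (hd t).hasDerivAt).congr_deriv ?_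
    have := he t
    field_simp at this
    linarith

theorem no_pos {F p G q : ℝ → ℝ} {k α C₁ C₂ R : ℝ} (hR : 1 ≤ R)
    (h1 : ∀ t, SysAt F p t) (h2 : ∀ t, SysAt G q t)
    (b1 : ∀ r : ℝ, 1 ≤ r → |F r - k - α / r ^ 2| ≤ C₁ / r ^ 4)
    (b2 : ∀ r : ℝ, 1 ≤ r → |G r - k - α / r ^ 2| ≤ C₂ / r ^ 4)
    (hpos : ∀ r, R ≤ r → 0 < F r - G r) : False := by
  set W : ℝ → ℝ := fun r => (p r - q r) / r ^ 2 + 2 * (1 / r + 1 / r ^ 3) * (F r - G r) with hW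
  set E : ℝ → ℝ := fun r => r ^ 2 * (F r - G r) with hE
  have hD : ∀ r, HasDerivAt (fun r => F r - G r) ((p r - q r) / (r ^ 2 + 1)) r := by
    intro r
    rw [sub_div]
    exact (h1 r).1.sub (h2 r).1
  have hp : ∀ r, HasDerivAt (fun r => p r - q r) (Real.sin (2 * F r) - Real.sin (2 * G r)) r :=
    fun r => (h1 r).2.sub (h2 r).2
  have hWd : ∀ r, 0 < r → HasDerivAt W
      ((Real.sin (2 * F r) - Real.sin (2 * G r) - 2 * (F r - G r)) / r ^ 2
        - 6 * (F r - G r) / r ^ 4) r := by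
    intro r hr
    have e1 := (hp r).div (hasDerivAt_pow 2 r) (by positivity)
    have e2 := (((hasDerivAt_inv hr.ne').add ((hasDerivAt_pow 3 r).inv (by positivity))).const_mul
      2).mul (hD r)
    have e3 := e1.add e2
    have hr2 : r ^ 2 + 1 ≠ 0 := by positivity
    refine (e3.congr_deriv ?_).congr_of_eventuallyEq (Filter.Eventually.of_forall ?_)
    · simp
      field_simp
      ring
    · intro s
      simp [hW]
  have hEd : ∀ r, 0 < r → HasDerivAt E (r ^ 4 / (r ^ 2 + 1) * W r) r := by
    intro r hr
    have e1 := (hasDerivAt_pow 2 r).mul (hD r)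
    refine e1.congr_deriv ?_
    have hr2 : r ^ 2 + 1 ≠ 0 := by positivity
    simp [hW]
    field_simp
    ring
  have hWanti : AntitoneOn W (Set.Ici R) := by
    apply antitoneOn_of_deriv_nonpos (convex_Ici R)
    · intro r hr
      have : R ≤ r := hr
      exact (hWd r (by linarith)).continuousAt.continuousWithinAt
    · intro r hr
      rw [interior_Ici] at hr
      have : R < r := hr
      exact (hWd r (by linarith)).differentiableAt.differentiableWithinAt
    · intro r hr
      rw [interior_Ici] at hr
      have hr' : R < r := hr
      have hr0 : 0 < r := by linarith
      rw [(hWd r hr0).deriv]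
      have hd := hpos r hr'.le
      have hs := sin_two_lip (F r) (G r)
      rw [abs_of_pos hd] at hs
      have hs' := (le_abs_self _).trans hs
      have t1 : (Real.sin (2 * F r) - Real.sin (2 * G r) - 2 * (F r - G r)) / r ^ 2 ≤ 0 :=
        div_nonpos_of_nonpos_of_nonneg (by linarith) (by positivity)
      have t2 : 0 ≤ 6 * (F r - G r) / r ^ 4 := by positivity
      linarith
  have hEpos : ∀ r, R ≤ r → 0 < E r := fun r hr => by
    have := hpos r hr
    have : 0 < r := by linarith
    simp only [hE]; positivity
  have hWpos : ∀ s, R ≤ s → 0 ≤ W s := by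
    intro s hs
    by_contra hneg
    push Not at hneg
    have hanti : AntitoneOn (fun r => E r - W s / 2 * r) (Set.Ici s) := by
      have hder : ∀ r, s ≤ r → HasDerivAt (fun r => E r - W s / 2 * r)
          (r ^ 4 / (r ^ 2 + 1) * W r - W s / 2 * 1) r := fun r hr =>
        (hEd r (by linarith)).sub ((hasDerivAt_id r).const_mul _)
      apply antitoneOn_of_deriv_nonpos (convex_Ici s)
      · intro r hr
        exact (hder r hr).continuousAt.continuousWithinAt
      · intro r hr
        rw [interior_Ici] at hr
        exact (hder r (le_of_lt hr)).differentiableAt.differentiableWithinAt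
      · intro r hr
        rw [interior_Ici] at hr
        have hr' : s < r := hr
        rw [(hder r hr'.le).deriv]
        have hw : W r ≤ W s := hWanti (show R ≤ s from hs) (show R ≤ r by linarith) hr'.le
        have hc : 1 / 2 ≤ r ^ 4 / (r ^ 2 + 1) := by
          rw [div_le_div_iff₀ (by norm_num) (by positivity)]
          have : 1 ≤ r ^ 2 := by nlinarith
          nlinarith
        nlinarith
    set t := s + 2 * E s / (-W s) with ht
    have hEs := hEpos s hs
    have hts : s ≤ t := by
      have : 0 ≤ 2 * E s / (-W s) := div_nonneg (by linarith) (by linarith)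
      linarith
    have h := hanti (show s ≤ s from le_rfl) (show s ≤ t from hts) hts
    have hx : W s / 2 * t = W s / 2 * s - E s := by
      rw [ht]
      have : W s ≠ 0 := hneg.ne
      field_simp
      ring
    have := hEpos t (hs.trans hts)
    simp only [] at h
    linarith
  have hEmono : MonotoneOn E (Set.Ici R) := by
    apply monotoneOn_of_deriv_nonneg (convex_Ici R)
    · intro r hr
      have : R ≤ r := hr
      exact (hEd r (by linarith)).continuousAt.continuousWithinAt
    · intro r hr
      rw [interior_Ici] at hr
      have : R < r := hr
      exact (hEd r (by linarith)).differentiableAt.differentiableWithinAt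
    · intro r hr
      rw [interior_Ici] at hr
      have hr' : R < r := hr
      rw [(hEd r (by linarith)).deriv]
      have := hWpos r hr'.le
      positivity
  have hEb : ∀ r, R ≤ r → E R ≤ (C₁ + C₂) / r ^ 2 := by
    intro r hr
    have h := hEmono (show R ≤ R from le_rfl) (show R ≤ r from hr) hr
    have hr0 : 0 < r := by linarith
    have c1 := abs_le.1 (b1 r (hR.trans hr))
    have c2 := abs_le.1 (b2 r (hR.trans hr))
    have : F r - G r ≤ (C₁ + C₂) / r ^ 4 := by
      rw [add_div]; linarith [c1.2, c2.1]
    calc E R ≤ E r := h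
      _ = r ^ 2 * (F r - G r) := rfl
      _ ≤ r ^ 2 * ((C₁ + C₂) / r ^ 4) := by gcongr
      _ = _ := by field_simp
  have hlim : Filter.Tendsto (fun r : ℝ => (C₁ + C₂) / r ^ 2) Filter.atTop (nhds 0) :=
    Filter.Tendsto.const_div_atTop (Filter.tendsto_pow_atTop (by norm_num)) _
  have := ge_of_tendsto hlim (Filter.eventually_atTop.2 ⟨R, hEb⟩)
  linarith [hEpos R le_rfl]

theorem sys_agree {F p G q : ℝ → ℝ} {n : ℕ} {α C₁ C₂ : ℝ}
    (h1 : ∀ t, SysAt F p t) (h2 : ∀ t, SysAt G q t)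
    (b1 : ∀ r : ℝ, 1 ≤ r → |F r - n * Real.pi - α / r ^ 2| ≤ C₁ / r ^ 4)
    (b2 : ∀ r : ℝ, 1 ≤ r → |G r - n * Real.pi - α / r ^ 2| ≤ C₂ / r ^ 4) :
    ∃ r, F r = G r ∧ p r = q r := by
  have hD : ∀ r, HasDerivAt (fun r => F r - G r) ((p r - q r) / (r ^ 2 + 1)) r := by
    intro r
    rw [sub_div]
    exact (h1 r).1.sub (h2 r).1
  have hp : ∀ r, HasDerivAt (fun r => p r - q r) (Real.sin (2 * F r) - Real.sin (2 * G r)) r :=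
    fun r => (h1 r).2.sub (h2 r).2
  have hDc : Continuous (fun r => F r - G r) :=
    continuous_iff_continuousAt.2 fun r => (hD r).continuousAt
  -- closeness to `nπ`
  have hclose : ∀ (H : ℝ → ℝ) (C : ℝ),
      (∀ r : ℝ, 1 ≤ r → |H r - n * Real.pi - α / r ^ 2| ≤ C / r ^ 4) →
      Filter.Tendsto H Filter.atTop (nhds (n * Real.pi)) := by
    intro H C hb
    have l1 : Filter.Tendsto (fun r : ℝ => C / r ^ 4) Filter.atTop (nhds 0) :=
      Filter.Tendsto.const_div_atTop (Filter.tendsto_pow_atTop (by norm_num)) _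
    have l2 : Filter.Tendsto (fun r : ℝ => α / r ^ 2) Filter.atTop (nhds 0) :=
      Filter.Tendsto.const_div_atTop (Filter.tendsto_pow_atTop (by norm_num)) _
    have l3 : Filter.Tendsto (fun r : ℝ => H r - n * Real.pi - α / r ^ 2) Filter.atTop
        (nhds 0) := by
      apply squeeze_zero_norm' _ l1
      filter_upwards [Filter.eventually_ge_atTop 1] with r hr
      exact hb r hr
    have := (l3.add l2).add_const (n * Real.pi)
    simpa using this
  have t1 := hclose F C₁ b1
  have t2 := hclose G C₂ b2
  have ev : ∀ᶠ r in Filter.atTop, |F r - n * Real.pi| < 1 / 2 ∧ |G r - n * Real.pi| < 1 / 2 := by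
    have e1 := Metric.tendsto_nhds.1 t1 (1 / 2) (by norm_num)
    have e2 := Metric.tendsto_nhds.1 t2 (1 / 2) (by norm_num)
    exact e1.and e2
  obtain ⟨R₀, hR₀⟩ := Filter.eventually_atTop.1 ev
  set R := max R₀ 1 with hRdef
  have hR1 : 1 ≤ R := le_max_right _ _
  have hR : ∀ r, R ≤ r → |F r - n * Real.pi| < 1 / 2 ∧ |G r - n * Real.pi| < 1 / 2 :=
    fun r hr => hR₀ r ((le_max_left _ _).trans hr)
  have hmon : ∀ r, R ≤ r → 0 ≤ (F r - G r) * (Real.sin (2 * F r) - Real.sin (2 * G r)) := by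
    intro r hr
    obtain ⟨c1, c2⟩ := hR r hr
    rw [abs_lt] at c1 c2
    have hsin : ∀ x : ℝ, Real.sin (2 * x) = Real.sin (2 * (x - n * Real.pi)) := by
      intro x
      rw [show 2 * (x - n * Real.pi) = 2 * x - n * (2 * Real.pi) by ring,
        Real.sin_sub_nat_mul_two_pi]
    rw [hsin (F r), hsin (G r)]
    have hpi := Real.pi_gt_three
    rcases le_total (F r) (G r) with h | h
    · apply mul_nonneg_of_nonpos_of_nonpos (by linarith)
      have := Real.sin_le_sin_of_le_of_le_pi_div_two (x := 2 * (F r - n * Real.pi))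
        (y := 2 * (G r - n * Real.pi)) (by linarith) (by linarith) (by linarith)
      linarith
    · apply mul_nonneg (by linarith)
      have := Real.sin_le_sin_of_le_of_le_pi_div_two (x := 2 * (G r - n * Real.pi))
        (y := 2 * (F r - n * Real.pi)) (by linarith) (by linarith) (by linarith)
      linarith
  by_cases hz : ∃ r₀, R ≤ r₀ ∧ F r₀ - G r₀ = 0
  · obtain ⟨r₀, hr₀, hz⟩ := hz
    have hm : MonotoneOn (fun r => (F r - G r) * (p r - q r)) (Set.Ici r₀) := by
      apply monotoneOn_of_deriv_nonneg (convex_Ici r₀)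
      · exact fun r _ => ((hD r).mul (hp r)).continuousAt.continuousWithinAt
      · exact fun r _ => ((hD r).mul (hp r)).differentiableAt.differentiableWithinAt
      · intro r hr
        rw [interior_Ici] at hr
        have hr' : r₀ < r := hr
        have hd : deriv (fun r => (F r - G r) * (p r - q r)) r = _ := ((hD r).mul (hp r)).deriv
        rw [hd]
        have a1 := hmon r (hr₀.trans hr'.le)
        have a2 : 0 ≤ (p r - q r) / (r ^ 2 + 1) * (p r - q r) := by
          rw [div_mul_eq_mul_div]
          exact div_nonneg (mul_self_nonneg _) (by positivity)
        linarith
    have hm0 : ∀ r, r₀ ≤ r → 0 ≤ (F r - G r) * (p r - q r) := by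
      intro r hr
      have := hm (show r₀ ≤ r₀ from le_rfl) (show r₀ ≤ r from hr) hr
      simpa [hz] using this
    have hsq : MonotoneOn (fun r => (F r - G r) * (F r - G r)) (Set.Ici r₀) := by
      apply monotoneOn_of_deriv_nonneg (convex_Ici r₀)
      · exact fun r _ => ((hD r).mul (hD r)).continuousAt.continuousWithinAt
      · exact fun r _ => ((hD r).mul (hD r)).differentiableAt.differentiableWithinAt
      · intro r hr
        rw [interior_Ici] at hr
        have hr' : r₀ < r := hr
        have hd : deriv (fun r => (F r - G r) * (F r - G r)) r = _ := ((hD r).mul (hD r)).deriv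
        rw [hd]
        have a2 : 0 ≤ (F r - G r) * (p r - q r) / (r ^ 2 + 1) :=
          div_nonneg (hm0 r hr'.le) (by positivity)
        have : (p r - q r) / (r ^ 2 + 1) * (F r - G r) + (F r - G r) * ((p r - q r) / (r ^ 2 + 1))
          = 2 * ((F r - G r) * (p r - q r) / (r ^ 2 + 1)) := by ring
        rw [this]
        positivity
    have hlim : Filter.Tendsto (fun r => (F r - G r) * (F r - G r)) Filter.atTop (nhds 0) := by
      have := (t1.sub t2).mul (t1.sub t2)
      simpa using this
    have hzero : ∀ r, r₀ ≤ r → F r - G r = 0 := by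
      intro r hr
      have h := ge_of_tendsto (b := (F r - G r) * (F r - G r)) hlim
        (Filter.eventually_atTop.2 ⟨r, fun s hs =>
          hsq (show r₀ ≤ r from hr) (show r₀ ≤ s from hr.trans hs) hs⟩)
      nlinarith
    refine ⟨r₀ + 1, by linarith [hzero (r₀ + 1) (by linarith)], ?_⟩
    have hd0 : HasDerivAt (fun r => F r - G r) 0 (r₀ + 1) := by
      refine (hasDerivAt_const (r₀ + 1) (0 : ℝ)).congr_of_eventuallyEq ?_
      filter_upwards [Ioi_mem_nhds (show r₀ < r₀ + 1 by linarith)] with s hs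
      exact hzero s (le_of_lt hs)
    have := (hD (r₀ + 1)).unique hd0
    have hne : (r₀ + 1) ^ 2 + 1 ≠ 0 := by positivity
    rw [div_eq_zero_iff] at this
    rcases this with h | h
    · linarith
    · exact absurd h hne
  · exfalso
    push Not at hz
    have sign : ∀ r, R ≤ r → 0 < (F R - G R) * (F r - G r) := by
      intro r hr
      by_contra hcon
      push Not at hcon
      have hc : ContinuousOn (fun r => (F R - G R) * (F r - G r)) (Set.Icc R r) :=
        (continuous_const.mul hDc).continuousOn
      have := intermediate_value_Icc' hr hc
      obtain ⟨s, hs, hs0⟩ := this (show (0 : ℝ) ∈ _ from ⟨hcon, mul_self_nonneg _⟩)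
      rcases mul_eq_zero.1 hs0 with h | h
      · exact hz R le_rfl h
      · exact hz s hs.1 h
    rcases lt_or_gt_of_ne (hz R le_rfl) with h | h
    · apply no_pos hR1 h2 h1 b2 b1
      intro r hr
      have := sign r hr
      rcases lt_or_gt_of_ne (hz r hr) with h' | h'
      · linarith
      · nlinarith [mul_neg_of_neg_of_pos h h']
    · apply no_pos hR1 h1 h2 b1 b2
      intro r hr
      exact (pos_iff_pos_of_mul_pos (sign r hr)).1 h

theorem sin_sub_lip {a b B : ℝ} (ha : |a| ≤ B) (hb : |b| ≤ B) :
    |(Real.sin a - a) - (Real.sin b - b)| ≤ B ^ 2 / 2 * |a - b| := by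
  have := Convex.norm_image_sub_le_of_norm_hasDerivWithin_le (f := fun x => Real.sin x - x)
    (f' := fun x => Real.cos x - 1) (s := Set.Icc (-B) B) (C := B ^ 2 / 2) (x := b) (y := a)
    (fun x _ => ((Real.hasDerivAt_sin x).sub (hasDerivAt_id x)).hasDerivWithinAt)
    (by
      intro x hx
      have h1 := Real.one_sub_sq_div_two_le_cos (x := x)
      have h2 := Real.cos_le_one x
      have h3 : x ^ 2 ≤ B ^ 2 := sq_le_sq' hx.1 hx.2
      rw [Real.norm_eq_abs, abs_le]
      constructor <;> nlinarith [sq_nonneg B])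
    (convex_Icc _ _) (abs_le.1 hb) (abs_le.1 ha)
  simpa [Real.norm_eq_abs] using this

/-- truncation to `[-M, M]` -/
noncomputable def trunc (M v : ℝ) : ℝ := max (-M) (min M v)

theorem trunc_abs {M : ℝ} (hM : 0 ≤ M) (v : ℝ) : |trunc M v| ≤ M := by
  unfold trunc
  rw [abs_le]
  exact ⟨le_max_left _ _, max_le (by linarith) (min_le_left _ _)⟩

theorem trunc_eq {M v : ℝ} (h : |v| ≤ M) : trunc M v = v := by
  rw [abs_le] at h
  unfold trunc
  rw [min_eq_right h.2, max_eq_right h.1]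

theorem trunc_lip (M v w : ℝ) : |trunc M v - trunc M w| ≤ |v - w| := by
  unfold trunc
  calc _ ≤ |min M v - min M w| := by
        rw [max_comm (-M), max_comm (-M)]; exact abs_max_sub_max_le_abs _ _ _
    _ ≤ max |M - M| |v - w| := abs_min_sub_min_le_max _ _ _ _
    _ = |v - w| := by simp

/-- the truncated right hand side -/
noncomputable def rhs (M z v : ℝ) : ℝ :=
  Real.sin (2 * trunc M v * z ^ 2) - 2 * trunc M v * z ^ 2 - 6 * trunc M v * z ^ 4

theorem rhs_sub {M z v w : ℝ} (hM : 0 ≤ M) (hz : |z| ≤ 1) :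
    |rhs M z v - rhs M z w| ≤ (4 * M ^ 2 + 6) * z ^ 4 * |trunc M v - trunc M w| := by
  have hz2 : z ^ 2 ≤ 1 := (sq_le_one_iff_abs_le_one z).2 hz
  have hb : ∀ v, |2 * trunc M v * z ^ 2| ≤ 2 * M * z ^ 2 := by
    intro v
    rw [abs_mul, abs_mul, abs_of_nonneg (sq_nonneg z), abs_two]
    gcongr
    exact trunc_abs hM v
  have h := sin_sub_lip (hb v) (hb w)
  set a := trunc M v
  set b := trunc M w
  have e1 : |2 * a * z ^ 2 - 2 * b * z ^ 2| = 2 * z ^ 2 * |a - b| := by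
    rw [show 2 * a * z ^ 2 - 2 * b * z ^ 2 = (2 * z ^ 2) * (a - b) by ring, abs_mul,
      abs_of_nonneg (by positivity)]
  rw [e1] at h
  have e2 : |6 * z ^ 4 * (a - b)| = 6 * z ^ 4 * |a - b| := by
    rw [abs_mul, abs_of_nonneg (by positivity)]
  have e3 : rhs M z v - rhs M z w = (Real.sin (2 * a * z ^ 2) - 2 * a * z ^ 2
      - (Real.sin (2 * b * z ^ 2) - 2 * b * z ^ 2)) - 6 * z ^ 4 * (a - b) := by
    simp only [rhs]; ring
  have h0 := abs_nonneg (a - b)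
  have h4 : M ^ 2 * (z ^ 4 * |a - b|) * z ^ 2 ≤ M ^ 2 * (z ^ 4 * |a - b|) * 1 := by gcongr
  rw [e3]
  have h5 : ∀ x y : ℝ, |x - y| ≤ |x| + |y| := fun x y => norm_sub_le x y
  refine (h5 _ _).trans ?_
  rw [e2]
  nlinarith

theorem rhs_abs {M z v : ℝ} (hM : 0 ≤ M) (hz : |z| ≤ 1) :
    |rhs M z v| ≤ (4 * M ^ 2 + 6) * M * z ^ 4 := by
  have h := rhs_sub (v := v) (w := 0) hM hz
  have h0 : trunc M 0 = 0 := trunc_eq (by simpa using hM)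
  have h1 : rhs M z 0 = 0 := by simp [rhs, h0]
  rw [h0, h1, sub_zero, sub_zero] at h
  calc _ ≤ _ := h
    _ ≤ (4 * M ^ 2 + 6) * z ^ 4 * M := by gcongr; exact trunc_abs hM v
    _ = _ := by ring

noncomputable def PP (M : ℝ) (u : ℝ → ℝ) (x : ℝ) : ℝ := ∫ z in (0:ℝ)..x, rhs M z (u z)

noncomputable def AA (M : ℝ) (u : ℝ → ℝ) (x : ℝ) : ℝ := PP M u x / (x ^ 4 * (1 + x ^ 2))

theorem rhs_cont (M : ℝ) {u : ℝ → ℝ} (hu : Continuous u) :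
    Continuous (fun z => rhs M z (u z)) := by
  unfold rhs trunc
  fun_prop

theorem PP_deriv (M : ℝ) {u : ℝ → ℝ} (hu : Continuous u) (x : ℝ) :
    HasDerivAt (PP M u) (rhs M x (u x)) x :=
  ((rhs_cont M hu).integral_hasStrictDerivAt 0 x).hasDerivAt

theorem abs_le_of_uIoc {x z : ℝ} (hz : z ∈ Set.uIoc 0 x) : |z| ≤ |x| := by
  rcases Set.mem_uIoc.1 hz with h | h
  · rw [abs_of_pos h.1, abs_of_pos (h.1.trans_le h.2)]; exact h.2
  · rw [abs_of_nonpos h.2, abs_of_neg (h.1.trans_le h.2)]; linarith [h.1]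

theorem pow4_le {x z : ℝ} (h : |z| ≤ |x|) : z ^ 4 ≤ x ^ 4 := by
  rw [← Even.pow_abs (by decide : Even 4) z, ← Even.pow_abs (by decide : Even 4) x]
  gcongr

theorem PP_abs {M x : ℝ} (hM : 0 ≤ M) (u : ℝ → ℝ) (hx : |x| ≤ 1) :
    |PP M u x| ≤ (4 * M ^ 2 + 6) * M * x ^ 4 * |x| := by
  have := intervalIntegral.norm_integral_le_of_norm_le_const (a := 0) (b := x)
    (f := fun z => rhs M z (u z)) (C := (4 * M ^ 2 + 6) * M * x ^ 4)
    (by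
      intro z hz
      have h := abs_le_of_uIoc hz
      calc _ ≤ _ := rhs_abs hM (h.trans hx)
        _ ≤ _ := by gcongr ?_ * ?_; exact pow4_le h)
  simpa [PP] using this

theorem PP_sub {M x d : ℝ} (hM : 0 ≤ M) {u w : ℝ → ℝ} (hu : Continuous u) (hw : Continuous w)
    (hx : |x| ≤ 1) (hd : ∀ z, |u z - w z| ≤ d) :
    |PP M u x - PP M w x| ≤ (4 * M ^ 2 + 6) * d * x ^ 4 * |x| := by
  have hd0 : 0 ≤ d := (abs_nonneg _).trans (hd 0)
  have := intervalIntegral.norm_integral_le_of_norm_le_const (a := 0) (b := x)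
    (f := fun z => rhs M z (u z) - rhs M z (w z)) (C := (4 * M ^ 2 + 6) * d * x ^ 4)
    (by
      intro z hz
      have h := abs_le_of_uIoc hz
      calc _ ≤ _ := rhs_sub hM (h.trans hx)
        _ ≤ (4 * M ^ 2 + 6) * x ^ 4 * d := by
            gcongr ?_ * ?_ * ?_
            · exact pow4_le h
            · exact (trunc_lip _ _ _).trans (hd z)
        _ = _ := by ring)
  rw [intervalIntegral.integral_sub ((rhs_cont M hu).intervalIntegrable _ _)
    ((rhs_cont M hw).intervalIntegrable _ _)] at this
  simpa [PP] using this

theorem quot_bound {P c x : ℝ} (hc : 0 ≤ c) (h : |P| ≤ c * x ^ 4 * |x|) :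
    |P / (x ^ 4 * (1 + x ^ 2))| ≤ c * |x| := by
  by_cases hx : x = 0
  · simp [hx]
  · rw [abs_div, abs_of_pos (by positivity : 0 < x ^ 4 * (1 + x ^ 2)),
      div_le_iff₀ (by positivity)]
    calc _ ≤ _ := h
      _ = c * |x| * (x ^ 4 * 1) := by ring
      _ ≤ _ := by gcongr; linarith [sq_nonneg x]

theorem AA_cont {M : ℝ} (hM : 0 ≤ M) {u : ℝ → ℝ} (hu : Continuous u) : Continuous (AA M u) := by
  rw [continuous_iff_continuousAt]
  intro x
  by_cases hx : x = 0
  · subst hx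
    have h0 : AA M u 0 = 0 := by simp [AA]
    rw [ContinuousAt, h0]
    have hl : Filter.Tendsto (fun x : ℝ => (4 * M ^ 2 + 6) * M * |x|) (nhds 0) (nhds 0) := by
      have : Continuous (fun x : ℝ => (4 * M ^ 2 + 6) * M * |x|) := by fun_prop
      simpa using this.tendsto 0
    apply squeeze_zero_norm' _ hl
    have : ∀ᶠ x : ℝ in nhds 0, |x| < 1 := by
      apply IsOpen.mem_nhds (isOpen_lt (by fun_prop) continuous_const)
      simp
    filter_upwards [this] with x hx
    exact quot_bound (by positivity) (PP_abs hM u hx.le)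
  · unfold AA
    apply ContinuousAt.div (PP_deriv M hu x).continuousAt (by fun_prop)
    positivity

theorem int_abs {f : ℝ → ℝ} {c x : ℝ} (hc : 0 ≤ c) (hx : |x| ≤ 1)
    (hf : ∀ y, |y| ≤ 1 → |f y| ≤ c * |y|) : |∫ y in (0:ℝ)..x, f y| ≤ c * x ^ 2 := by
  have := intervalIntegral.norm_integral_le_of_norm_le_const (a := 0) (b := x)
    (f := f) (C := c * |x|)
    (by
      intro z hz
      have h := abs_le_of_uIoc hz
      calc _ ≤ _ := hf z (h.trans hx)
        _ ≤ _ := by gcongr)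
  calc _ ≤ _ := this
    _ = c * |x| ^ 2 := by rw [sub_zero]; ring
    _ = _ := by rw [sq_abs]

theorem fixed_point (α : ℝ) : ∃ δ : ℝ, 0 < δ ∧ ∃ v P : ℝ → ℝ, ∃ C : ℝ,
    ∀ x ∈ Set.Ioo 0 δ, HasDerivAt v (P x / (x ^ 4 * (1 + x ^ 2))) x ∧
      HasDerivAt P (Real.sin (2 * v x * x ^ 2) - 2 * v x * x ^ 2 - 6 * v x * x ^ 4) x ∧
      |v x - α| ≤ C * x ^ 2 := by
  set M : ℝ := |α| + 1 with hMdef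
  have hM1 : 1 ≤ M := by linarith [abs_nonneg α]
  have hM : 0 ≤ M := by linarith
  set L : ℝ := 4 * M ^ 2 + 6 with hL
  have hL6 : 6 ≤ L := by nlinarith
  have hL0 : 0 ≤ L := by linarith
  have hLM : 6 ≤ L * M := by nlinarith
  set δ : ℝ := 1 / (2 * (L * M)) with hδ
  have hδ0 : 0 < δ := by positivity
  have hδe : L * M * δ = 1 / 2 := by rw [hδ]; field_simp
  have hδ1 : δ ≤ 1 := by nlinarith
  have hδ2 : L * M * δ ^ 2 ≤ 1 / 2 := by nlinarith
  have hδ3 : L * δ ^ 2 ≤ 1 / 2 := by nlinarith [mul_nonneg hL0 (sq_nonneg δ)]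
  set pr : ℝ → ℝ := fun x => max 0 (min δ x) with hpr
  have hprc : Continuous pr := by simp only [hpr]; fun_prop
  have hpr0 : ∀ x, 0 ≤ pr x := fun x => le_max_left _ _
  have hprδ : ∀ x, pr x ≤ δ := fun x => max_le hδ0.le (min_le_left _ _)
  have hprabs : ∀ x, |pr x| ≤ 1 := fun x => by
    rw [abs_of_nonneg (hpr0 x)]; exact (hprδ x).trans hδ1
  have hprsq : ∀ x, pr x ^ 2 ≤ δ ^ 2 := fun x => by
    have := hpr0 x
    have := hprδ x
    gcongr
  have hAb : ∀ (u : ℝ → ℝ) (y : ℝ), |y| ≤ 1 → |AA M u y| ≤ L * M * |y| := fun u y hy =>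
    quot_bound (by positivity) (PP_abs hM u hy)
  have hI : ∀ (u : ℝ → ℝ) (x : ℝ), |∫ y in (0:ℝ)..pr x, AA M u y| ≤ L * M * pr x ^ 2 :=
    fun u x => int_abs (by positivity) (hprabs x) (hAb u)
  have hB : ∀ (u : ℝ → ℝ) (x : ℝ), |α + ∫ y in (0:ℝ)..pr x, AA M u y| ≤ M := by
    intro u x
    have h1 := hI u x
    have h2 : L * M * pr x ^ 2 ≤ L * M * δ ^ 2 := by
      have := hprsq x
      gcongr
    have := abs_add_le α (∫ y in (0:ℝ)..pr x, AA M u y)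
    linarith
  have hcont : ∀ u : ℝ → ℝ, Continuous u →
      Continuous (fun x => α + ∫ y in (0:ℝ)..pr x, AA M u y) := by
    intro u hu
    have h1 : Continuous (fun x => ∫ y in (0:ℝ)..x, AA M u y) :=
      continuous_iff_continuousAt.2 fun x =>
        ((AA_cont hM hu).integral_hasStrictDerivAt 0 x).hasDerivAt.continuousAt
    exact continuous_const.add (h1.comp hprc)
  let T : BoundedContinuousFunction ℝ ℝ → BoundedContinuousFunction ℝ ℝ := fun u =>
    BoundedContinuousFunction.ofNormedAddCommGroup
      (fun x => α + ∫ y in (0:ℝ)..pr x, AA M u y) (hcont u u.continuous) M (hB u)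
  have hT : ContractingWith (1 / 2) T := by
    refine ⟨by norm_num, LipschitzWith.of_dist_le_mul fun u w => ?_⟩
    rw [BoundedContinuousFunction.dist_le (by positivity)]
    intro x
    have hd : ∀ z, |u z - w z| ≤ dist u w := fun z => by
      rw [← Real.dist_eq]; exact BoundedContinuousFunction.dist_coe_le_dist z
    change dist (α + ∫ y in (0:ℝ)..pr x, AA M u y) (α + ∫ y in (0:ℝ)..pr x, AA M w y) ≤ _
    rw [dist_add_left, Real.dist_eq, ← intervalIntegral.integral_sub
      ((AA_cont hM u.continuous).intervalIntegrable _ _)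
      ((AA_cont hM w.continuous).intervalIntegrable _ _)]
    have h := int_abs (f := fun y => AA M u y - AA M w y) (c := L * dist u w) (x := pr x)
      (by positivity) (hprabs x) (by
        intro y hy
        simp only [AA]
        rw [← sub_div]
        exact quot_bound (by positivity) (PP_sub hM u.continuous w.continuous hy hd))
    have h2 : L * pr x ^ 2 ≤ L * δ ^ 2 := by
      have := hprsq x
      gcongr
    have h3 : (((1 / 2 : NNReal)) : ℝ) = 1 / 2 := by push_cast; norm_num
    rw [h3]
    have hd0 : 0 ≤ dist u w := dist_nonneg
    nlinarith
  set u := ContractingWith.fixedPoint T hT with hu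
  have hfix : T u = u := hT.fixedPoint_isFixedPt
  have hux : ∀ x, u x = α + ∫ y in (0:ℝ)..pr x, AA M u y := fun x => by
    conv_lhs => rw [← hfix]
    rfl
  have huM : ∀ x, |u x| ≤ M := fun x => by rw [hux]; exact hB u x
  refine ⟨δ, hδ0, u, PP M u, L * M, ?_⟩
  intro x hx
  have hprx : ∀ y ∈ Set.Ioo 0 δ, pr y = y := fun y hy => by
    simp only [hpr]
    rw [min_eq_right hy.2.le, max_eq_right hy.1.le]
  refine ⟨?_, ?_, ?_⟩
  · have h1 := (((AA_cont hM u.continuous).integral_hasStrictDerivAt 0 x).hasDerivAt).const_add α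
    refine h1.congr_of_eventuallyEq ?_
    filter_upwards [Ioo_mem_nhds hx.1 hx.2] with y hy
    rw [hux y, hprx y hy]
  · refine (PP_deriv M u.continuous x).congr_deriv ?_
    simp only [rhs]
    rw [trunc_eq (huM x)]
  · rw [hux x, add_sub_cancel_left]
    have := hI u x
    rwa [hprx x hx] at this ⊢

theorem exists_near_inf (α : ℝ) : ∃ R : ℝ, 1 ≤ R ∧ ∃ F p : ℝ → ℝ, ∃ C : ℝ,
    ∀ r, R < r → SysAt F p r ∧ |F r - α / r ^ 2| ≤ C / r ^ 4 := by
  obtain ⟨δ, hδ, v, P, C, h⟩ := fixed_point α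
  refine ⟨max 1 (1 / δ), le_max_left _ _, fun r => v r⁻¹ / r ^ 2,
    fun r => -(P r⁻¹ * r ^ 2) - 2 * (r⁻¹ + (r ^ 3)⁻¹) * v r⁻¹, C, ?_⟩
  intro r hr
  have hr1 : 1 < r := (le_max_left _ _).trans_lt hr
  have hr2 : 1 / δ < r := (le_max_right _ _).trans_lt hr
  have hr0 : 0 < r := by linarith
  have hmem : r⁻¹ ∈ Set.Ioo 0 δ := by
    refine ⟨by positivity, ?_⟩
    rw [inv_lt_comm₀ hr0 hδ, ← one_div]; exact hr2
  obtain ⟨hv, hP, hb⟩ := h _ hmem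
  have hinv := hasDerivAt_inv hr0.ne'
  have hv' : HasDerivAt (fun r => v r⁻¹) _ r := hv.comp r hinv
  have hP' : HasDerivAt (fun r => P r⁻¹) _ r := hP.comp r hinv
  have hr2 : r ^ 2 + 1 ≠ 0 := by positivity
  have hr3 : 1 + r⁻¹ ^ 2 ≠ 0 := by positivity
  refine ⟨⟨?_, ?_⟩, ?_⟩
  · refine (hv'.div (hasDerivAt_pow 2 r) (by positivity)).congr_deriv ?_
    simp
    field_simp
  · have e := (hP'.mul (hasDerivAt_pow 2 r)).neg.sub
      (((hinv.add ((hasDerivAt_pow 3 r).inv (by positivity))).const_mul 2).mul hv')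
    refine e.congr_deriv ?_
    have : 2 * (v r⁻¹ / r ^ 2) = 2 * v r⁻¹ * r⁻¹ ^ 2 := by field_simp
    rw [this]
    generalize Real.sin (2 * v r⁻¹ * r⁻¹ ^ 2) = S
    simp
    field_simp
    ring
  · have : v r⁻¹ / r ^ 2 - α / r ^ 2 = (v r⁻¹ - α) / r ^ 2 := by ring
    rw [this, abs_div, abs_of_pos (by positivity : 0 < r ^ 2), div_le_iff₀ (by positivity)]
    calc _ ≤ _ := hb
      _ = _ := by field_simp

theorem stmt3 (k : ℕ) (α : ℝ) :
    ∃! F : ℝ → ℝ, IsHarmonicMapSol F ∧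
      ∃ C : ℝ, 0 < C ∧ ∀ r : ℝ, 1 ≤ r →
        |F r - (k : ℝ) * Real.pi - α / r ^ 2| ≤ C / r ^ 4 := by
  obtain ⟨R, hR, F₀, p₀, C, h⟩ := exists_near_inf α
  have h' : ∀ r, R < r → SysAt (fun r => F₀ r + k * Real.pi) p₀ r := by
    intro r hr
    obtain ⟨⟨h1, h2⟩, -⟩ := h r hr
    refine ⟨h1.add_const _, ?_⟩
    have : Real.sin (2 * (F₀ r + k * Real.pi)) = Real.sin (2 * F₀ r) := by
      rw [show 2 * (F₀ r + k * Real.pi) = 2 * F₀ r + k * (2 * Real.pi) by ring,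
        Real.sin_add_nat_mul_two_pi]
    rw [this]
    exact h2
  obtain ⟨F, p, hF, hp, hs⟩ := sys_global (R + 1) (F₀ (R + 1) + k * Real.pi) (p₀ (R + 1))
  have hagree : ∀ r, R < r → F r = F₀ r + k * Real.pi := by
    intro r hr
    exact (sys_unique (F := F) (p := p) (G := fun r => F₀ r + k * Real.pi) (q := p₀)
      (a := R) (b := max (R + 2) (r + 1)) (t₀ := R + 1)
      ⟨by linarith, lt_of_lt_of_le (by linarith) (le_max_left _ _)⟩ (fun t _ => hs t)
      (fun t ht => h' t ht.1) hF hp r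
      ⟨hr, lt_of_lt_of_le (by linarith) (le_max_right _ _)⟩).1
  have hFc : Continuous F := continuous_iff_continuousAt.2 fun r => (hs r).1.continuousAt
  have hbd : ∃ C : ℝ, 0 < C ∧ ∀ r : ℝ, 1 ≤ r →
        |F r - (k : ℝ) * Real.pi - α / r ^ 2| ≤ C / r ^ 4 := by
    have hco : ContinuousOn (fun r => (F r - (k : ℝ) * Real.pi - α / r ^ 2) * r ^ 4)
        (Set.Icc 1 (R + 1)) := by
      apply ContinuousOn.mul _ (by fun_prop)
      apply ContinuousOn.sub (by fun_prop)
      apply ContinuousOn.div (by fun_prop) (by fun_prop)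
      intro x hx
      have : 0 < x := by linarith [hx.1]
      positivity
    obtain ⟨B, hB⟩ := isCompact_Icc.exists_bound_of_continuousOn hco
    refine ⟨|B| + |C| + 1, by positivity, ?_⟩
    intro r hr
    have hr0 : 0 < r := by linarith
    rcases le_or_gt r (R + 1) with hc | hc
    · have := hB r ⟨hr, hc⟩
      rw [Real.norm_eq_abs, abs_mul, abs_of_pos (by positivity : 0 < r ^ 4)] at this
      rw [le_div_iff₀ (by positivity)]
      linarith [le_abs_self B, abs_nonneg C]
    · have h1 := (h r (by linarith)).2
      rw [hagree r (by linarith), add_sub_cancel_right]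
      calc _ ≤ _ := h1
        _ ≤ _ := by gcongr; linarith [le_abs_self C, abs_nonneg B]
  refine ⟨F, ⟨isSol_of_sys hs, hbd⟩, ?_⟩
  rintro G ⟨hG, C₂, -, hb2⟩
  obtain ⟨C₁, -, hb1⟩ := hbd
  have hG' := sys_of_isSol hG
  obtain ⟨r, e1, e2⟩ := sys_agree hG' hs hb2 hb1
  funext t
  exact (sys_unique (a := min r t - 1) (b := max r t + 1) (t₀ := r)
    ⟨by linarith [min_le_left r t], by linarith [le_max_left r t]⟩
    (fun t _ => hG' t) (fun t _ => hs t) e1 e2 t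
    ⟨by linarith [min_le_right r t], by linarith [le_max_right r t]⟩).1
end

section
/- Suppose F : ℝ → ℝ is a C² solution of the harmonic map ODE such that lim_{r→-∞} F(r) = lπ and lim_{r→+∞} F(r) = kπ for some integers l, k. Then F is monotone on ℝ (either nondecreasing on ℝ or nonincreasing on ℝ). In particular, if l = k then F is the constant function F ≡ kπ. -/
open Real Filter MeasureTheory

theorem hm_energy_deriv (F : ℝ → ℝ) (h1 : ∀ r, HasDerivAt F (deriv F r) r)
    (h2 : ∀ r, HasDerivAt (deriv F) (deriv (deriv F) r) r)
    (hode : ∀ r : ℝ, (r ^ 2 + 1) * deriv (deriv F) r + 2 * r * deriv F r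
      = 2 * Real.sin (F r) * Real.cos (F r)) (r : ℝ) :
    HasDerivAt (fun r => (r ^ 2 + 1) * (deriv F r) ^ 2 / 2 - Real.sin (F r) ^ 2)
      (-(r * (deriv F r) ^ 2)) r := by
  have hq : HasDerivAt (fun r : ℝ => r ^ 2 + 1) (2 * r) r := by
    simpa using ((hasDerivAt_id r).pow 2).add_const 1
  have hs := (h1 r).sin
  have := ((hq.mul ((h2 r).pow 2)).div_const 2).sub (hs.pow 2)
  refine this.congr_deriv ?_
  simp
  linear_combination (deriv F r) * hode r

theorem hm_gronwall (F : ℝ → ℝ) (h1 : ∀ r, HasDerivAt F (deriv F r) r)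
    (h2 : ∀ r, HasDerivAt (deriv F) (deriv (deriv F) r) r)
    (hode : ∀ r : ℝ, (r ^ 2 + 1) * deriv (deriv F) r + 2 * r * deriv F r
      = 2 * Real.sin (F r) * Real.cos (F r)) (r₀ : ℝ)
    (hz : deriv F r₀ = 0) (hs0 : Real.sin (F r₀) = 0) (r : ℝ) : deriv F r = 0 := by
  obtain ⟨H, hH⟩ : ∃ H : ℝ → ℝ, H = fun r => ((r ^ 2 + 1) * deriv F r) ^ 2 + Real.sin (F r) ^ 2 :=
    ⟨_, rfl⟩
  obtain ⟨D, hD⟩ : ∃ D : ℝ → ℝ, D = fun r => 2 * ((r ^ 2 + 1) * deriv F r) *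
      (2 * Real.sin (F r) * Real.cos (F r)) + 2 * Real.sin (F r) * Real.cos (F r) * deriv F r :=
    ⟨_, rfl⟩
  have hd : ∀ r, HasDerivAt H (D r) r := by
    intro r
    have hq : HasDerivAt (fun r : ℝ => r ^ 2 + 1) (2 * r) r := by
      simpa using ((hasDerivAt_id r).pow 2).add_const 1
    have := ((hq.mul (h2 r)).pow 2).add ((h1 r).sin.pow 2)
    rw [hH, hD]
    refine this.congr_deriv ?_
    simp
    linear_combination 2 * ((r ^ 2 + 1) * deriv F r) * hode r
  have hb : ∀ r, |D r| ≤ 3 * H r := by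
    intro r
    have e : D r = (2 * (r ^ 2 + 1) + 1) * deriv F r * (2 * Real.sin (F r)) * Real.cos (F r) := by
      rw [hD]; ring
    have hc := Real.abs_cos_le_one (F r)
    have a1 : |(2 * (r ^ 2 + 1) + 1) * deriv F r| ≤ 3 * |(r ^ 2 + 1) * deriv F r| := by
      rw [abs_mul, abs_mul, abs_of_pos (by positivity : 0 < 2 * (r ^ 2 + 1) + 1),
        abs_of_pos (by positivity : 0 < r ^ 2 + 1)]
      nlinarith [mul_nonneg (sq_nonneg r) (abs_nonneg (deriv F r))]
    have a2 : |D r| ≤ 3 * |(r ^ 2 + 1) * deriv F r| * (2 * |Real.sin (F r)|) * 1 := by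
      rw [e, abs_mul, abs_mul, abs_mul 2 (Real.sin _), abs_two]
      gcongr
    have a3 : H r = |(r ^ 2 + 1) * deriv F r| ^ 2 + |Real.sin (F r)| ^ 2 := by
      rw [hH]; simp only [sq_abs]
    rw [a3]
    nlinarith [sq_nonneg (|(r ^ 2 + 1) * deriv F r| - |Real.sin (F r)|)]
  have hH0 : H r₀ = 0 := by rw [hH]; simp [hz, hs0]
  have hexp : ∀ c x : ℝ, HasDerivAt (fun x => H x * Real.exp (c * x))
      ((D x + c * H x) * Real.exp (c * x)) x := by
    intro c x
    have := (hd x).mul (((hasDerivAt_id x).const_mul c).exp)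
    refine this.congr_deriv ?_
    simp
    ring
  have hle : H r ≤ 0 := by
    rcases le_total r₀ r with h | h
    · have hA : Antitone (fun x => H x * Real.exp (-3 * x)) := by
        refine antitone_of_deriv_nonpos (fun x => (hexp _ x).differentiableAt) fun x => ?_
        rw [(hexp _ x).deriv]
        have := (abs_le.1 (hb x)).2
        exact mul_nonpos_of_nonpos_of_nonneg (by linarith) (Real.exp_pos _).le
      have := hA h
      simp only [hH0, zero_mul] at this
      exact nonpos_of_mul_nonpos_left this (Real.exp_pos _)
    · have hA : Monotone (fun x => H x * Real.exp (3 * x)) := by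
        refine monotone_of_deriv_nonneg (fun x => (hexp _ x).differentiableAt) fun x => ?_
        rw [(hexp _ x).deriv]
        have := (abs_le.1 (hb x)).1
        exact mul_nonneg (by linarith) (Real.exp_pos _).le
      have := hA h
      simp only [hH0, zero_mul] at this
      exact nonpos_of_mul_nonpos_left this (Real.exp_pos _)
  rw [hH] at hle
  have h3 : ((r ^ 2 + 1) * deriv F r) ^ 2 = 0 :=
    le_antisymm (by nlinarith [sq_nonneg (Real.sin (F r))]) (sq_nonneg _)
  have h4 := pow_eq_zero_iff (two_ne_zero) |>.1 h3
  have : r ^ 2 + 1 ≠ 0 := by positivity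
  simpa [this] using h4

theorem stmt4 (F : ℝ → ℝ) (hF : IsHarmonicMapSol F) (l k : ℤ)
    (hl : Tendsto F atBot (nhds ((l : ℝ) * Real.pi)))
    (hk : Tendsto F atTop (nhds ((k : ℝ) * Real.pi))) :
    (Monotone F ∨ Antitone F) ∧ (l = k → F = fun _ => (k : ℝ) * Real.pi) := by
  obtain ⟨hC, hE⟩ := hF
  have hdF : Differentiable ℝ F := hC.differentiable (by norm_num)
  have hC1 : ContDiff ℝ 1 (deriv F) := by
    have : ContDiff ℝ (1 + 1) F := by simpa [one_add_one_eq_two] using hC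
    exact (contDiff_succ_iff_deriv.1 this).2.2
  have h1 : ∀ r, HasDerivAt F (deriv F r) r := fun r => (hdF r).hasDerivAt
  have h2 : ∀ r, HasDerivAt (deriv F) (deriv (deriv F) r) r :=
    fun r => (hC1.differentiable (by norm_num) r).hasDerivAt
  have hode : ∀ r : ℝ, (r ^ 2 + 1) * deriv (deriv F) r + 2 * r * deriv F r
      = 2 * Real.sin (F r) * Real.cos (F r) := by
    intro r
    have h := hE r
    have hp : r ^ 2 + 1 ≠ 0 := by positivity
    rw [Real.sin_two_mul] at h
    field_simp at h
    linarith
  have hmain : Monotone F ∨ Antitone F := by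
    by_cases hex : ∃ r₀, deriv F r₀ = 0
    · obtain ⟨r₀, hr₀⟩ := hex
      have hed := hm_energy_deriv F h1 h2 hode
      have hcont : Continuous (fun r => (r ^ 2 + 1) * (deriv F r) ^ 2 / 2 - Real.sin (F r) ^ 2) :=
        continuous_iff_continuousAt.2 fun x => (hed x).continuousAt
      have hs0 : Real.sin (F r₀) ^ 2 ≤ 0 := by
        have hlim : ∀ (m : ℤ) (f : Filter ℝ), Tendsto F f (nhds ((m : ℝ) * Real.pi)) →
            Tendsto (fun r => Real.sin (F r) ^ 2) f (nhds 0) := by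
          intro m f hf
          have := ((Real.continuous_sin.tendsto _).comp hf).pow 2
          simpa [Real.sin_int_mul_pi] using this
        rcases le_total 0 r₀ with h0 | h0
        · refine ge_of_tendsto (hlim k _ hk) ?_
          filter_upwards [eventually_ge_atTop r₀] with r hr
          have hA : AntitoneOn (fun r => (r ^ 2 + 1) * (deriv F r) ^ 2 / 2
              - Real.sin (F r) ^ 2) (Set.Ici 0) := by
            refine antitoneOn_of_deriv_nonpos (convex_Ici 0) hcont.continuousOn
              (fun x _ => (hed x).differentiableAt.differentiableWithinAt) fun x hx => ?_
            rw [(hed x).deriv]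
            simp only [interior_Ici, Set.mem_Ioi] at hx
            have := mul_nonneg hx.le (sq_nonneg (deriv F x))
            linarith
          have := hA (Set.mem_Ici.2 h0) (Set.mem_Ici.2 (h0.trans hr)) hr
          simp only [hr₀] at this
          have h5 : 0 ≤ (r ^ 2 + 1) * (deriv F r) ^ 2 / 2 := by positivity
          nlinarith
        · refine ge_of_tendsto (hlim l _ hl) ?_
          filter_upwards [eventually_le_atBot r₀] with r hr
          have hA : MonotoneOn (fun r => (r ^ 2 + 1) * (deriv F r) ^ 2 / 2
              - Real.sin (F r) ^ 2) (Set.Iic 0) := by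
            refine monotoneOn_of_deriv_nonneg (convex_Iic 0) hcont.continuousOn
              (fun x _ => (hed x).differentiableAt.differentiableWithinAt) fun x hx => ?_
            rw [(hed x).deriv]
            simp only [interior_Iic, Set.mem_Iio] at hx
            have := mul_nonneg (neg_nonneg.2 hx.le) (sq_nonneg (deriv F x))
            linarith
          have := hA (Set.mem_Iic.2 (hr.trans h0)) (Set.mem_Iic.2 h0) hr
          simp only [hr₀] at this
          have h5 : 0 ≤ (r ^ 2 + 1) * (deriv F r) ^ 2 / 2 := by positivity
          nlinarith
      have hs : Real.sin (F r₀) = 0 :=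
        pow_eq_zero_iff two_ne_zero |>.1 (le_antisymm hs0 (sq_nonneg _))
      left
      exact monotone_of_deriv_nonneg hdF fun x => (hm_gronwall F h1 h2 hode r₀ hr₀ hs x).ge
    · push Not at hex
      have hc : Continuous (deriv F) := hC1.continuous
      by_cases h0 : 0 ≤ deriv F 0
      · left
        refine monotone_of_deriv_nonneg hdF fun x => ?_
        by_contra hx
        obtain ⟨y, hy⟩ := mem_range_of_exists_le_of_exists_ge hc ⟨x, (not_le.1 hx).le⟩ ⟨0, h0⟩
        exact hex y hy
      · right
        refine antitone_of_deriv_nonpos hdF fun x => ?_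
        by_contra hx
        obtain ⟨y, hy⟩ := mem_range_of_exists_le_of_exists_ge hc ⟨0, (not_le.1 h0).le⟩
          ⟨x, (not_le.1 hx).le⟩
        exact hex y hy
  refine ⟨hmain, ?_⟩
  rintro rfl
  funext r
  rcases hmain with h | h
  · exact le_antisymm (h.ge_of_tendsto hk r) (h.le_of_tendsto hl r)
  · exact le_antisymm (h.ge_of_tendsto hl r) (h.le_of_tendsto hk r)
end
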